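/- arXiv:2311.15666 — 2 statements merged into one kernel-verified Lean document; each statement's English description precedes it below -/
import Mathlib

section
/- For every integer p ≥ 2 there exist rational numbers q1, q2, q3, q4, q5 such that ∫_0^∞ z^(4p−1)/(cos z − cosh z)^3 dz = q1·Γ(1/4)^(8p−8)/π^(2p−2) + q2·Γ(1/4)^(8p)/π^(2p+2) + q3·Γ(1/4)^(8p)/π^(2p+1) + q4·Γ(1/4)^(8p)/π^(2p) + q5·Γ(1/4)^(8p+8)/π^(2p+6). -/
open Real
open scoped Topology

/-- The `k`-th power moment of a sequence. -/
noncomputable def moment (u : ℕ → ℂ) (k : ℕ) : ℂ := ∑' n : ℕ, (n : ℂ) ^ k * u n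

theorem sum_range_two_mul_add_one {M : Type*} [AddCommMonoid M] (f : ℕ → M) (κ : ℕ) :
    ∑ m ∈ Finset.range (2 * κ + 1), f m
      = f (2 * κ) + ∑ s ∈ Finset.range κ, (f (2 * s) + f (2 * s + 1)) := by
  induction κ with
  | zero => simp
  | succ n ih =>
    rw [show 2 * (n + 1) + 1 = (2 * n + 1) + 1 + 1 by ring, Finset.sum_range_succ,
      Finset.sum_range_succ, ih, Finset.sum_range_succ, show 2 * (n + 1) = 2 * n + 1 + 1 by ring]
    abel

theorem sum_odd_choose_mul (x y : ℂ) (κ : ℕ) :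
    ∑ s ∈ Finset.range κ, ((2 * κ).choose (2 * s + 1) : ℂ) *
      (x ^ (2 * s + 1) * y ^ (2 * κ - (2 * s + 1)))
      = ((x + y) ^ (2 * κ) - (x - y) ^ (2 * κ)) / 2 := by
  have h1 := add_pow x y (2 * κ)
  have h2 := add_pow x (-y) (2 * κ)
  rw [sub_eq_add_neg x y, h1, h2, ← Finset.sum_sub_distrib]
  rw [sum_range_two_mul_add_one, add_div, Finset.sum_div]
  simp only [Nat.sub_self, pow_zero, mul_one, sub_self, zero_div, zero_add]
  refine Finset.sum_congr rfl fun s hs ↦ ?_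
  have hs' := Finset.mem_range.1 hs
  have e1 : Even (2 * κ - 2 * s) := ⟨κ - s, by omega⟩
  have e2 : Odd (2 * κ - (2 * s + 1)) := ⟨κ - s - 1, by omega⟩
  rw [e1.neg_pow, e2.neg_pow]
  ring

section Convolution

variable {u : ℕ → ℂ}

theorem summable_moment_mul (hs : ∀ k : ℕ, Summable fun n : ℕ ↦ ‖(n : ℂ) ^ k * u n‖) (i j : ℕ) :
    Summable fun p : ℕ × ℕ ↦ ((p.1 : ℂ) ^ i * u p.1) * ((p.2 : ℂ) ^ j * u p.2) :=
  summable_mul_of_summable_norm (f := fun n : ℕ ↦ (n : ℂ) ^ i * u n)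
    (g := fun n : ℕ ↦ (n : ℂ) ^ j * u n) (hs i) (hs j)

theorem summable_add_pow_mul (hs : ∀ k : ℕ, Summable fun n : ℕ ↦ ‖(n : ℂ) ^ k * u n‖) (c : ℂ)
    (k : ℕ) :
    Summable fun p : ℕ × ℕ ↦ ((p.1 : ℂ) + c * p.2) ^ k * (u p.1 * u p.2) := by
  have : (fun p : ℕ × ℕ ↦ ((p.1 : ℂ) + c * p.2) ^ k * (u p.1 * u p.2)) = fun p : ℕ × ℕ ↦
      ∑ m ∈ Finset.range (k + 1), (c ^ (k - m) * (k.choose m : ℂ)) *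
        (((p.1 : ℂ) ^ m * u p.1) * ((p.2 : ℂ) ^ (k - m) * u p.2)) := by
    funext p
    rw [add_pow, Finset.sum_mul]
    refine Finset.sum_congr rfl fun m _ ↦ ?_
    rw [mul_pow]; ring
  rw [this]
  exact summable_sum fun m _ ↦ (summable_moment_mul hs m (k - m)).mul_left _

theorem tsum_prod_eq_tsum_antidiagonal {f : ℕ × ℕ → ℂ} (hf : Summable f) :
    ∑' p, f p = ∑' n, ∑ p ∈ Finset.HasAntidiagonal.antidiagonal n, f p := by
  rw [← Finset.HasAntidiagonal.sigmaAntidiagonalEquivProd.tsum_eq f]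
  have h : Summable (f ∘ Finset.HasAntidiagonal.sigmaAntidiagonalEquivProd) :=
    Finset.HasAntidiagonal.sigmaAntidiagonalEquivProd.summable_iff.2 hf
  refine (h.tsum_sigma' fun n ↦ (hasSum_fintype _).summable).trans ?_
  refine tsum_congr fun n ↦ ?_
  rw [tsum_fintype, ← Finset.sum_coe_sort (Finset.HasAntidiagonal.antidiagonal n)]
  rfl

theorem summable_antidiagonal {f : ℕ × ℕ → ℂ} (hf : Summable f) :
    Summable fun n ↦ ∑ p ∈ Finset.HasAntidiagonal.antidiagonal n, f p := by
  have h : Summable (f ∘ Finset.HasAntidiagonal.sigmaAntidiagonalEquivProd) :=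
    Finset.HasAntidiagonal.sigmaAntidiagonalEquivProd.summable_iff.2 hf
  refine (h.sigma' fun n ↦ (hasSum_fintype _).summable).congr fun n ↦ ?_
  rw [tsum_fintype, ← Finset.sum_coe_sort (Finset.HasAntidiagonal.antidiagonal n)]
  rfl

/-- A symmetric double sum vanishing on the diagonal, arranged by differences of the indices. -/
theorem tsum_prod_eq_two_mul_tsum_sub {g : ℕ × ℕ → ℂ} (hg : Summable g)
    (hsymm : ∀ m n, g (m, n) = g (n, m)) (hdiag : ∀ n, g (n, n) = 0) :
    ∑' p, g p = 2 * ∑' p : ℕ × ℕ, g (p.2 + p.1, p.2) := by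
  classical
  set g₁ : ℕ × ℕ → ℂ := Set.indicator {p | p.2 ≤ p.1} g with hg₁
  have hs₁ : Summable g₁ := hg.indicator _
  have hsplit : ∀ p, g p = g₁ p + g₁ p.swap := by
    rintro ⟨m, n⟩
    simp only [hg₁, Set.indicator_apply, Set.mem_ofPred_eq, Prod.swap_prod_mk]
    rcases lt_trichotomy m n with h | h | h
    · simp [h.le, not_le.2 h, hsymm m n]
    · subst h; simp [hdiag]
    · simp [h.le, not_le.2 h]
  have hs₂ : Summable fun p : ℕ × ℕ ↦ g₁ p.swap :=
    (Equiv.prodComm ℕ ℕ).summable_iff.2 hs₁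
  have e₂ : ∑' p : ℕ × ℕ, g₁ p.swap = ∑' p, g₁ p := (Equiv.prodComm ℕ ℕ).tsum_eq g₁
  have hinj : Function.Injective fun p : ℕ × ℕ ↦ (p.2 + p.1, p.2) := by
    rintro ⟨a, b⟩ ⟨c, d⟩ h
    simp only [Prod.mk.injEq] at h ⊢
    omega
  have e₁ : ∑' p : ℕ × ℕ, g₁ (p.2 + p.1, p.2) = ∑' p, g₁ p := by
    refine hinj.tsum_eq (f := g₁) ?_
    rintro ⟨m, n⟩ h
    have : n ≤ m := by
      by_contra hc
      exact h (by simp [hg₁, hc])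
    exact ⟨(m - n, n), by simp [this]⟩
  rw [tsum_congr hsplit, hs₁.tsum_add hs₂, e₂, ← e₁, two_mul]
  have e₃ : ∑' p : ℕ × ℕ, g₁ (p.2 + p.1, p.2) = ∑' p : ℕ × ℕ, g (p.2 + p.1, p.2) :=
    tsum_congr fun p ↦ by simp [hg₁]
  rw [e₃]

/-- The convolution identity satisfied by the power moments of a sequence with
`u m * u n = u (m + n) * (1 + u m + u n)`. -/
theorem moment_convolution (h0 : u 0 = 0)
    (hu : ∀ m n, 1 ≤ m → 1 ≤ n → u m * u n = u (m + n) * (1 + u m + u n))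
    (hs : ∀ k : ℕ, Summable fun n : ℕ ↦ ‖(n : ℂ) ^ k * u n‖) {κ : ℕ} (hκ : 1 ≤ κ) :
    ∑' n : ℕ, (n : ℂ) ^ (2 * κ) * (u n * (1 + u n))
      + ∑ s ∈ Finset.range κ, ((2 * κ).choose (2 * s + 1) : ℂ) *
          (moment u (2 * s + 1) * moment u (2 * κ - (2 * s + 1)))
      = moment u (2 * κ + 1) / 2
        + ∑' n : ℕ, u n * (∑ l ∈ Finset.range n, (l : ℂ) ^ (2 * κ) + (n : ℂ) ^ (2 * κ) / 2) := by
  set k := 2 * κ with hk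
  have hk0 : k ≠ 0 := by omega
  have hke : Even k := ⟨κ, by omega⟩
  have hsu : ∀ k : ℕ, Summable fun n : ℕ ↦ (n : ℂ) ^ k * u n := fun k ↦ (hs k).of_norm
  have hsu0 : Summable u := by simpa using hsu 0
  have hA := summable_add_pow_mul hs 1 k
  have hB := summable_add_pow_mul hs (-1) k
  simp only [one_mul, neg_one_mul, ← sub_eq_add_neg] at hA hB
  -- the product of moments as a double sum
  have h1 : ∑ s ∈ Finset.range κ, (k.choose (2 * s + 1) : ℂ) *
      (moment u (2 * s + 1) * moment u (k - (2 * s + 1)))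
      = (∑' p : ℕ × ℕ, ((p.1 : ℂ) + p.2) ^ k * (u p.1 * u p.2)
        - ∑' p : ℕ × ℕ, ((p.1 : ℂ) - p.2) ^ k * (u p.1 * u p.2)) / 2 := by
    rw [← hA.tsum_sub hB, ← tsum_div_const]
    have : ∀ p : ℕ × ℕ, (((p.1 : ℂ) + p.2) ^ k * (u p.1 * u p.2)
        - ((p.1 : ℂ) - p.2) ^ k * (u p.1 * u p.2)) / 2
        = ∑ s ∈ Finset.range κ, (k.choose (2 * s + 1) : ℂ) *
          (((p.1 : ℂ) ^ (2 * s + 1) * u p.1) * ((p.2 : ℂ) ^ (k - (2 * s + 1)) * u p.2)) := by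
      intro p
      have := sum_odd_choose_mul (p.1 : ℂ) p.2 κ
      rw [← sub_mul, mul_div_right_comm, ← this, Finset.sum_mul]
      exact Finset.sum_congr rfl fun s _ ↦ by ring
    rw [tsum_congr this, Summable.tsum_finsetSum
      fun s _ ↦ (summable_moment_mul hs _ _).mul_left _]
    refine Finset.sum_congr rfl fun s _ ↦ ?_
    rw [tsum_mul_left, moment, moment, tsum_mul_tsum_of_summable_norm (hs _) (hs _)]
  -- the sums arranged by `m + n`
  have h2 : ∀ N : ℕ, ∑ p ∈ Finset.HasAntidiagonal.antidiagonal N,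
      ((p.1 : ℂ) + p.2) ^ k * (u p.1 * u p.2)
      = (N : ℂ) ^ k * (u N * ((N : ℂ) - 1 + 2 * ∑ m ∈ Finset.range N, u m)) := by
    intro N
    have e : ∀ p ∈ Finset.HasAntidiagonal.antidiagonal N, ((p.1 : ℂ) + p.2) ^ k * (u p.1 * u p.2)
        = (N : ℂ) ^ k * (u p.1 * u p.2) := by
      intro p hp
      rw [← Finset.HasAntidiagonal.mem_antidiagonal.1 hp]; push_cast; ring
    rw [Finset.sum_congr rfl e, ← Finset.mul_sum]
    congr 1
    rw [Finset.Nat.sum_antidiagonal_eq_sum_range_succ (fun i j ↦ u i * u j)]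
    cases N with
    | zero => simp [h0]
    | succ N =>
      rw [Finset.sum_range_succ, Finset.sum_range_succ', Nat.sub_self, h0, mul_zero, add_zero,
        zero_mul, add_zero, Finset.sum_range_succ' (fun m ↦ u m), h0, add_zero]
      have e : ∀ i ∈ Finset.range N, u (i + 1) * u (N + 1 - (i + 1))
          = u (N + 1) * (1 + u (i + 1) + u (N - 1 - i + 1)) := by
        intro i hi
        have := Finset.mem_range.1 hi
        rw [hu _ _ (by omega) (by omega), show N + 1 - (i + 1) = N - 1 - i + 1 by omega,
          show i + 1 + (N - 1 - i + 1) = N + 1 by omega]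
      rw [Finset.sum_congr rfl e, ← Finset.mul_sum, Finset.sum_add_distrib, Finset.sum_add_distrib,
        Finset.sum_range_reflect (fun i ↦ u (i + 1))]
      simp only [Finset.sum_const, Finset.card_range, nsmul_eq_mul]
      push_cast
      ring
  have hA' := summable_antidiagonal hA
  rw [h1, tsum_prod_eq_tsum_antidiagonal hA, tsum_congr h2]
  simp_rw [h2] at hA'
  -- the sums arranged by `m - n`
  have hB' : Summable fun p : ℕ × ℕ ↦ (p.1 : ℂ) ^ k * (u (p.2 + p.1) * u p.2) := by
    have hinj : Function.Injective fun p : ℕ × ℕ ↦ (p.2 + p.1, p.2) := by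
      rintro ⟨a, b⟩ ⟨c, d⟩ h
      simp only [Prod.mk.injEq] at h ⊢
      omega
    refine (hB.comp_injective hinj).congr fun p ↦ ?_
    simp
  have hBt : ∑' p : ℕ × ℕ, ((p.1 : ℂ) - p.2) ^ k * (u p.1 * u p.2)
      = 2 * ∑' p : ℕ × ℕ, (p.1 : ℂ) ^ k * (u (p.2 + p.1) * u p.2) := by
    rw [tsum_prod_eq_two_mul_tsum_sub hB]
    · simp
    · intro m n
      simp only
      rw [← hke.neg_pow]; ring
    · simp [hk0]
  have hR : ∀ N : ℕ, Summable fun n : ℕ ↦ u (n + 1 + N) := fun N ↦ by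
    have := (summable_nat_add_iff (1 + N)).2 hsu0
    simpa [add_assoc] using this
  have hBrow : ∀ N : ℕ, ∑' n : ℕ, (N : ℂ) ^ k * (u (n + N) * u n)
      = (N : ℂ) ^ k * (u N * (∑ m ∈ Finset.range N, u m + u N)) -
        (N : ℂ) ^ k * ∑' n : ℕ, u (n + 1 + N) := by
    intro N
    rcases Nat.eq_zero_or_pos N with rfl | hN
    · simp [hk0]
    rw [tsum_mul_left, ← mul_sub]
    congr 1
    have hrow : Summable fun n : ℕ ↦ u (n + N) * u n := by
      refine (((hB'.prod_factor N)).mul_left (((N : ℂ) ^ k)⁻¹)).congr fun n ↦ ?_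
      have : (N : ℂ) ^ k ≠ 0 := pow_ne_zero _ (by exact_mod_cast hN.ne')
      field_simp
    rw [hrow.tsum_eq_zero_add, h0, mul_zero, zero_add]
    have e : ∀ n : ℕ, u (n + 1 + N) * u (n + 1)
        = u N * (u (n + 1) - u (n + 1 + N)) - u (n + 1 + N) := by
      intro n
      have := hu (n + 1) N (by omega) hN
      linear_combination -this
    have hR0 := hR 0
    simp only [add_zero] at hR0
    rw [tsum_congr e, Summable.tsum_sub ((hR0.sub (hR N)).mul_left _) (hR N), tsum_mul_left,
      hR0.tsum_sub (hR N)]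
    congr 2
    have := hR0.sum_add_tsum_nat_add N
    have h3 : ∑' n : ℕ, u (n + 1 + N) = ∑' n : ℕ, u (n + N + 1) :=
      tsum_congr fun n ↦ by congr 1; omega
    rw [h3, ← this, add_sub_cancel_right, ← Finset.sum_range_succ, Finset.sum_range_succ', h0,
      add_zero]
  -- the tails
  have hT : Summable fun p : ℕ × ℕ ↦ (p.1 : ℂ) ^ k * u (p.2 + 1 + p.1) := by
    have hdom : Summable fun n : ℕ ↦ ∑ p ∈ Finset.HasAntidiagonal.antidiagonal n,
        ‖(p.1 : ℂ) ^ k * u (p.2 + 1 + p.1)‖ := by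
      have h4 : Summable fun n : ℕ ↦ ‖((n + 1 : ℕ) : ℂ) ^ (k + 1) * u (n + 1)‖ :=
        (summable_nat_add_iff 1).2 (hs (k + 1))
      refine Summable.of_nonneg_of_le (fun n ↦ Finset.sum_nonneg fun _ _ ↦ norm_nonneg _) ?_ h4
      intro n
      have e : ∀ p ∈ Finset.HasAntidiagonal.antidiagonal n, ‖(p.1 : ℂ) ^ k * u (p.2 + 1 + p.1)‖
          ≤ ((n + 1 : ℕ) : ℝ) ^ k * ‖u (n + 1)‖ := by
        intro p hp
        have hp := Finset.HasAntidiagonal.mem_antidiagonal.1 hp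
        rw [show p.2 + 1 + p.1 = n + 1 by omega, norm_mul, norm_pow, Complex.norm_natCast]
        gcongr
        omega
      refine (Finset.sum_le_sum e).trans ?_
      rw [Finset.sum_const, Finset.Nat.card_antidiagonal, nsmul_eq_mul, norm_mul, norm_pow,
        Complex.norm_natCast]
      exact le_of_eq (by ring)
    have h5 : Summable ((fun p : ℕ × ℕ ↦ ‖(p.1 : ℂ) ^ k * u (p.2 + 1 + p.1)‖) ∘
        Finset.HasAntidiagonal.sigmaAntidiagonalEquivProd) := by
      refine (summable_sigma_of_nonneg fun _ ↦ norm_nonneg _).2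
        ⟨fun n ↦ (hasSum_fintype _).summable, hdom.congr fun n ↦ ?_⟩
      rw [tsum_fintype, ← Finset.sum_coe_sort (Finset.HasAntidiagonal.antidiagonal n)]
      rfl
    exact (Finset.HasAntidiagonal.sigmaAntidiagonalEquivProd.summable_iff.1 h5).of_norm
  have h6 : ∀ n : ℕ, ∑ p ∈ Finset.HasAntidiagonal.antidiagonal n, (p.1 : ℂ) ^ k * u (p.2 + 1 + p.1)
      = u (n + 1) * ∑ l ∈ Finset.range (n + 1), (l : ℂ) ^ k := by
    intro n
    rw [Finset.Nat.sum_antidiagonal_eq_sum_range_succ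
      (fun i j ↦ (i : ℂ) ^ k * u (j + 1 + i)), Finset.mul_sum]
    refine Finset.sum_congr rfl fun i hi ↦ ?_
    have := Finset.mem_range.1 hi
    rw [show n - i + 1 + i = n + 1 by omega]; ring
  have hsT : Summable fun n : ℕ ↦ u n * ∑ l ∈ Finset.range n, (l : ℂ) ^ k := by
    have h7 := summable_antidiagonal hT
    simp_rw [h6] at h7
    exact (summable_nat_add_iff 1).1 h7
  have hTt : ∑' N : ℕ, (N : ℂ) ^ k * ∑' n : ℕ, u (n + 1 + N)
      = ∑' n : ℕ, u n * ∑ l ∈ Finset.range n, (l : ℂ) ^ k := by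
    simp_rw [← tsum_mul_left]
    rw [← hT.tsum_prod, tsum_prod_eq_tsum_antidiagonal hT, tsum_congr h6, hsT.tsum_eq_zero_add]
    simp
  have hsR : Summable fun N : ℕ ↦ (N : ℂ) ^ k * ∑' n : ℕ, u (n + 1 + N) := by
    have := hT.prod
    simpa only [tsum_mul_left] using this
  have hsP : Summable fun N : ℕ ↦ (N : ℂ) ^ k * (u N * (∑ m ∈ Finset.range N, u m + u N)) := by
    have := hB'.prod
    simp only [hBrow] at this
    simpa using this.add hsR
  rw [hBt, hB'.tsum_prod, tsum_congr hBrow, hsP.tsum_sub hsR, hTt]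
  have hsq : Summable fun n : ℕ ↦ (n : ℂ) ^ k * (u n * (1 + u n)) := by
    have h9 := (hsP.mul_left 2).sub hA'
    refine ((h9.add ((hsu (k+1)).sub (hsu k))).mul_left (1/2)).add (hsu k) |>.congr fun n ↦ ?_
    ring
  have hs10 : Summable fun n : ℕ ↦ (n : ℂ) ^ k * u n / 2 := (hsu k).div_const 2
  have e11 : ∑' n : ℕ, u n * (∑ l ∈ Finset.range n, (l : ℂ) ^ k + (n : ℂ) ^ k / 2)
      = ∑' n : ℕ, u n * ∑ l ∈ Finset.range n, (l : ℂ) ^ k + ∑' n : ℕ, (n : ℂ) ^ k * u n / 2 := by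
    rw [← hsT.tsum_add hs10]
    exact tsum_congr fun n ↦ by ring
  have e12 : ∑' n : ℕ, (n : ℂ) ^ k * (u n * (1 + u n))
      + (∑' n : ℕ, (n : ℂ) ^ k * (u n * ((n : ℂ) - 1 + 2 * ∑ m ∈ Finset.range n, u m))
        - 2 * ∑' n : ℕ, (n : ℂ) ^ k * (u n * (∑ m ∈ Finset.range n, u m + u n))) / 2
      = moment u (k + 1) / 2 + ∑' n : ℕ, (n : ℂ) ^ k * u n / 2 := by
    rw [moment, ← tsum_mul_left, ← hA'.tsum_sub (hsP.mul_left 2), ← tsum_div_const,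
      ← hsq.tsum_add ((hA'.sub (hsP.mul_left 2)).div_const 2), ← tsum_div_const,
      ← ((hsu (k+1)).div_const 2).tsum_add hs10]
    exact tsum_congr fun n ↦ by ring
  rw [e11]
  linear_combination e12

end Convolution

/-- Euler's convolution identity for the Bernoulli numbers. -/
theorem sum_antidiagonal_bernoulli_mul_bernoulli (n : ℕ) :
    ∑ p ∈ Finset.HasAntidiagonal.antidiagonal (n + 1),
      (bernoulli p.1 / p.1.factorial) * (bernoulli p.2 / p.2.factorial)
      = -(n : ℚ) * (bernoulli (n + 1) / (n + 1).factorial) - bernoulli n / n.factorial := by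
  set S := bernoulliPowerSeries ℚ with hS
  set E := PowerSeries.exp ℚ with hE
  have h1 : S * (E - 1) = PowerSeries.X := bernoulliPowerSeries_mul_exp_sub_one ℚ
  have h2 : PowerSeries.derivative ℚ S * (E - 1) + S * E = 1 := by
    have := congrArg (PowerSeries.derivative ℚ) h1
    simp only [Derivation.leibniz, smul_eq_mul, map_sub, Derivation.map_one_eq_zero, sub_zero,
      PowerSeries.derivative_X] at this
    have h3 : PowerSeries.derivative ℚ E = E := PowerSeries.derivative_exp ℚ
    rw [h3] at this
    linear_combination this
  have h3 : S * S = S - PowerSeries.X * PowerSeries.derivative ℚ S - PowerSeries.X * S := by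
    linear_combination S * h2 - PowerSeries.derivative ℚ S * h1 - S * h1
  have hc : ∀ m, PowerSeries.coeff m S = bernoulli m / m.factorial := by
    intro m
    simp [hS, bernoulliPowerSeries]
  have h4 := congrArg (PowerSeries.coeff (n + 1)) h3
  rw [PowerSeries.coeff_mul, map_sub, map_sub, PowerSeries.coeff_succ_X_mul,
    PowerSeries.coeff_succ_X_mul, PowerSeries.coeff_derivative] at h4
  simp only [hc] at h4
  rw [h4]
  ring

/-- The constant term of the `q`-expansion of an Eisenstein series of weight `2 * κ`, up to sign. -/
noncomputable def eisConst (κ : ℕ) : ℚ := bernoulli (2 * κ) / (4 * κ)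

theorem choose_div_factorial (κ s : ℕ) (hs : s < κ) :
    ((2 * κ).choose (2 * s + 1) : ℚ) / ((4 * (s + 1)) * (4 * (κ - s)))
      = (2 * κ).factorial / (4 * (2 * (s + 1)).factorial * (2 * (κ - s)).factorial) := by
  obtain ⟨t, rfl⟩ : ∃ t, κ = s + 1 + t := ⟨κ - s - 1, by omega⟩
  rw [Nat.cast_choose ℚ (by omega : 2 * s + 1 ≤ 2 * (s + 1 + t)),
    show 2 * (s + 1 + t) - (2 * s + 1) = 2 * t + 1 by omega,
    show s + 1 + t - s = t + 1 by omega, show 2 * (s + 1) = (2 * s + 1) + 1 by ring,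
    show 2 * (t + 1) = (2 * t + 1) + 1 by ring, Nat.factorial_succ (2 * s + 1),
    Nat.factorial_succ (2 * t + 1)]
  have h1 : ((2 * s + 1).factorial : ℚ) ≠ 0 := by positivity
  have h2 : ((2 * t + 1).factorial : ℚ) ≠ 0 := by positivity
  have h3 : ((t : ℚ) + 1) ≠ 0 := by positivity
  have h4 : ((s : ℚ) + 1) ≠ 0 := by positivity
  push_cast
  have h5 : (2 * (s : ℚ) + 1 + 1) ≠ 0 := by positivity
  have h6 : (2 * (t : ℚ) + 1 + 1) ≠ 0 := by positivity
  have h7 : ((s : ℚ) + 1 + t - s) ≠ 0 := by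
    rw [show (s : ℚ) + 1 + t - s = t + 1 by ring]; exact h3
  field_simp
  ring

theorem sum_eisConst_mul_eisConst {κ : ℕ} (hκ : 1 ≤ κ) :
    ∑ s ∈ Finset.range κ, ((2 * κ).choose (2 * s + 1) : ℚ) *
        (eisConst (s + 1) * eisConst (κ - s))
      = -((2 * κ + 3) / (2 * (2 * κ + 1)) * eisConst (κ + 1)) := by
  have h := sum_antidiagonal_bernoulli_mul_bernoulli (2 * κ + 1)
  rw [Finset.Nat.sum_antidiagonal_eq_sum_range_succ
    (fun i j ↦ (bernoulli i / i.factorial) * (bernoulli j / j.factorial)),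
    bernoulli_eq_zero_of_odd (n := 2 * κ + 1) ⟨κ, rfl⟩ (by omega),
    show (2 * κ + 1 + 1).succ = 2 * (κ + 1) + 1 by omega, sum_range_two_mul_add_one] at h
  have hodd : ∀ s ∈ Finset.range (κ + 1),
      bernoulli (2 * s) / (2 * s).factorial *
          (bernoulli (2 * κ + 1 + 1 - 2 * s) / (2 * κ + 1 + 1 - 2 * s).factorial) +
        bernoulli (2 * s + 1) / (2 * s + 1).factorial *
          (bernoulli (2 * κ + 1 + 1 - (2 * s + 1)) / (2 * κ + 1 + 1 - (2 * s + 1)).factorial)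
      = bernoulli (2 * s) / (2 * s).factorial *
          (bernoulli (2 * (κ + 1 - s)) / (2 * (κ + 1 - s)).factorial) := by
    intro s hs
    have hs := Finset.mem_range.1 hs
    have : bernoulli (2 * s + 1) * bernoulli (2 * κ + 1 + 1 - (2 * s + 1)) = 0 := by
      rcases Nat.eq_zero_or_pos s with rfl | h0
      · rw [bernoulli_eq_zero_of_odd (n := 2 * κ + 1 + 1 - (2 * 0 + 1)) ⟨κ, by omega⟩ (by omega),
          mul_zero]
      · rw [bernoulli_eq_zero_of_odd (n := 2 * s + 1) ⟨s, rfl⟩ (by omega), zero_mul]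
    rw [div_mul_div_comm (bernoulli (2 * s + 1)), this, zero_div, add_zero,
      show 2 * κ + 1 + 1 - 2 * s = 2 * (κ + 1 - s) by omega]
  rw [Finset.sum_congr rfl hodd, Finset.sum_range_succ', ← add_assoc] at h
  simp only [Nat.sub_zero, mul_zero, bernoulli_zero, Nat.factorial_zero, Nat.cast_one,
    one_mul, div_one, zero_div, sub_zero, show 2 * κ + 1 + 1 = 2 * (κ + 1) by ring,
    Nat.sub_self, mul_one, Nat.add_sub_add_right] at h
  have e : ∀ s ∈ Finset.range κ, ((2 * κ).choose (2 * s + 1) : ℚ) *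
        (eisConst (s + 1) * eisConst (κ - s))
      = (2 * κ).factorial / 4 * (bernoulli (2 * (s + 1)) / (2 * (s + 1)).factorial *
          (bernoulli (2 * (κ - s)) / (2 * (κ - s)).factorial)) := by
    intro s hs
    have hs := Finset.mem_range.1 hs
    have := choose_div_factorial κ s hs
    rw [eisConst, eisConst, Nat.cast_sub hs.le, div_mul_div_comm]
    push_cast
    rw [mul_div_assoc', mul_div_right_comm, this]
    field_simp
  rw [Finset.sum_congr rfl e, ← Finset.mul_sum]
  have h5 : ∑ s ∈ Finset.range κ, (bernoulli (2 * (s + 1)) / (2 * (s + 1)).factorial *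
          (bernoulli (2 * (κ - s)) / (2 * (κ - s)).factorial))
      = -(2 * κ + 3) * (bernoulli (2 * (κ + 1)) / (2 * (κ + 1)).factorial) := by
    push_cast at h
    linear_combination h
  rw [h5, eisConst,
    show (2 * (κ + 1)).factorial = (2 * κ + 2) * ((2 * κ + 1) * (2 * κ).factorial) by
    rw [show 2 * (κ + 1) = (2 * κ + 1) + 1 by ring, Nat.factorial_succ, Nat.factorial_succ]]
  have h1 : ((2 * κ).factorial : ℚ) ≠ 0 := by positivity
  push_cast
  field_simp

/-- Faulhaber's formula for an even exponent. -/
theorem sum_range_pow_even {κ : ℕ} (hκ : 1 ≤ κ) (n : ℕ) :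
    ∑ l ∈ Finset.range n, (l : ℚ) ^ (2 * κ) + (n : ℚ) ^ (2 * κ) / 2
      = (n : ℚ) ^ (2 * κ + 1) / (2 * κ + 1) + ∑ s ∈ Finset.range κ,
        ((2 * κ).choose (2 * s + 1) : ℚ) * (2 * eisConst (s + 1)) *
          (n : ℚ) ^ (2 * κ - (2 * s + 1)) := by
  rw [sum_range_pow, sum_range_two_mul_add_one]
  have e : ∀ s, bernoulli (2 * (s + 1)) * ((2 * κ + 1).choose (2 * (s + 1)) : ℚ) *
      (n : ℚ) ^ (2 * κ + 1 - 2 * (s + 1)) / ((2 * κ : ℕ) + 1)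
      = ((2 * κ).choose (2 * s + 1) : ℚ) * (2 * eisConst (s + 1)) *
          (n : ℚ) ^ (2 * κ - (2 * s + 1)) := by
    intro s
    have h1 := Nat.add_one_mul_choose_eq (2 * κ) (2 * s + 1)
    have h2 : ((2 * κ + 1).choose (2 * (s + 1)) : ℚ) / ((2 * κ : ℕ) + 1)
        = ((2 * κ).choose (2 * s + 1) : ℚ) / (2 * (s + 1)) := by
      rw [div_eq_div_iff (by positivity) (by positivity)]
      have : ((2 * κ + 1 : ℕ) : ℚ) * ((2 * κ).choose (2 * s + 1) : ℚ) =
        ((2 * κ + 1).choose (2 * s + 1 + 1) : ℚ) * ((2 * s + 1 + 1 : ℕ) : ℚ) := by exact_mod_cast h1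
      push_cast at this ⊢
      rw [show 2 * (s + 1) = 2 * s + 1 + 1 by ring]
      linear_combination -this
    rw [eisConst, show 2 * κ + 1 - 2 * (s + 1) = 2 * κ - (2 * s + 1) by omega]
    calc _ = bernoulli (2 * (s + 1)) * (n : ℚ) ^ (2 * κ - (2 * s + 1)) *
          (((2 * κ + 1).choose (2 * (s + 1)) : ℚ) / ((2 * κ : ℕ) + 1)) := by ring
      _ = _ := by rw [h2]; push_cast; field_simp; ring
  obtain ⟨m, rfl⟩ : ∃ m, κ = m + 1 := ⟨κ - 1, by omega⟩
  have hodd : ∀ s ∈ Finset.range m, bernoulli (2 * (s + 1) + 1) = 0 := fun s _ ↦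
    bernoulli_eq_zero_of_odd ⟨s + 1, rfl⟩ (by omega)
  rw [Finset.sum_add_distrib, Finset.sum_range_succ' (fun s ↦ bernoulli (2 * s) * _ * _ / _),
    Finset.sum_range_succ' (fun s ↦ bernoulli (2 * s + 1) * _ * _ / _)]
  simp only [e]
  have z : ∑ s ∈ Finset.range m, bernoulli (2 * (s + 1) + 1) *
      ((2 * (m + 1) + 1).choose (2 * (s + 1) + 1) : ℚ) *
      (n : ℚ) ^ (2 * (m + 1) + 1 - (2 * (s + 1) + 1)) / ((2 * (m + 1) : ℕ) + 1) = 0 :=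
    Finset.sum_eq_zero fun s hs ↦ by rw [hodd s hs]; simp
  rw [z, Finset.sum_range_succ]
  simp
  field_simp
  ring

/-- The sequence `q ^ n / (1 - q ^ n)` of coefficients of Lambert series. -/
noncomputable def lambert (q : ℂ) (n : ℕ) : ℂ := q ^ n / (1 - q ^ n)

theorem lambert_zero_right (q : ℂ) : lambert q 0 = 0 := by simp [lambert]

theorem one_sub_pow_ne_zero_of_norm_lt_one {q : ℂ} (hq : ‖q‖ < 1) {n : ℕ} (hn : n ≠ 0) :
    1 - q ^ n ≠ 0 := by
  intro h
  have h1 : ‖q ^ n‖ < 1 := by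
    rw [norm_pow]
    exact pow_lt_one₀ (norm_nonneg _) hq hn
  rw [← sub_eq_zero.1 h, norm_one] at h1
  exact lt_irrefl _ h1

theorem lambert_mul {q : ℂ} (hq : ‖q‖ < 1) (m n : ℕ) (hm : 1 ≤ m) (hn : 1 ≤ n) :
    lambert q m * lambert q n = lambert q (m + n) * (1 + lambert q m + lambert q n) := by
  have h1 := one_sub_pow_ne_zero_of_norm_lt_one hq (n := m) (by omega)
  have h2 := one_sub_pow_ne_zero_of_norm_lt_one hq (n := n) (by omega)
  have h3 := one_sub_pow_ne_zero_of_norm_lt_one hq (n := m + n) (by omega)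
  simp only [lambert]
  rw [pow_add] at h3 ⊢
  field_simp
  ring

theorem norm_pow_mul_lambert_le {r : ℝ} (hr : r < 1) {q : ℂ} (hq : ‖q‖ ≤ r) (k n : ℕ) :
    ‖(n : ℂ) ^ k * lambert q n‖ ≤ (n : ℝ) ^ k * r ^ n / (1 - r) := by
  have hr0 : 0 ≤ r := (norm_nonneg _).trans hq
  rcases Nat.eq_zero_or_pos n with rfl | hn
  · rw [lambert_zero_right, mul_zero, norm_zero]
    have : 0 < 1 - r := by linarith
    positivity
  rw [lambert, norm_mul, norm_pow, Complex.norm_natCast, norm_div, norm_pow, mul_div_assoc]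
  have h1 : 1 - r ≤ ‖1 - q ^ n‖ := by
    have h2 : ‖q ^ n‖ ≤ r := by
      rw [norm_pow]
      exact (pow_le_of_le_one (norm_nonneg _) (hq.trans hr.le) hn.ne').trans hq
    have h3 := norm_sub_norm_le (1 : ℂ) (q ^ n)
    rw [norm_one] at h3
    linarith
  have : 0 < 1 - r := by linarith
  gcongr

theorem summable_pow_mul_pow_div {r : ℝ} (h0 : 0 ≤ r) (hr : r < 1) (k : ℕ) :
    Summable fun n : ℕ ↦ (n : ℝ) ^ k * r ^ n / (1 - r) := by
  have h1 : ‖r‖ < 1 := by rwa [Real.norm_of_nonneg h0]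
  have h2 : Summable fun n : ℕ ↦ (n : ℝ) ^ k * r ^ n :=
    summable_pow_mul_geometric_of_norm_lt_one k h1
  exact h2.div_const _

theorem summable_norm_pow_mul_lambert {q : ℂ} (hq : ‖q‖ < 1) (k : ℕ) :
    Summable fun n : ℕ ↦ ‖(n : ℂ) ^ k * lambert q n‖ :=
  .of_nonneg_of_le (fun _ ↦ norm_nonneg _) (norm_pow_mul_lambert_le hq le_rfl k)
    (summable_pow_mul_pow_div (norm_nonneg _) hq k)

theorem hasDerivAt_lambert {q : ℂ} (hq : ‖q‖ < 1) (n : ℕ) :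
    HasDerivAt (fun q ↦ lambert q n) (n * q ^ (n - 1) / (1 - q ^ n) ^ 2) q := by
  rcases Nat.eq_zero_or_pos n with rfl | hn
  · simpa [lambert] using hasDerivAt_const q (0 : ℂ)
  have h1 := one_sub_pow_ne_zero_of_norm_lt_one hq hn.ne'
  have h2 := (hasDerivAt_pow n q).div ((hasDerivAt_const q (1 : ℂ)).sub (hasDerivAt_pow n q)) h1
  refine h2.congr_deriv ?_
  simp only [Pi.sub_apply]
  congr 1
  ring

theorem mul_deriv_lambert {q : ℂ} (hq : ‖q‖ < 1) (n : ℕ) :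
    q * (n * q ^ (n - 1) / (1 - q ^ n) ^ 2) = n * (lambert q n * (1 + lambert q n)) := by
  rcases Nat.eq_zero_or_pos n with rfl | hn
  · simp
  have h1 := one_sub_pow_ne_zero_of_norm_lt_one hq hn.ne'
  obtain ⟨m, rfl⟩ : ∃ m, n = m + 1 := ⟨n - 1, by omega⟩
  simp only [lambert, Nat.add_sub_cancel]
  field_simp
  ring

theorem differentiableOn_moment_lambert {r : ℝ} (h0 : 0 ≤ r) (hr : r < 1) (k : ℕ) :
    DifferentiableOn ℂ (fun q ↦ moment (lambert q) k) (Metric.ball 0 r) := by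
  refine Complex.differentiableOn_tsum_of_summable_norm (summable_pow_mul_pow_div h0 hr k)
    (fun n q hq ↦ ?_)
    Metric.isOpen_ball (fun n q hq ↦ ?_)
  · have hq' : ‖q‖ < 1 := (mem_ball_zero_iff.1 hq).trans hr
    exact ((hasDerivAt_lambert hq' n).differentiableAt.const_mul _).differentiableWithinAt
  · exact norm_pow_mul_lambert_le hr (mem_ball_zero_iff.1 hq).le k n

theorem differentiableAt_moment_lambert {q : ℂ} (hq : ‖q‖ < 1) (k : ℕ) :
    DifferentiableAt ℂ (fun q ↦ moment (lambert q) k) q := by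
  obtain ⟨r, h1, h2⟩ := exists_between hq
  exact (differentiableOn_moment_lambert ((norm_nonneg _).trans h1.le) h2 k).differentiableAt
    (Metric.isOpen_ball.mem_nhds (mem_ball_zero_iff.2 h1))

theorem mul_deriv_moment_lambert {q : ℂ} (hq : ‖q‖ < 1) (k : ℕ) :
    q * deriv (fun q ↦ moment (lambert q) k) q
      = ∑' n : ℕ, (n : ℂ) ^ (k + 1) * (lambert q n * (1 + lambert q n)) := by
  obtain ⟨r, h1, h2⟩ := exists_between hq
  have h := Complex.hasSum_deriv_of_summable_norm (F := fun (n : ℕ) q ↦ (n : ℂ) ^ k * lambert q n)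
    (summable_pow_mul_pow_div ((norm_nonneg _).trans h1.le) h2 k)
    (fun n q hq ↦ ((hasDerivAt_lambert ((mem_ball_zero_iff.1 hq).trans h2)
      n).differentiableAt.const_mul _).differentiableWithinAt)
    Metric.isOpen_ball
    (fun n q hq ↦ norm_pow_mul_lambert_le h2 (mem_ball_zero_iff.1 hq).le k n)
    (mem_ball_zero_iff.2 h1)
  refine (h.mul_left q).tsum_eq.symm.trans (tsum_congr fun n ↦ ?_)
  rw [((hasDerivAt_lambert hq n).const_mul _).deriv, mul_left_comm, mul_deriv_lambert hq]
  ring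

/-- The Eisenstein series of weight `2 * κ` as a function of `q`, up to normalization. -/
noncomputable def qEis (κ : ℕ) (q : ℂ) : ℂ := moment (lambert q) (2 * κ - 1) - (eisConst κ : ℂ)

theorem differentiableAt_qEis {q : ℂ} (hq : ‖q‖ < 1) (κ : ℕ) : DifferentiableAt ℂ (qEis κ) q :=
  (differentiableAt_moment_lambert hq _).sub_const _

/-- Ramanujan's differential equations for the Eisenstein series. -/
theorem mul_deriv_qEis {q : ℂ} (hq : ‖q‖ < 1) {κ : ℕ} (hκ : 1 ≤ κ) :
    q * deriv (qEis κ) q = (2 * κ + 3) / (2 * (2 * κ + 1)) * qEis (κ + 1) q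
      - ∑ s ∈ Finset.range κ, ((2 * κ).choose (2 * s + 1) : ℂ) *
          (qEis (s + 1) q * qEis (κ - s) q) := by
  set u := lambert q
  set M := moment u
  have hs := summable_norm_pow_mul_lambert hq
  have hd : q * deriv (qEis κ) q = ∑' n : ℕ, (n : ℂ) ^ (2 * κ) * (u n * (1 + u n)) := by
    rw [show qEis κ = fun q ↦ moment (lambert q) (2 * κ - 1) - (eisConst κ : ℂ) from rfl,
      deriv_sub_const, mul_deriv_moment_lambert hq, Nat.sub_add_cancel (by omega)]
  have hF : ∑' n : ℕ, u n * (∑ l ∈ Finset.range n, (l : ℂ) ^ (2 * κ) + (n : ℂ) ^ (2 * κ) / 2)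
      = M (2 * κ + 1) / (2 * κ + 1) + ∑ s ∈ Finset.range κ,
        ((2 * κ).choose (2 * s + 1) : ℂ) * (2 * (eisConst (s + 1) : ℂ)) *
          M (2 * κ - (2 * s + 1)) := by
    have e : ∀ n : ℕ, u n * (∑ l ∈ Finset.range n, (l : ℂ) ^ (2 * κ) + (n : ℂ) ^ (2 * κ) / 2)
        = (n : ℂ) ^ (2 * κ + 1) * u n / (2 * κ + 1) + ∑ s ∈ Finset.range κ,
        ((2 * κ).choose (2 * s + 1) : ℂ) * (2 * (eisConst (s + 1) : ℂ)) *
          ((n : ℂ) ^ (2 * κ - (2 * s + 1)) * u n) := by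
      intro n
      have := congrArg (fun x : ℚ ↦ (x : ℂ)) (sum_range_pow_even hκ n)
      push_cast at this
      rw [this, mul_add, Finset.mul_sum]
      congr 1
      · ring
      · exact Finset.sum_congr rfl fun s _ ↦ by ring
    have hs' : ∀ k, Summable fun n : ℕ ↦ (n : ℂ) ^ k * u n := fun k ↦ (hs k).of_norm
    rw [tsum_congr e, ((hs' _).div_const _).tsum_add (summable_sum fun s _ ↦ (hs' _).mul_left _),
      Summable.tsum_finsetSum fun s _ ↦ (hs' _).mul_left _, tsum_div_const]
    simp only [tsum_mul_left]
    rfl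
  have hc := moment_convolution (lambert_zero_right q) (lambert_mul hq) hs hκ
  rw [hF, ← hd] at hc
  have hrefl : ∑ s ∈ Finset.range κ, ((2 * κ).choose (2 * s + 1) : ℂ) *
        ((eisConst (κ - s) : ℂ) * M (2 * s + 1))
      = ∑ s ∈ Finset.range κ, ((2 * κ).choose (2 * s + 1) : ℂ) *
        ((eisConst (s + 1) : ℂ) * M (2 * κ - (2 * s + 1))) := by
    rw [← Finset.sum_range_reflect]
    refine Finset.sum_congr rfl fun s hs ↦ ?_
    have := Finset.mem_range.1 hs
    rw [show 2 * (κ - 1 - s) + 1 = 2 * κ - (2 * s + 1) by omega, Nat.choose_symm (by omega),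
      show κ - (κ - 1 - s) = s + 1 by omega]
  have hB := congrArg (fun x : ℚ ↦ (x : ℂ)) (sum_eisConst_mul_eisConst hκ)
  push_cast at hB
  have hsum : ∑ s ∈ Finset.range κ, ((2 * κ).choose (2 * s + 1) : ℂ) *
          (qEis (s + 1) q * qEis (κ - s) q)
      = ∑ s ∈ Finset.range κ, ((2 * κ).choose (2 * s + 1) : ℂ) *
          (M (2 * s + 1) * M (2 * κ - (2 * s + 1)))
        - ∑ s ∈ Finset.range κ, ((2 * κ).choose (2 * s + 1) : ℂ) *
          ((eisConst (s + 1) : ℂ) * M (2 * κ - (2 * s + 1)))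
        - ∑ s ∈ Finset.range κ, ((2 * κ).choose (2 * s + 1) : ℂ) *
          ((eisConst (κ - s) : ℂ) * M (2 * s + 1))
        + ∑ s ∈ Finset.range κ, ((2 * κ).choose (2 * s + 1) : ℂ) *
          ((eisConst (s + 1) : ℂ) * (eisConst (κ - s) : ℂ)) := by
    rw [← Finset.sum_sub_distrib, ← Finset.sum_sub_distrib, ← Finset.sum_add_distrib]
    refine Finset.sum_congr rfl fun s hs ↦ ?_
    rw [qEis, qEis, show 2 * (s + 1) - 1 = 2 * s + 1 by omega,
      show 2 * (κ - s) - 1 = 2 * κ - (2 * s + 1) by omega]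
    ring
  have h2 : ∑ s ∈ Finset.range κ, ((2 * κ).choose (2 * s + 1) : ℂ) * (2 * (eisConst (s + 1) : ℂ)) *
          M (2 * κ - (2 * s + 1)) = 2 * ∑ s ∈ Finset.range κ, ((2 * κ).choose (2 * s + 1) : ℂ) *
          ((eisConst (s + 1) : ℂ) * M (2 * κ - (2 * s + 1))) := by
    rw [Finset.mul_sum]
    exact Finset.sum_congr rfl fun s _ ↦ by ring
  have h3 : (2 * (κ : ℂ) + 1) ≠ 0 := by exact_mod_cast (by omega : 2 * κ + 1 ≠ 0)
  have h4 : M (2 * κ + 1) / 2 + M (2 * κ + 1) / (2 * κ + 1)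
      = (2 * κ + 3) / (2 * (2 * κ + 1)) * M (2 * κ + 1) := by
    field_simp
    ring
  rw [h2] at hc
  rw [hsum, hrefl, hB, qEis, show 2 * (κ + 1) - 1 = 2 * κ + 1 by omega]
  linear_combination hc + h4

/-- The nome at the point `I * (1 - t) / (1 + t)` of the upper half plane. -/
noncomputable def nome (t : ℂ) : ℂ := Complex.exp (-2 * π * ((1 - t) / (1 + t)))

theorem one_add_ne_zero_of_norm_lt_one {t : ℂ} (ht : ‖t‖ < 1) : 1 + t ≠ 0 := by
  intro h
  rw [eq_neg_of_add_eq_zero_right h, norm_neg, norm_one] at ht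
  exact lt_irrefl _ ht

theorem re_one_sub_div_one_add_pos {t : ℂ} (ht : ‖t‖ < 1) : 0 < ((1 - t) / (1 + t)).re := by
  have h0 : 0 < Complex.normSq (1 + t) :=
    Complex.normSq_pos.2 (one_add_ne_zero_of_norm_lt_one ht)
  have h1 : t.re * t.re + t.im * t.im < 1 := by
    have h2 := Complex.normSq_eq_norm_sq t
    rw [Complex.normSq_apply] at h2
    rw [h2]
    exact pow_lt_one₀ (norm_nonneg _) ht two_ne_zero
  rw [Complex.div_re, ← add_div]
  refine div_pos ?_ h0
  simp only [Complex.sub_re, Complex.add_re, Complex.sub_im, Complex.add_im, Complex.one_re,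
    Complex.one_im]
  nlinarith

theorem norm_nome_lt_one {t : ℂ} (ht : ‖t‖ < 1) : ‖nome t‖ < 1 := by
  rw [nome, Complex.norm_exp, Real.exp_lt_one_iff]
  have h := re_one_sub_div_one_add_pos ht
  have h1 : (-2 * π * ((1 - t) / (1 + t)) : ℂ) = ((-2 * π : ℝ) : ℂ) * ((1 - t) / (1 + t)) := by
    push_cast; ring
  rw [h1, Complex.re_ofReal_mul]
  nlinarith [Real.pi_pos]

theorem hasDerivAt_nome {t : ℂ} (ht : ‖t‖ < 1) :
    HasDerivAt nome (4 * π / (1 + t) ^ 2 * nome t) t := by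
  have h0 := one_add_ne_zero_of_norm_lt_one ht
  have h1 : HasDerivAt (fun t : ℂ ↦ (1 - t) / (1 + t)) (-2 / (1 + t) ^ 2) t := by
    refine (((hasDerivAt_id t).const_sub 1).div ((hasDerivAt_id t).const_add 1) h0).congr_deriv ?_
    simp only [id]
    congr 1
    ring
  refine (h1.const_mul (-2 * π : ℂ)).cexp.congr_deriv ?_
  rw [nome]
  ring

/-- The Eisenstein series of weight `2 * κ` in the variable `t`, completed in weight two. -/
noncomputable def diskEis (κ : ℕ) (t : ℂ) : ℂ :=
  ((1 + t)⁻¹) ^ (2 * κ) * qEis κ (nome t) + if κ = 1 then (1 + t)⁻¹ / (8 * π) else 0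

theorem sum_diskEis_mul_diskEis (a δ : ℂ) (S : ℕ → ℂ) (κ : ℕ) (hκ : 1 ≤ κ) :
    ∑ s ∈ Finset.range κ, ((2 * κ).choose (2 * s + 1) : ℂ) *
        ((a ^ (2 * (s + 1)) * S (s + 1) + if s + 1 = 1 then δ else 0) *
          (a ^ (2 * (κ - s)) * S (κ - s) + if κ - s = 1 then δ else 0))
      = a ^ (2 * κ + 2) * ∑ s ∈ Finset.range κ, ((2 * κ).choose (2 * s + 1) : ℂ) *
          (S (s + 1) * S (κ - s)) + 4 * κ * δ * (a ^ (2 * κ) * S κ)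
        + if κ = 1 then 2 * δ ^ 2 else 0 := by
  obtain ⟨m, rfl⟩ : ∃ m, κ = m + 1 := ⟨κ - 1, by omega⟩
  have e : ∀ s ∈ Finset.range (m + 1), ((2 * (m + 1)).choose (2 * s + 1) : ℂ) *
        ((a ^ (2 * (s + 1)) * S (s + 1) + if s + 1 = 1 then δ else 0) *
          (a ^ (2 * (m + 1 - s)) * S (m + 1 - s) + if m + 1 - s = 1 then δ else 0))
      = a ^ (2 * (m + 1) + 2) * (((2 * (m + 1)).choose (2 * s + 1) : ℂ) *
          (S (s + 1) * S (m + 1 - s)))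
        + (if s = 0 then 2 * (m + 1) * δ * (a ^ (2 * (m + 1)) * S (m + 1)) +
            (if m = 0 then 2 * δ ^ 2 else 0) else 0)
        + (if s = m then 2 * (m + 1) * δ * (a ^ (2 * (m + 1)) * S (m + 1)) else 0) := by
    intro s hs
    have hs := Finset.mem_range.1 hs
    have h1 : a ^ (2 * (m + 1) + 2) = a ^ (2 * (s + 1)) * a ^ (2 * (m + 1 - s)) := by
      rw [← pow_add]; congr 1; omega
    have h2 : (m + 1 - s = 1) = (s = m) := by
      apply propext; omega
    have h3 : (s + 1 = 1) = (s = 0) := by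
      apply propext; omega
    rw [h1]
    simp only [h2, h3]
    have c0 : ((2 * (m + 1)).choose (2 * 0 + 1) : ℂ) = 2 * (m + 1) := by simp
    have cm : ((2 * (m + 1)).choose (2 * m + 1) : ℂ) = 2 * (m + 1) := by
      rw [show 2 * (m + 1) = (2 * m + 1) + 1 by ring, Nat.choose_succ_self_right]
      push_cast; ring
    rcases eq_or_ne s 0 with rfl | h0
    · rcases eq_or_ne m 0 with rfl | hm
      · simp
        ring
      · simp only [if_true, hm.symm, hm, if_false, c0, Nat.sub_zero]
        ring_nf
    · rcases eq_or_ne s m with rfl | hm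
      · simp only [if_true, h0, if_false, cm, show s + 1 - s = 1 by omega]
        ring
      · simp only [h0, hm, if_false]
        ring
  rw [Finset.sum_congr rfl e, Finset.sum_add_distrib, Finset.sum_add_distrib,
    Finset.sum_ite_eq' , Finset.sum_ite_eq', ← Finset.mul_sum]
  simp only [Finset.mem_range, Nat.succ_pos, Nat.lt_succ_self, if_true, Nat.add_eq_right]
  push_cast
  ring

theorem differentiableAt_diskEis {t : ℂ} (ht : ‖t‖ < 1) (κ : ℕ) :
    DifferentiableAt ℂ (diskEis κ) t := by
  have h0 := one_add_ne_zero_of_norm_lt_one ht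
  have h1 : DifferentiableAt ℂ (fun t : ℂ ↦ (1 + t)⁻¹) t :=
    ((differentiableAt_id).const_add 1).inv h0
  have h2 := (differentiableAt_qEis (norm_nome_lt_one ht) κ).comp t
    (hasDerivAt_nome ht).differentiableAt
  refine ((h1.pow _).mul h2).add ?_
  split_ifs
  · exact h1.div_const _
  · exact differentiableAt_const _

theorem deriv_diskEis {t : ℂ} (ht : ‖t‖ < 1) {κ : ℕ} (hκ : 1 ≤ κ) :
    deriv (diskEis κ) t = 4 * π * ((2 * κ + 3) / (2 * (2 * κ + 1)) * diskEis (κ + 1) t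
      - ∑ s ∈ Finset.range κ, ((2 * κ).choose (2 * s + 1) : ℂ) *
          (diskEis (s + 1) t * diskEis (κ - s) t)) := by
  have h0 := one_add_ne_zero_of_norm_lt_one ht
  have hq := norm_nome_lt_one ht
  have h1 : HasDerivAt (fun t : ℂ ↦ (1 + t)⁻¹) (-((1 + t)⁻¹) ^ 2) t := by
    refine (((hasDerivAt_id t).const_add 1).inv h0).congr_deriv ?_
    simp only [id]
    field_simp
  have h2 : HasDerivAt (fun t ↦ qEis κ (nome t)) _ t :=
    (differentiableAt_qEis hq κ).hasDerivAt.comp t (hasDerivAt_nome ht)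
  have h3 : HasDerivAt (fun t : ℂ ↦ if κ = 1 then (1 + t)⁻¹ / (8 * π) else 0)
      (if κ = 1 then -((1 + t)⁻¹) ^ 2 / (8 * π) else 0) t := by
    split_ifs
    · exact h1.div_const _
    · exact hasDerivAt_const _ _
  have h4 := ((h1.pow (2 * κ)).mul h2).add h3
  have h5 : deriv (diskEis κ) t = _ := h4.deriv
  rw [h5]
  have hr := mul_deriv_qEis hq hκ
  have hs := sum_diskEis_mul_diskEis (1 + t)⁻¹ ((1 + t)⁻¹ / (8 * π)) (fun s ↦ qEis s (nome t)) κ hκ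
  simp only [diskEis]
  rw [hs]
  obtain ⟨m, rfl⟩ : ∃ m, κ = m + 1 := ⟨κ - 1, by omega⟩
  have hπ : (π : ℂ) ≠ 0 := by exact_mod_cast Real.pi_ne_zero
  rw [if_neg (by omega : ¬ (m + 1 + 1 = 1)), show 4 * (π : ℂ) / (1 + t) ^ 2 * nome t
    = 4 * π * ((1 + t)⁻¹) ^ 2 * nome t by rw [inv_pow]; ring]
  rw [show deriv (qEis (m + 1)) (nome t) * (4 * π * (1 + t)⁻¹ ^ 2 * nome t)
    = 4 * π * (1 + t)⁻¹ ^ 2 * (nome t * deriv (qEis (m + 1)) (nome t)) by ring, hr]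
  set a := (1 + t)⁻¹
  simp only [Pi.pow_apply, show 2 * (m + 1) - 1 = 2 * m + 1 by omega]
  have h6 : (4 : ℂ) * π * (a / (8 * π)) = a / 2 := by field_simp; ring
  split_ifs with h
  · push_cast
    linear_combination (4 * (m + 1) * (a ^ (2 * (m + 1)) * qEis (m + 1) (nome t))
      + 2 * (a / (8 * π))) * h6
  · push_cast
    linear_combination (4 * (m + 1) * (a ^ (2 * (m + 1)) * qEis (m + 1) (nome t))) * h6

/-- The rational multiples of `γ ^ (w / 4)`, where only zero is allowed unless `4 ∣ w`. -/
def HasWeight (γ : ℂ) (w : ℕ) (x : ℂ) : Prop :=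
  ∃ r : ℚ, x = r * γ ^ (w / 4) ∧ (¬ 4 ∣ w → r = 0)

namespace HasWeight

variable {γ x y : ℂ} {w v : ℕ}

theorem zero : HasWeight γ w 0 := ⟨0, by simp, fun _ ↦ rfl⟩

theorem add (hx : HasWeight γ w x) (hy : HasWeight γ w y) : HasWeight γ w (x + y) := by
  obtain ⟨r, rfl, hr⟩ := hx
  obtain ⟨s, rfl, hs⟩ := hy
  exact ⟨r + s, by push_cast; ring, fun h ↦ by rw [hr h, hs h, add_zero]⟩

theorem ratCast_mul (c : ℚ) (hx : HasWeight γ w x) : HasWeight γ w (c * x) := by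
  obtain ⟨r, rfl, hr⟩ := hx
  exact ⟨c * r, by push_cast; ring, fun h ↦ by rw [hr h, mul_zero]⟩

theorem sum {ι : Type*} {f : ι → ℂ} {s : Finset ι} (h : ∀ i ∈ s, HasWeight γ w (f i)) :
    HasWeight γ w (∑ i ∈ s, f i) := by
  classical
  induction s using Finset.induction_on with
  | empty => exact zero
  | insert a s ha ih =>
    rw [Finset.sum_insert ha]
    exact (h a (Finset.mem_insert_self a s)).add
      (ih fun i hi ↦ h i (Finset.mem_insert_of_mem hi))

theorem mul (hx : HasWeight γ w x) (hy : HasWeight γ v y) : HasWeight γ (w + v) (x * y) := by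
  obtain ⟨r, rfl, hr⟩ := hx
  obtain ⟨s, rfl, hs⟩ := hy
  by_cases hw : 4 ∣ w
  · by_cases hv : 4 ∣ v
    · refine ⟨r * s, ?_, fun h ↦ absurd (dvd_add hw hv) h⟩
      rw [Nat.add_div_of_dvd_right hw, pow_add]
      push_cast
      ring
    · simpa [hs hv] using zero
  · simpa [hr hw] using zero

end HasWeight

/-- Weights of the Taylor coefficients of a solution of the differential equations of
`deriv_diskEis` whose values have the expected weights. -/
theorem hasWeight_iteratedDeriv {f : ℕ → ℂ → ℂ} {γ : ℂ}
    (hf : ∀ κ, AnalyticAt ℂ (f κ) 0)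
    (hode : ∀ κ, 1 ≤ κ → deriv (f κ) =ᶠ[𝓝 0] fun t ↦
      4 * π * ((2 * κ + 3) / (2 * (2 * κ + 1)) * f (κ + 1) t
      - ∑ s ∈ Finset.range κ, ((2 * κ).choose (2 * s + 1) : ℂ) * (f (s + 1) t * f (κ - s) t)))
    (h0 : ∀ κ, 1 ≤ κ → HasWeight γ (2 * κ) (f κ 0)) (a : ℕ) :
    ∀ κ, 1 ≤ κ → HasWeight γ (2 * κ + 2 * a) (iteratedDeriv a (f κ) 0 / π ^ a) := by
  have hπ : (π : ℂ) ≠ 0 := by exact_mod_cast Real.pi_ne_zero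
  have hc : ∀ (n : ℕ) κ, ContDiffAt ℂ n (f κ) 0 := fun n κ ↦ (hf κ).contDiffAt
  induction a using Nat.strong_induction_on with
  | _ a ih =>
    intro κ hκ
    cases a with
    | zero => simpa using h0 κ hκ
    | succ a =>
      have h1 : iteratedDeriv (a + 1) (f κ) 0 / π ^ (a + 1)
          = ((4 * ((2 * κ + 3) / (2 * (2 * κ + 1))) : ℚ) : ℂ) *
              (iteratedDeriv a (f (κ + 1)) 0 / π ^ a)
            + ∑ s ∈ Finset.range κ, ∑ i ∈ Finset.range (a + 1),
              ((-4 * ((2 * κ).choose (2 * s + 1) * a.choose i) : ℚ) : ℂ) *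
              ((iteratedDeriv i (f (s + 1)) 0 / π ^ i) *
                (iteratedDeriv (a - i) (f (κ - s)) 0 / π ^ (a - i))) := by
        have hm : ∀ s, ContDiffAt ℂ a (fun t ↦ f (s + 1) t * f (κ - s) t) 0 :=
          fun s ↦ (hc a _).mul (hc a _)
        have hms : ∀ s, ContDiffAt ℂ a
            (fun t ↦ ((2 * κ).choose (2 * s + 1) : ℂ) * (f (s + 1) t * f (κ - s) t)) 0 :=
          fun s ↦ contDiffAt_const.mul (hm s)
        rw [iteratedDeriv_succ', (hode κ hκ).iteratedDeriv_eq, iteratedDeriv_const_mul_field,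
          iteratedDeriv_fun_sub (contDiffAt_const.mul (hc a _)) (ContDiffAt.sum fun s _ ↦ hms s),
          iteratedDeriv_const_mul_field, iteratedDeriv_fun_sum fun s _ ↦ hms s]
        simp only [iteratedDeriv_const_mul_field, iteratedDeriv_fun_mul (hc a _) (hc a _)]
        rw [mul_sub, sub_div, sub_eq_add_neg]
        congr 1
        · push_cast
          field_simp
          ring
        · rw [Finset.mul_sum, Finset.sum_div, ← Finset.sum_neg_distrib]
          refine Finset.sum_congr rfl fun s _ ↦ ?_
          rw [Finset.mul_sum, Finset.mul_sum, Finset.sum_div, ← Finset.sum_neg_distrib]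
          refine Finset.sum_congr rfl fun i hi ↦ ?_
          have hi := Finset.mem_range_succ_iff.1 hi
          rw [show (π : ℂ) ^ (a + 1) = π * (π ^ i * π ^ (a - i)) by
            rw [← pow_add, Nat.add_sub_cancel' hi, pow_succ']]
          push_cast
          field_simp
      rw [h1]
      refine HasWeight.add ?_ (HasWeight.sum fun s hs ↦ HasWeight.sum fun i hi ↦ ?_)
      · have := ih a (by omega) (κ + 1) (by omega)
        rw [show 2 * (κ + 1) + 2 * a = 2 * κ + 2 * (a + 1) by ring] at this
        exact this.ratCast_mul _
      · have hs := Finset.mem_range.1 hs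
        have hi := Finset.mem_range.1 hi
        have := (ih i (by omega) (s + 1) (by omega)).mul (ih (a - i) (by omega) (κ - s) (by omega))
        rw [show 2 * (s + 1) + 2 * i + (2 * (κ - s) + 2 * (a - i)) = 2 * κ + 2 * (a + 1)
          by omega] at this
        exact this.ratCast_mul _

theorem analyticAt_diskEis (κ : ℕ) : AnalyticAt ℂ (diskEis κ) 0 := by
  have h : DifferentiableOn ℂ (diskEis κ) (Metric.ball 0 1) := fun t ht ↦
    (differentiableAt_diskEis (mem_ball_zero_iff.1 ht) κ).differentiableWithinAt
  exact h.analyticAt (Metric.ball_mem_nhds 0 one_pos)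

theorem hasWeight_iteratedDeriv_diskEis {γ : ℂ}
    (h0 : ∀ κ, 1 ≤ κ → HasWeight γ (2 * κ) (diskEis κ 0)) (a : ℕ) {κ : ℕ} (hκ : 1 ≤ κ) :
    HasWeight γ (2 * κ + 2 * a) (iteratedDeriv a (diskEis κ) 0 / π ^ a) := by
  refine hasWeight_iteratedDeriv analyticAt_diskEis (fun κ hκ ↦ ?_) h0 a κ hκ
  filter_upwards [Metric.ball_mem_nhds (0 : ℂ) one_pos] with t ht
  exact deriv_diskEis (mem_ball_zero_iff.1 ht) hκ

section LatticeSums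

open EisensteinSeries UpperHalfPlane

theorem tsum_eisSummand_eq_qEis {κ : ℕ} (hκ : 2 ≤ κ) (z : ℍ) :
    ∑' v, eisSummand (2 * κ : ℕ) v z = 2 * (2 * π * Complex.I) ^ (2 * κ) / (2 * κ - 1).factorial *
      qEis κ (Complex.exp (2 * π * Complex.I * z)) := by
  have hq := norm_exp_two_pi_I_lt_one z
  set q := Complex.exp (2 * π * Complex.I * z)
  rw [tsum_eisSummand_eq_tsum_sigma_mul_cexp_pow (by omega) (even_two_mul κ),
    ← tsum_pow_div_one_sub_eq_tsum_sigma hq]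
  have h1 : ∑' n : ℕ+, ((n : ℕ) : ℂ) ^ (2 * κ - 1) * q ^ (n : ℕ) / (1 - q ^ (n : ℕ))
      = moment (lambert q) (2 * κ - 1) := by
    have := tsum_zero_pnat_eq_tsum_nat (summable_norm_pow_mul_lambert hq (2 * κ - 1)).of_norm
    rw [lambert_zero_right, mul_zero, zero_add] at this
    rw [moment, ← this]
    exact tsum_congr fun n ↦ by rw [lambert, mul_div_assoc]
  have h2 := riemannZeta_two_mul_nat (k := κ) (by omega)
  rw [h1, qEis, eisConst]
  push_cast
  rw [h2, show -2 * (π : ℂ) * Complex.I = -(2 * π * Complex.I) by ring,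
    (even_two_mul κ).neg_pow]
  obtain ⟨m, rfl⟩ : ∃ m, κ = m + 1 := ⟨κ - 1, by omega⟩
  rw [show 2 * (m + 1) - 1 = 2 * m + 1 by omega, show 2 * (m + 1) = 2 * m + 1 + 1 by ring,
    Nat.factorial_succ (2 * m + 1)]
  have h3 : (2 * π * Complex.I) ^ (2 * m + 1 + 1)
      = (-1) ^ (m + 1) * (2 ^ (2 * m + 1 + 1) * (π : ℂ) ^ (2 * m + 1 + 1)) := by
    rw [mul_pow, mul_pow, show 2 * m + 1 + 1 = 2 * (m + 1) by ring, pow_mul Complex.I,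
      Complex.I_sq]
    ring
  have h4 : ((2 * m + 1).factorial : ℂ) ≠ 0 := by exact_mod_cast Nat.factorial_ne_zero _
  have h5 : (m : ℂ) + 1 ≠ 0 := by exact_mod_cast Nat.succ_ne_zero m
  have h6 : 2 * (m : ℂ) + 1 + 1 ≠ 0 := by exact_mod_cast Nat.succ_ne_zero (2 * m + 1)
  rw [h3]
  push_cast
  field_simp
  ring

/-- The Gaussian integer with the given coordinates. -/
noncomputable def gauss (p : ℤ × ℤ) : ℂ := p.1 + p.2 * Complex.I

theorem gauss_eq_zero {p : ℤ × ℤ} : gauss p = 0 ↔ p = 0 := by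
  rw [gauss, Complex.ext_iff]
  simp [Prod.ext_iff]

theorem summable_norm_gauss_pow {k : ℕ} (hk : 3 ≤ k) :
    Summable fun p : ℤ × ℤ ↦ (‖gauss p‖ ^ k)⁻¹ := by
  have h := summable_norm_eisSummand (k := k) (by omega) UpperHalfPlane.I
  rw [← (finTwoArrowEquiv ℤ).symm.summable_iff, ← (Equiv.prodComm ℤ ℤ).summable_iff] at h
  refine h.congr fun p ↦ ?_
  simp [eisSummand, gauss, add_comm]

/-- The sum of `conj w ^ a / (w + t * conj w) ^ b` over the Gaussian integers `w`. -/
noncomputable def gaussLatticeSum (a b : ℕ) (t : ℂ) : ℂ :=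
  ∑' p : ℤ × ℤ, (starRingEnd ℂ (gauss p)) ^ a / (gauss p + t * starRingEnd ℂ (gauss p)) ^ b

theorem gaussLatticeSum_eq_diskEis {κ : ℕ} (hκ : 2 ≤ κ) {t : ℂ} (ht : ‖t‖ < 1) :
    gaussLatticeSum 0 (2 * κ) t
      = 2 * (2 * π * Complex.I) ^ (2 * κ) / (2 * κ - 1).factorial * diskEis κ t := by
  have h0 := one_add_ne_zero_of_norm_lt_one ht
  have hz : 0 < (Complex.I * ((1 - t) / (1 + t))).im := by
    rw [Complex.I_mul_im]
    exact re_one_sub_div_one_add_pos ht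
  set z : ℍ := ⟨Complex.I * ((1 - t) / (1 + t)), hz⟩ with hzdef
  have hzc : (z : ℂ) = Complex.I * ((1 - t) / (1 + t)) := rfl
  have h1 : Complex.exp (2 * π * Complex.I * z) = nome t := by
    rw [nome, hzc]
    congr 1
    linear_combination (2 * π * ((1 - t) / (1 + t))) * Complex.I_mul_I
  have h2 := tsum_eisSummand_eq_qEis hκ z
  rw [h1, ← (finTwoArrowEquiv ℤ).symm.tsum_eq, ← (Equiv.prodComm ℤ ℤ).tsum_eq] at h2
  rw [diskEis, if_neg (by omega), add_zero, mul_left_comm, ← h2, ← tsum_mul_left, gaussLatticeSum]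
  refine tsum_congr fun p ↦ ?_
  have h3 : gauss p + t * starRingEnd ℂ (gauss p) = (1 + t) * ((p.2 : ℂ) * z + p.1) := by
    rw [hzc]
    simp only [gauss, map_add, map_mul, Complex.conj_I, map_intCast]
    field_simp
    ring
  rw [h3]
  simp only [eisSummand, pow_zero, mul_pow, finTwoArrowEquiv_symm_apply, Equiv.prodComm_apply,
    Prod.swap, Matrix.cons_val_zero, Matrix.cons_val_one, zpow_neg, zpow_natCast, one_div,
    mul_inv, inv_pow]

theorem norm_gauss_add_mul_conj_ge (p : ℤ × ℤ) {t : ℂ} {r : ℝ} (ht : ‖t‖ ≤ r) :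
    (1 - r) * ‖gauss p‖ ≤ ‖gauss p + t * starRingEnd ℂ (gauss p)‖ := by
  have h1 := norm_sub_le_norm_add (gauss p) (t * starRingEnd ℂ (gauss p))
  rw [norm_mul, RCLike.norm_conj] at h1
  nlinarith [norm_nonneg (gauss p)]

theorem deriv_gaussLatticeSum {a b : ℕ} (hab : a + 3 ≤ b) {t : ℂ} (ht : ‖t‖ < 1) :
    deriv (gaussLatticeSum a b) t = -b * gaussLatticeSum (a + 1) (b + 1) t := by
  obtain ⟨r, h1, h2⟩ := exists_between ht
  have hr : 0 < 1 - r := by linarith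
  have hne : ∀ p ≠ 0, ∀ s : ℂ, ‖s‖ < r → gauss p + s * starRingEnd ℂ (gauss p) ≠ 0 := by
    intro p hp s hs h
    have h3 := norm_gauss_add_mul_conj_ge p hs.le
    rw [h, norm_zero] at h3
    have : 0 < ‖gauss p‖ := norm_pos_iff.2 (gauss_eq_zero.not.2 hp)
    nlinarith
  have hd : ∀ p, ∀ s : ℂ, ‖s‖ < r →
      HasDerivAt (fun s ↦ (starRingEnd ℂ (gauss p)) ^ a /
          (gauss p + s * starRingEnd ℂ (gauss p)) ^ b)
        (-b * ((starRingEnd ℂ (gauss p)) ^ (a + 1) /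
          (gauss p + s * starRingEnd ℂ (gauss p)) ^ (b + 1))) s := by
    intro p s hs
    rcases eq_or_ne p 0 with rfl | hp
    · have : gauss 0 = 0 := gauss_eq_zero.2 rfl
      simp only [this, map_zero, mul_zero, add_zero]
      simpa using hasDerivAt_const s _
    have h3 := hne p hp s hs
    have h4 : HasDerivAt (fun s ↦ gauss p + s * starRingEnd ℂ (gauss p))
        (starRingEnd ℂ (gauss p)) s := by
      simpa using ((hasDerivAt_id s).mul_const (starRingEnd ℂ (gauss p))).const_add (gauss p)
    refine ((h4.fun_pow b).fun_inv (pow_ne_zero _ h3)).const_mul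
      ((starRingEnd ℂ (gauss p)) ^ a) |>.congr_deriv ?_
    obtain ⟨c, rfl⟩ : ∃ c, b = c + 1 := ⟨b - 1, by omega⟩
    rw [Nat.add_sub_cancel]
    field_simp
    ring
  have hle : ∀ p, ∀ s ∈ Metric.ball (0 : ℂ) r, ‖(starRingEnd ℂ (gauss p)) ^ a /
      (gauss p + s * starRingEnd ℂ (gauss p)) ^ b‖
      ≤ ((1 - r) ^ b)⁻¹ * (‖gauss p‖ ^ (b - a))⁻¹ := by
    intro p s hs
    rcases eq_or_ne p 0 with rfl | hp
    · have : gauss 0 = 0 := gauss_eq_zero.2 rfl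
      simp only [this, map_zero, mul_zero, add_zero, norm_div, norm_pow, norm_zero]
      rw [zero_pow (by omega : b ≠ 0), zero_pow (by omega : b - a ≠ 0)]
      simp
    have h3 := norm_gauss_add_mul_conj_ge p (mem_ball_zero_iff.1 hs).le
    have h5 : 0 < ‖gauss p‖ := norm_pos_iff.2 (gauss_eq_zero.not.2 hp)
    rw [norm_div, norm_pow, norm_pow, RCLike.norm_conj]
    calc _ ≤ ‖gauss p‖ ^ a / ((1 - r) * ‖gauss p‖) ^ b := by gcongr
      _ = _ := by
        obtain ⟨c, rfl⟩ : ∃ c, b = a + c := ⟨b - a, by omega⟩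
        rw [Nat.add_sub_cancel_left, mul_pow, pow_add ‖gauss p‖]
        field_simp
  have h := Complex.hasSum_deriv_of_summable_norm
    ((summable_norm_gauss_pow (k := b - a) (by omega)).mul_left _)
    (fun p s hs ↦ (hd p s (mem_ball_zero_iff.1 hs)).differentiableAt.differentiableWithinAt)
    Metric.isOpen_ball hle (mem_ball_zero_iff.2 h1)
  refine h.tsum_eq.symm.trans ?_
  rw [gaussLatticeSum, ← tsum_mul_left]
  exact tsum_congr fun p ↦ (hd p t h1).deriv

theorem iteratedDeriv_gaussLatticeSum (a : ℕ) {k : ℕ} (hk : 3 ≤ k) :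
    ∃ c : ℚ, c ≠ 0 ∧ ∀ t : ℂ, ‖t‖ < 1 →
      iteratedDeriv a (gaussLatticeSum 0 k) t = c * gaussLatticeSum a (k + a) t := by
  induction a with
  | zero => exact ⟨1, one_ne_zero, fun t _ ↦ by simp⟩
  | succ a ih =>
    obtain ⟨c, hc, h⟩ := ih
    refine ⟨c * -(k + a), mul_ne_zero hc (neg_ne_zero.2 (by positivity)), fun t ht ↦ ?_⟩
    have he : iteratedDeriv a (gaussLatticeSum 0 k) =ᶠ[𝓝 t]
        fun t ↦ (c : ℂ) * gaussLatticeSum a (k + a) t := by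
      filter_upwards [Metric.isOpen_ball.mem_nhds (mem_ball_zero_iff.2 ht)] with s hs
      exact h s (mem_ball_zero_iff.1 hs)
    rw [iteratedDeriv_succ, he.deriv_eq, deriv_const_mul_field, deriv_gaussLatticeSum (by omega) ht,
      add_assoc]
    push_cast
    ring

theorem exists_gaussLatticeSum_zero_eq {κ : ℕ} (hκ : 2 ≤ κ) :
    ∃ c : ℚ, c ≠ 0 ∧ ∀ t : ℂ, ‖t‖ < 1 →
      gaussLatticeSum 0 (2 * κ) t = c * π ^ (2 * κ) * diskEis κ t := by
  refine ⟨2 * (-1) ^ κ * 2 ^ (2 * κ) / (2 * κ - 1).factorial, ?_, fun t ht ↦ ?_⟩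
  · exact div_ne_zero (by simp) (by exact_mod_cast Nat.factorial_ne_zero _)
  · rw [gaussLatticeSum_eq_diskEis hκ ht, mul_pow, mul_pow, pow_mul Complex.I, Complex.I_sq]
    push_cast
    ring

theorem hasWeight_gaussLatticeSum {γ : ℂ}
    (h0 : ∀ κ, 1 ≤ κ → HasWeight γ (2 * κ) (diskEis κ 0)) (a : ℕ)
    {κ : ℕ} (hκ : 2 ≤ κ) :
    HasWeight γ (2 * κ + 2 * a) (gaussLatticeSum a (2 * κ + a) 0 / π ^ (2 * κ + a)) := by
  obtain ⟨c, hc, h1⟩ := exists_gaussLatticeSum_zero_eq hκ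
  obtain ⟨d, hd, h2⟩ := iteratedDeriv_gaussLatticeSum a (k := 2 * κ) (by omega)
  have h3 := h2 0 (by simp)
  have he : gaussLatticeSum 0 (2 * κ) =ᶠ[𝓝 0] fun t ↦ c * π ^ (2 * κ) * diskEis κ t := by
    filter_upwards [Metric.ball_mem_nhds (0 : ℂ) one_pos] with s hs
    exact h1 s (mem_ball_zero_iff.1 hs)
  rw [he.iteratedDeriv_eq, iteratedDeriv_const_mul_field] at h3
  have hπ : (π : ℂ) ≠ 0 := by exact_mod_cast Real.pi_ne_zero
  have hd' : (d : ℂ) ≠ 0 := by exact_mod_cast hd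
  have h4 : gaussLatticeSum a (2 * κ + a) 0 / π ^ (2 * κ + a)
      = ((c / d : ℚ) : ℂ) * (iteratedDeriv a (diskEis κ) 0 / π ^ a) := by
    push_cast
    rw [pow_add]
    field_simp
    linear_combination -h3
  rw [h4]
  exact (hasWeight_iteratedDeriv_diskEis h0 a (by omega)).ratCast_mul _

end LatticeSums

namespace PeriodPair

variable (L : PeriodPair)

theorem countable_lattice : (L.lattice : Set ℂ).Countable := by
  have : Countable L.lattice := L.latticeEquivProd.toEquiv.countable_iff.2 inferInstance
  exact this.to_set

theorem isOpen_compl_lattice : IsOpen (L.lattice : Set ℂ)ᶜ := L.isClosed_lattice.isOpen_compl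

theorem isPreconnected_compl_lattice : IsPreconnected (L.lattice : Set ℂ)ᶜ :=
  (L.countable_lattice.isConnected_compl_of_one_lt_rank (by simp)).isPreconnected

theorem eventually_notMem_lattice (x : ℂ) : ∀ᶠ z in 𝓝[≠] x, z ∉ L.lattice := by
  filter_upwards [nhdsWithin_le_nhds (L.compl_lattice_sdiff_singleton_mem_nhds x),
    self_mem_nhdsWithin] with z hz hzx h
  exact hz ⟨h, hzx⟩

theorem exists_derivWeierstrassP_ne_zero : ∃ z ∉ L.lattice, L.derivWeierstrassP z ≠ 0 := by
  by_contra! h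
  have h1 : (fun z ↦ z ^ 3 * L.derivWeierstrassPExcept 0 z) =ᶠ[𝓝[≠] 0] fun _ ↦ 2 := by
    filter_upwards [L.eventually_notMem_lattice 0, self_mem_nhdsWithin] with z hz hz0
    have h2 := L.derivWeierstrassPExcept_def 0 z
    simp only [ZeroMemClass.coe_zero, sub_zero] at h2
    rw [h2, h z hz, zero_add, mul_div_cancel₀]
    exact pow_ne_zero 3 hz0
  have h3 : ContinuousAt (fun z ↦ z ^ 3 * L.derivWeierstrassPExcept 0 z) 0 :=
    ((continuousAt_id.pow 3).mul (L.analyticAt_derivWeierstrassPExcept 0).continuousAt)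
  have h4 := tendsto_nhds_unique (h3.tendsto.mono_left nhdsWithin_le_nhds)
    ((tendsto_const_nhds (x := (2 : ℂ))).congr' h1.symm)
  norm_num at h4

theorem deriv_derivWeierstrassP {z : ℂ} (hz : z ∉ L.lattice) :
    deriv L.derivWeierstrassP z = 6 * L.weierstrassP z ^ 2 - L.g₂ / 2 := by
  have hP := L.analyticOnNhd_weierstrassP
  have hP' := L.analyticOnNhd_derivWeierstrassP
  have hP2 := hP'.deriv
  have key := hP'.eq_zero_or_eq_zero_of_mul_eq_zero
    (g := fun z ↦ deriv L.derivWeierstrassP z - (6 * L.weierstrassP z ^ 2 - L.g₂ / 2))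
    (hP2.sub (((analyticOnNhd_const).mul (hP.pow 2)).sub analyticOnNhd_const)) ?_
    L.isPreconnected_compl_lattice
  · rcases key with h | h
    · obtain ⟨w, hw, h1⟩ := L.exists_derivWeierstrassP_ne_zero
      exact absurd (h w hw) h1
    · exact sub_eq_zero.1 (h z hz)
  · intro w hw
    have hd : HasDerivAt L.weierstrassP (L.derivWeierstrassP w) w := by
      rw [← L.deriv_weierstrassP]
      exact (hP w hw).differentiableAt.hasDerivAt
    have hd' := (hP' w hw).differentiableAt.hasDerivAt
    have he : (fun z ↦ L.derivWeierstrassP z ^ 2) =ᶠ[𝓝 w]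
        fun z ↦ 4 * L.weierstrassP z ^ 3 - L.g₂ * L.weierstrassP z - L.g₃ := by
      filter_upwards [L.isOpen_compl_lattice.mem_nhds hw] with v hv
      exact L.derivWeierstrassP_sq v hv
    have h1 := (hd'.fun_pow 2).unique
      (((((hd.fun_pow 3).const_mul 4).sub (hd.const_mul L.g₂)).sub_const L.g₃).congr_of_eventuallyEq
        he)
    push_cast at h1
    simp only [pow_one] at h1
    linear_combination h1 / 2

theorem sq_mul_deriv_deriv_weierstrassPExcept :
    (fun z ↦ z ^ 2 * deriv (deriv (L.weierstrassPExcept 0)) z) =ᶠ[𝓝 0]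
      fun z ↦ 12 * L.weierstrassPExcept 0 z
        + z ^ 2 * (6 * L.weierstrassPExcept 0 z ^ 2 - 30 * L.G 4) := by
  have hmem : (↑L.lattice \ {(0 : ℂ)})ᶜ ∈ 𝓝 (0 : ℂ) := L.compl_lattice_sdiff_singleton_mem_nhds 0
  filter_upwards [hmem] with z hz
  rcases eq_or_ne z 0 with rfl | hz0
  · simp
  have hzL : z ∉ L.lattice := fun h ↦ hz ⟨h, hz0⟩
  have e1 : deriv (L.weierstrassPExcept 0) =ᶠ[𝓝 z] L.derivWeierstrassPExcept 0 := by
    filter_upwards [L.isOpen_compl_lattice_sdiff.mem_nhds hz] with w hw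
    exact L.eqOn_deriv_weierstrassPExcept_derivWeierstrassPExcept 0 hw
  have e2 : L.derivWeierstrassPExcept 0 =ᶠ[𝓝 z]
      fun w ↦ L.derivWeierstrassP w + 2 * (w ^ 3)⁻¹ := by
    filter_upwards with w
    have := L.derivWeierstrassPExcept_def 0 w
    simp only [ZeroMemClass.coe_zero, sub_zero] at this
    rw [this, div_eq_mul_inv]
  have e3 := L.weierstrassPExcept_def 0 z
  simp only [ZeroMemClass.coe_zero, sub_zero] at e3
  have hd := (L.analyticOnNhd_derivWeierstrassP z hzL).differentiableAt.hasDerivAt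
  rw [(e1.trans e2).deriv_eq, (hd.fun_add
    ((((hasDerivAt_id' z).fun_pow 3).fun_inv (pow_ne_zero 3 hz0)).const_mul 2)).deriv,
    L.deriv_derivWeierstrassP hzL, e3, g₂]

  field_simp
  ring

end PeriodPair

section Recursion

theorem iteratedDeriv_sq_mul_zero {f : ℂ → ℂ} (hf : AnalyticAt ℂ f 0) (n : ℕ) :
    iteratedDeriv (n + 2) (fun z ↦ z ^ 2 * f z) 0 = (n + 2) * (n + 1) * iteratedDeriv n f 0 := by
  rw [iteratedDeriv_fun_mul (by fun_prop) hf.contDiffAt,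
    Finset.sum_eq_single_of_mem 2 (by simp)]
  · have h := Nat.add_one_mul_choose_eq (n + 1) 1
    rw [iteratedDeriv_fun_pow_zero]
    have h2 : ((n + 2).choose 2 : ℂ) * 2 = (n + 2) * (n + 1) := by
      rw [Nat.choose_one_right] at h
      have := congrArg (Nat.cast (R := ℂ)) h
      push_cast at this
      linear_combination -this
    simp only [if_true, Nat.add_sub_cancel, Nat.factorial]
    push_cast
    linear_combination iteratedDeriv n f 0 * h2
  · intro i _ hi
    rw [iteratedDeriv_fun_pow_zero, if_neg hi]
    simp

variable (L : PeriodPair)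

theorem PeriodPair.iteratedDeriv_weierstrassPExcept_zero_recursion {n : ℕ} (hn : 1 ≤ n) :
    ((n : ℂ) - 2) * (n + 5) * iteratedDeriv (n + 2) (L.weierstrassPExcept 0) 0
      = 6 * (n + 2) * (n + 1) * ∑ i ∈ Finset.range (n + 1), n.choose i *
        (iteratedDeriv i (L.weierstrassPExcept 0) 0 *
          iteratedDeriv (n - i) (L.weierstrassPExcept 0) 0) := by
  have ha := L.analyticAt_weierstrassPExcept 0
  have hc : ContDiffAt ℂ ((n + 2 : ℕ) : WithTop ℕ∞) (L.weierstrassPExcept 0) 0 := ha.contDiffAt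
  have hc' : ContDiffAt ℂ (n : WithTop ℕ∞) (L.weierstrassPExcept 0) 0 := ha.contDiffAt
  have h := L.sq_mul_deriv_deriv_weierstrassPExcept.iteratedDeriv_eq (n + 2)
  rw [iteratedDeriv_sq_mul_zero ha.deriv.deriv, iteratedDeriv_fun_add (by fun_prop) (by fun_prop),
    iteratedDeriv_const_mul_field, iteratedDeriv_sq_mul_zero (by fun_prop),
    iteratedDeriv_fun_sub (by fun_prop) (by fun_prop), iteratedDeriv_const, if_neg (by omega),
    iteratedDeriv_const_mul_field, ← iteratedDeriv_succ', ← iteratedDeriv_succ'] at h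
  simp only [sq (L.weierstrassPExcept 0 _)] at h
  rw [iteratedDeriv_fun_mul ha.contDiffAt ha.contDiffAt] at h
  simp only [mul_assoc] at h ⊢
  linear_combination h

end Recursion

theorem gaussLatticeSum_zero_eq_mul (a b : ℕ) :
    gaussLatticeSum a b 0 = (-Complex.I) ^ (a + b) * gaussLatticeSum a b 0 := by
  let e : ℤ × ℤ ≃ ℤ × ℤ := ⟨fun p ↦ (-p.2, p.1), fun p ↦ (p.2, -p.1),
    fun p ↦ by simp, fun p ↦ by simp⟩
  have h : ∀ p, gauss (e p) = Complex.I * gauss p := by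
    intro p
    simp only [e, gauss, Equiv.coe_fn_mk]
    push_cast
    linear_combination -(p.2 : ℂ) * Complex.I_mul_I
  conv_lhs => rw [gaussLatticeSum, ← e.tsum_eq]
  rw [gaussLatticeSum, ← tsum_mul_left]
  refine tsum_congr fun p ↦ ?_
  rw [h, zero_mul, zero_mul, add_zero, add_zero, map_mul, Complex.conj_I, mul_pow, mul_pow,
    pow_add, ← Complex.inv_I, inv_pow, inv_pow]
  have := Complex.I_ne_zero
  simp only [div_eq_mul_inv, mul_inv]
  ring

theorem gaussLatticeSum_zero_eq_zero {a b : ℕ} (h : (a + b) % 4 = 2) :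
    gaussLatticeSum a b 0 = 0 := by
  have h1 := gaussLatticeSum_zero_eq_mul a b
  obtain ⟨k, hk⟩ : ∃ k, a + b = 2 * (2 * k + 1) := ⟨(a + b) / 4, by omega⟩
  rw [hk, pow_mul, neg_sq, Complex.I_sq, pow_succ, pow_mul] at h1
  norm_num at h1
  linear_combination h1 / 2

/-- The lattice of Gaussian integers. -/
noncomputable def gaussPeriodPair : PeriodPair where
  ω₁ := 1
  ω₂ := Complex.I
  indep := by
    rw [← Complex.coe_basisOneI]
    exact Complex.basisOneI.linearIndependent

theorem gaussPeriodPair_coe_symm_apply (p : ℤ × ℤ) :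
    ((gaussPeriodPair.latticeEquivProd.symm p : gaussPeriodPair.lattice) : ℂ) = gauss p := by
  rw [PeriodPair.latticeEquiv_symm_apply, gauss, gaussPeriodPair, mul_one]

theorem gaussPeriodPair_G (n : ℕ) : gaussPeriodPair.G n = gaussLatticeSum 0 n 0 := by
  rw [PeriodPair.G, ← gaussPeriodPair.latticeEquivProd.symm.toEquiv.tsum_eq, gaussLatticeSum]
  refine tsum_congr fun p ↦ ?_
  simp [gaussPeriodPair_coe_symm_apply]

theorem exists_diskEis_two_zero_eq : ∃ x : ℝ, 0 < x ∧ diskEis 2 0 = x := by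
  have hq : nome 0 = (rexp (-2 * π) : ℝ) := by
    rw [nome]
    push_cast
    congr 1
    ring
  have hlt : rexp (-2 * π) < 1 := Real.exp_lt_one_iff.2 (by linarith [Real.pi_pos])
  refine ⟨∑' n : ℕ, (n : ℝ) ^ 3 * (rexp (-2 * π) ^ n / (1 - rexp (-2 * π) ^ n)) + 1 / 240,
    ?_, ?_⟩
  · refine add_pos_of_nonneg_of_pos (tsum_nonneg fun n ↦ ?_) (by norm_num)
    have : rexp (-2 * π) ^ n ≤ 1 := pow_le_one₀ (Real.exp_pos _).le hlt.le
    have h0 := Real.exp_pos (-2 * π)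
    have : 0 ≤ 1 - rexp (-2 * π) ^ n := by linarith
    positivity
  · have hb : bernoulli 4 = -1 / 30 := by
      rw [bernoulli_eq_bernoulli'_of_ne_one (by norm_num), bernoulli'_four]
    rw [diskEis, qEis, if_neg (by norm_num), hq, eisConst, hb, moment]
    push_cast
    simp only [lambert]
    norm_num

theorem diskEis_two_zero_ne_zero : diskEis 2 0 ≠ 0 := by
  obtain ⟨x, hx, h⟩ := exists_diskEis_two_zero_eq
  rw [h]
  exact_mod_cast hx.ne'

theorem diskEis_zero_eq_zero {κ : ℕ} (hκ : 2 ≤ κ) (h : gaussLatticeSum 0 (2 * κ) 0 = 0) :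
    diskEis κ 0 = 0 := by
  obtain ⟨c, hc, h1⟩ := exists_gaussLatticeSum_zero_eq hκ
  have hπ : (π : ℂ) ≠ 0 := by exact_mod_cast Real.pi_ne_zero
  have hc' : (c : ℂ) ≠ 0 := by exact_mod_cast hc
  have h2 := h1 0 (by simp)
  rw [h, eq_comm] at h2
  exact (mul_eq_zero.1 h2).resolve_left (mul_ne_zero hc' (pow_ne_zero _ hπ))

theorem diskEis_one_zero : diskEis 1 0 = 0 := by
  obtain ⟨c, hc, h1⟩ := exists_gaussLatticeSum_zero_eq le_rfl
  have hπ : (π : ℂ) ≠ 0 := by exact_mod_cast Real.pi_ne_zero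
  have hc' : (c : ℂ) ≠ 0 := by exact_mod_cast hc
  have h3 : diskEis 3 0 = 0 := diskEis_zero_eq_zero (by norm_num) (gaussLatticeSum_zero_eq_zero rfl)
  have he : gaussLatticeSum 0 (2 * 2) =ᶠ[𝓝 0] fun t ↦ c * π ^ (2 * 2) * diskEis 2 t := by
    filter_upwards [Metric.ball_mem_nhds (0 : ℂ) one_pos] with s hs
    exact h1 s (mem_ball_zero_iff.1 hs)
  have hd := he.deriv_eq
  rw [deriv_gaussLatticeSum (by norm_num) (by simp), gaussLatticeSum_zero_eq_zero rfl, mul_zero,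
    deriv_const_mul_field, deriv_diskEis (κ := 2) (by simp) (by norm_num), h3, eq_comm] at hd
  have h5 := (mul_eq_zero.1 hd).resolve_left (mul_ne_zero hc' (pow_ne_zero _ hπ))
  have h6 := (mul_eq_zero.1 h5).resolve_left (mul_ne_zero (by norm_num) hπ)
  simp only [Finset.sum_range_succ, Finset.sum_range_zero] at h6
  norm_num [Nat.choose] at h6
  have h7 : diskEis 1 0 * diskEis 2 0 = 0 := by linear_combination -h6 / 8
  exact (mul_eq_zero.1 h7).resolve_right diskEis_two_zero_ne_zero

theorem hasWeight_iteratedDeriv_weierstrassPExcept (n : ℕ) :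
    HasWeight (diskEis 2 0) (n + 2)
      (iteratedDeriv n (gaussPeriodPair.weierstrassPExcept 0) 0 / π ^ (n + 2)) := by
  have hπ : (π : ℂ) ≠ 0 := by exact_mod_cast Real.pi_ne_zero
  have hval : ∀ {m : ℕ}, m ≠ 0 → iteratedDeriv m (gaussPeriodPair.weierstrassPExcept 0) 0
      = (m + 1).factorial * gaussPeriodPair.G (m + 2) := by
    intro m hm
    rw [PeriodPair.iteratedDeriv_weierstrassPExcept_self, if_neg hm, PeriodPair.sumInvPow_zero]
  induction n using Nat.strong_induction_on with
  | _ n ih =>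
    match n, ih with
    | 0, _ =>
      rw [iteratedDeriv_zero, PeriodPair.weierstrassPExcept_zero, zero_div]
      exact .zero
    | 1, _ =>
      rw [hval one_ne_zero, PeriodPair.G_eq_zero_of_odd _ _ (by decide), mul_zero, zero_div]
      exact .zero
    | 2, _ =>
      obtain ⟨c, hc, h⟩ := exists_gaussLatticeSum_zero_eq le_rfl
      rw [hval two_ne_zero, gaussPeriodPair_G, h 0 (by simp)]
      refine ⟨(2 + 1).factorial * c, ?_, fun h ↦ absurd ⟨1, rfl⟩ h⟩
      push_cast
      field_simp
    | 3, _ =>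
      rw [hval three_ne_zero, PeriodPair.G_eq_zero_of_odd _ _ (by decide), mul_zero, zero_div]
      exact .zero
    | 4, _ =>
      rw [hval four_ne_zero, gaussPeriodPair_G, gaussLatticeSum_zero_eq_zero rfl, mul_zero,
        zero_div]
      exact .zero
    | m + 5, ih =>
      have h := gaussPeriodPair.iteratedDeriv_weierstrassPExcept_zero_recursion (n := m + 3)
        (by omega)
      have h1 : iteratedDeriv (m + 5) (gaussPeriodPair.weierstrassPExcept 0) 0 / π ^ (m + 5 + 2)
          = ((6 * (m + 5) * (m + 4) / ((m + 1) * (m + 8)) : ℚ) : ℂ) *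
            ∑ i ∈ Finset.range (m + 4), ((m + 3).choose i : ℚ) *
              (iteratedDeriv i (gaussPeriodPair.weierstrassPExcept 0) 0 / π ^ (i + 2) *
              (iteratedDeriv (m + 3 - i) (gaussPeriodPair.weierstrassPExcept 0) 0 /
                π ^ (m + 3 - i + 2))) := by
        have h2 : ∑ i ∈ Finset.range (m + 4), ((m + 3).choose i : ℚ) *
              (iteratedDeriv i (gaussPeriodPair.weierstrassPExcept 0) 0 / π ^ (i + 2) *
              (iteratedDeriv (m + 3 - i) (gaussPeriodPair.weierstrassPExcept 0) 0 /
                π ^ (m + 3 - i + 2)))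
            = (∑ i ∈ Finset.range (m + 3 + 1), (m + 3).choose i *
              (iteratedDeriv i (gaussPeriodPair.weierstrassPExcept 0) 0 *
              (iteratedDeriv (m + 3 - i) (gaussPeriodPair.weierstrassPExcept 0) 0))) /
                (π : ℂ) ^ (m + 5 + 2) := by
          rw [Finset.sum_div]
          refine Finset.sum_congr rfl fun i hi ↦ ?_
          have hi' := Finset.mem_range.1 hi
          rw [div_mul_div_comm, ← pow_add, ← mul_div_assoc, Rat.cast_natCast,
            show i + 2 + (m + 3 - i + 2) = m + 5 + 2 by omega]
        have h3 : (m : ℂ) + 1 ≠ 0 := by exact_mod_cast Nat.succ_ne_zero m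
        have h4 : (m : ℂ) + 8 ≠ 0 := by exact_mod_cast Nat.succ_ne_zero (m + 7)
        rw [h2]
        generalize (∑ i ∈ Finset.range (m + 3 + 1), ((m + 3).choose i : ℂ) *
              (iteratedDeriv i (gaussPeriodPair.weierstrassPExcept 0) 0 *
              (iteratedDeriv (m + 3 - i) (gaussPeriodPair.weierstrassPExcept 0) 0))) = S at h ⊢
        push_cast at h ⊢
        field_simp
        linear_combination h
      rw [h1]
      refine (HasWeight.sum fun i hi ↦ ?_).ratCast_mul _
      have hi' := Finset.mem_range.1 hi
      have h5 := (ih i (by omega)).mul (ih (m + 3 - i) (by omega))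
      rw [show i + 2 + (m + 3 - i + 2) = m + 5 + 2 by omega] at h5
      exact h5.ratCast_mul _

theorem hasWeight_diskEis_zero {κ : ℕ} (hκ : 1 ≤ κ) :
    HasWeight (diskEis 2 0) (2 * κ) (diskEis κ 0) := by
  obtain rfl | hκ' := hκ.eq_or_lt
  · rw [diskEis_one_zero]
    exact .zero
  obtain ⟨c, hc, h1⟩ := exists_gaussLatticeSum_zero_eq hκ'
  have hπ : (π : ℂ) ≠ 0 := by exact_mod_cast Real.pi_ne_zero
  have hc' : (c : ℂ) ≠ 0 := by exact_mod_cast hc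
  obtain ⟨m, rfl⟩ : ∃ m, κ = m + 1 := ⟨κ - 1, by omega⟩
  have h := hasWeight_iteratedDeriv_weierstrassPExcept (2 * m)
  rw [PeriodPair.iteratedDeriv_weierstrassPExcept_self, if_neg (by omega),
    PeriodPair.sumInvPow_zero, gaussPeriodPair_G, show 2 * m + 2 = 2 * (m + 1) by ring,
    h1 0 (by simp)] at h
  have hf : ((2 * m + 1).factorial : ℂ) ≠ 0 := by exact_mod_cast Nat.factorial_ne_zero _
  have := h.ratCast_mul (1 / ((2 * m + 1).factorial * c))
  convert this using 1
  push_cast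
  field_simp

section EllipticIntegral

open MeasureTheory Set Filter

theorem integral_rpow_mul_one_sub_rpow {a b : ℝ} (ha : 0 < a) (hb : 0 < b) :
    ∫ s in Ioo (0 : ℝ) 1, s ^ (a - 1) * (1 - s) ^ (b - 1)
      = Real.Gamma a * Real.Gamma b / Real.Gamma (a + b) := by
  have h := ProbabilityTheory.beta_eq_betaIntegralReal a b ha hb
  rw [ProbabilityTheory.beta, Complex.betaIntegral,
    intervalIntegral.integral_of_le zero_le_one, integral_Ioc_eq_integral_Ioo] at h
  have h2 : ∫ s in Ioo (0 : ℝ) 1, (s : ℂ) ^ ((a : ℂ) - 1) * (1 - (s : ℂ)) ^ ((b : ℂ) - 1)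
      = ∫ s in Ioo (0 : ℝ) 1, ((s ^ (a - 1) * (1 - s) ^ (b - 1) : ℝ) : ℂ) := by
    refine setIntegral_congr_fun measurableSet_Ioo fun s hs ↦ ?_
    have h3 : 0 ≤ 1 - s := by linarith [hs.2]
    push_cast
    rw [Complex.ofReal_cpow hs.1.le, Complex.ofReal_cpow h3]
    push_cast
    rfl
  rw [h, h2, integral_complex_ofReal, Complex.ofReal_re]

variable {f f' : ℝ → ℝ} {e : ℝ}

theorem le_of_sq_deriv_eq (he : 0 < e) (hf : ∀ x ∈ Ioo (0 : ℝ) 1, HasDerivAt f (f' x) x)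
    (hsq : ∀ x ∈ Ioo (0 : ℝ) 1, f' x ^ 2 = 4 * f x * (f x ^ 2 - e ^ 2))
    (hlim : Tendsto f (𝓝[>] 0) atTop) {x : ℝ} (hx : x ∈ Ioo (0 : ℝ) 1) : e ≤ f x := by
  by_contra! h
  obtain ⟨v, hv1, hv2⟩ := exists_between (max_lt h he)
  obtain ⟨y, hy1, hy2⟩ := ((hlim.eventually_gt_atTop e).and
    (Ioo_mem_nhdsGT hx.1)).exists
  have hc : ContinuousOn f (Icc y x) := fun z hz ↦
    (hf z ⟨hy2.1.trans_le hz.1, hz.2.trans_lt hx.2⟩).continuousAt.continuousWithinAt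
  obtain ⟨z, hz, rfl⟩ := intermediate_value_Icc' hy2.2.le hc
    ⟨((le_max_left _ _).trans_lt hv1).le, (hv2.trans hy1).le⟩
  have h1 := hsq z ⟨hy2.1.trans_le hz.1, hz.2.trans_lt hx.2⟩
  have h2 : 0 < f z := (le_max_right _ _).trans_lt hv1
  nlinarith [sq_nonneg (f' z), mul_pos h2 (mul_pos (sub_pos.2 hv2) (add_pos h2 he))]

theorem two_mul_sqrt_eq_integral (he : 0 < e)
    (hf : ∀ x ∈ Ioo (0 : ℝ) 1, HasDerivAt f (f' x) x)
    (hf' : ∀ x ∈ Ioo (0 : ℝ) 1, HasDerivAt f' (6 * f x ^ 2 - 2 * e ^ 2) x)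
    (hsq : ∀ x ∈ Ioo (0 : ℝ) 1, f' x ^ 2 = 4 * f x * (f x ^ 2 - e ^ 2))
    (hlim : Tendsto f (𝓝[>] 0) atTop) (hhalf : f' (1 / 2) = 0) :
    2 * √e = ∫ s in Ioo (0 : ℝ) 1, s ^ ((1 / 4 : ℝ) - 1) * (1 - s) ^ ((1 / 2 : ℝ) - 1) := by
  have hle := fun x (hx : x ∈ Ioo (0 : ℝ) 1) ↦ le_of_sq_deriv_eq he hf hsq hlim hx
  have hsub : ∀ {x : ℝ}, x ∈ Ioc (0 : ℝ) (1 / 2) → x ∈ Ioo (0 : ℝ) 1 :=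
    fun hx ↦ ⟨hx.1, by linarith [hx.2]⟩
  have hmem : (1 / 2 : ℝ) ∈ Ioc (0 : ℝ) (1 / 2) := by norm_num
  have hmono : StrictMonoOn f' (Ioc 0 (1 / 2)) := by
    refine strictMonoOn_of_deriv_pos (convex_Ioc _ _)
      (fun x hx ↦ (hf' x (hsub hx)).continuousAt.continuousWithinAt) fun x hx ↦ ?_
    have hx' := hsub (interior_subset hx)
    rw [(hf' x hx').deriv]
    nlinarith [hle x hx']
  have hneg : ∀ x ∈ Ioo (0 : ℝ) (1 / 2), f' x < 0 := fun x hx ↦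
    hhalf ▸ hmono ⟨hx.1, hx.2.le⟩ hmem hx.2
  have hanti : StrictAntiOn f (Ioc 0 (1 / 2)) := by
    refine strictAntiOn_of_deriv_neg (convex_Ioc _ _)
      (fun x hx ↦ (hf x (hsub hx)).continuousAt.continuousWithinAt) fun x hx ↦ ?_
    rw [interior_Ioc] at hx
    rw [(hf x (hsub ⟨hx.1, hx.2.le⟩)).deriv]
    exact hneg x hx
  have hfhalf : f (1 / 2) = e := by
    have h1 := hsq _ (hsub hmem)
    have h2 := hle _ (hsub hmem)
    rw [hhalf] at h1
    by_contra h
    have h3 : e < f (1 / 2) := lt_of_le_of_ne h2 (Ne.symm h)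
    nlinarith [mul_pos (he.trans h3) (mul_pos (sub_pos.2 h3) (add_pos (he.trans h3) he))]
  have hgt : ∀ x ∈ Ioo (0 : ℝ) (1 / 2), e < f x := fun x hx ↦
    hfhalf ▸ hanti ⟨hx.1, hx.2.le⟩ hmem hx.2
  have hd : ∀ x ∈ Ioo (0 : ℝ) (1 / 2),
      HasDerivAt (fun x ↦ e ^ 2 * (f x ^ 2)⁻¹) (-(2 * e ^ 2 * f' x / f x ^ 3)) x := by
    intro x hx
    have h0 : f x ≠ 0 := (he.trans (hgt x hx)).ne'
    refine ((((hf x (hsub ⟨hx.1, hx.2.le⟩)).fun_pow 2).fun_inv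
      (pow_ne_zero 2 h0)).const_mul (e ^ 2)).congr_deriv ?_
    push_cast
    field_simp
  have hinj : InjOn (fun x ↦ e ^ 2 * (f x ^ 2)⁻¹) (Ioo 0 (1 / 2)) := by
    intro x hx y hy hxy
    have h1 := he.trans (hgt x hx)
    have h2 := he.trans (hgt y hy)
    have h3 := inv_inj.1 (mul_left_cancel₀ (pow_ne_zero 2 he.ne') hxy)
    exact hanti.injOn ⟨hx.1, hx.2.le⟩ ⟨hy.1, hy.2.le⟩
      ((pow_left_inj₀ h1.le h2.le two_ne_zero).1 h3)
  have himg : (fun x ↦ e ^ 2 * (f x ^ 2)⁻¹) '' Ioo 0 (1 / 2) = Ioo 0 1 := by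
    ext s
    constructor
    · rintro ⟨x, hx, rfl⟩
      have h1 := hgt x hx
      have h2 := he.trans h1
      refine ⟨by positivity, ?_⟩
      simp only
      rw [← div_eq_mul_inv, div_lt_one (by positivity)]
      nlinarith
    · intro hs
      have hs0 := hs.1
      have h1 : e < e / √s := by
        rw [lt_div_iff₀ (by positivity)]
        have : √s < 1 := by rw [Real.sqrt_lt' one_pos]; linarith [hs.2]
        nlinarith
      obtain ⟨y, hy1, hy2⟩ := ((hlim.eventually_gt_atTop (e / √s)).and
        (Ioo_mem_nhdsGT (show (0 : ℝ) < 1 / 2 by norm_num))).exists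
      have hc : ContinuousOn f (Icc y (1 / 2)) := fun z hz ↦
        (hf z (hsub ⟨hy2.1.trans_le hz.1, hz.2⟩)).continuousAt.continuousWithinAt
      obtain ⟨z, hz, hzs⟩ := intermediate_value_Icc' hy2.2.le hc
        ⟨hfhalf.symm ▸ h1.le, hy1.le⟩
      have hz2 : z ≠ 1 / 2 := by
        rintro rfl
        rw [hfhalf] at hzs
        exact h1.ne hzs
      refine ⟨z, ⟨hy2.1.trans_le hz.1, lt_of_le_of_ne hz.2 hz2⟩, ?_⟩
      simp only [hzs, div_pow, Real.sq_sqrt hs0.le]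
      field_simp
  have key := integral_image_eq_integral_abs_deriv_smul measurableSet_Ioo
    (fun x hx ↦ (hd x hx).hasDerivWithinAt) hinj
    (fun s : ℝ ↦ s ^ ((1 / 4 : ℝ) - 1) * (1 - s) ^ ((1 / 2 : ℝ) - 1))
  rw [himg] at key
  rw [key, setIntegral_congr_fun (g := fun _ ↦ 4 * √e) measurableSet_Ioo, setIntegral_const]
  · simp
    ring
  · intro x hx
    have h1 := hgt x hx
    have h2 := he.trans h1
    have h3 := hneg x hx
    have h4 : 0 < f x ^ 2 - e ^ 2 := by nlinarith
    have h5 : f' x = -(2 * √(f x) * √(f x ^ 2 - e ^ 2)) := by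
      rw [← neg_eq_iff_eq_neg]
      refine (pow_left_inj₀ (by linarith) (by positivity) two_ne_zero).1 ?_
      rw [neg_sq, mul_pow, mul_pow, Real.sq_sqrt h2.le, Real.sq_sqrt h4.le,
        hsq x (hsub ⟨hx.1, hx.2.le⟩)]
      ring
    have h6 : (e ^ 2 * (f x ^ 2)⁻¹) ^ ((1 / 4 : ℝ) - 1) = f x * √(f x) / (e * √e) := by
      have h7 : e ^ 2 * (f x ^ 2)⁻¹ = (√e / √(f x)) ^ 4 := by
        rw [div_pow, show √e ^ 4 = (√e ^ 2) ^ 2 by ring,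
          show √(f x) ^ 4 = (√(f x) ^ 2) ^ 2 by ring, Real.sq_sqrt he.le, Real.sq_sqrt h2.le,
          div_eq_mul_inv]
      have h8 : 0 < √e / √(f x) := by positivity
      rw [h7, ← Real.rpow_natCast, ← Real.rpow_mul h8.le,
        show ((4 : ℕ) : ℝ) * (1 / 4 - 1) = -(3 : ℕ) by norm_num, Real.rpow_neg h8.le,
        Real.rpow_natCast, div_pow, inv_div, pow_succ, pow_succ √e, Real.sq_sqrt he.le,
        Real.sq_sqrt h2.le]
    have h9 : (1 - e ^ 2 * (f x ^ 2)⁻¹) ^ ((1 / 2 : ℝ) - 1) = f x / √(f x ^ 2 - e ^ 2) := by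
      have h10 : 1 - e ^ 2 * (f x ^ 2)⁻¹ = (√(f x ^ 2 - e ^ 2) / f x) ^ 2 := by
        rw [div_pow, Real.sq_sqrt h4.le]
        field_simp
      have h8 : 0 < √(f x ^ 2 - e ^ 2) / f x := by positivity
      rw [h10, ← Real.rpow_natCast, ← Real.rpow_mul h8.le,
        show ((2 : ℕ) : ℝ) * (1 / 2 - 1) = -1 by norm_num, Real.rpow_neg h8.le,
        Real.rpow_one, inv_div]
    have h11 : 0 < -(2 * e ^ 2 * f' x / f x ^ 3) := by
      rw [Left.neg_pos_iff]
      exact div_neg_of_neg_of_pos (mul_neg_of_pos_of_neg (by positivity) h3) (by positivity)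
    simp only [smul_eq_mul]
    rw [abs_of_pos h11, h6, h9, h5]
    have h12 := Real.sq_sqrt he.le
    have h13 := Real.sq_sqrt h2.le
    have h14 : 0 < √(f x ^ 2 - e ^ 2) := Real.sqrt_pos.2 h4
    have h15 : 0 < √e := Real.sqrt_pos.2 he
    field_simp
    rw [h12, h13]
    ring

end EllipticIntegral

section GaussEisensteinFour

open Filter

theorem integral_rpow_eq_Gamma_one_quarter :
    ∫ s in Set.Ioo (0 : ℝ) 1, s ^ ((1 / 4 : ℝ) - 1) * (1 - s) ^ ((1 / 2 : ℝ) - 1)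
      = Real.Gamma (1 / 4) ^ 2 / √(2 * π) := by
  have hG := Real.Gamma_pos_of_pos (show (0 : ℝ) < 1 / 4 by norm_num)
  have hπ := Real.pi_pos
  have h1 := Real.Gamma_mul_Gamma_one_sub (1 / 4)
  rw [show π * (1 / 4) = π / 4 by ring, Real.sin_pi_div_four] at h1
  rw [integral_rpow_mul_one_sub_rpow (by norm_num) (by norm_num), Real.Gamma_one_half_eq,
    show (1 / 4 : ℝ) + 1 / 2 = 1 - 1 / 4 by norm_num]
  have h2 : Real.Gamma (1 - 1 / 4) = π / (√2 / 2) / Real.Gamma (1 / 4) := by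
    rw [← h1]
    field_simp
  rw [h2, Real.sqrt_mul zero_le_two]
  field_simp
  rw [Real.sq_sqrt hπ.le, Real.sq_sqrt zero_le_two]

theorem mem_gaussPeriodPair_lattice {z : ℂ} :
    z ∈ gaussPeriodPair.lattice ↔ ∃ p, gauss p = z := by
  constructor
  · intro h
    refine ⟨gaussPeriodPair.latticeEquivProd ⟨z, h⟩, ?_⟩
    rw [← gaussPeriodPair_coe_symm_apply, LinearEquiv.symm_apply_apply]
  · rintro ⟨p, rfl⟩
    rw [← gaussPeriodPair_coe_symm_apply]
    exact SetLike.coe_mem _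

theorem ofReal_notMem_gaussPeriodPair_lattice {x : ℝ} (hx : x ∈ Set.Ioo (0 : ℝ) 1) :
    (x : ℂ) ∉ gaussPeriodPair.lattice := by
  rw [mem_gaussPeriodPair_lattice]
  rintro ⟨p, hp⟩
  have h : (p.1 : ℝ) = x := by simpa [gauss] using congrArg Complex.re hp
  rw [← h] at hx
  have h1 : 0 < p.1 := by exact_mod_cast hx.1
  have h2 : p.1 < 1 := by exact_mod_cast hx.2
  omega

theorem im_tsum_gaussPeriodPair_lattice_eq_zero (F : ℂ → ℂ)
    (hF : ∀ w, starRingEnd ℂ (F w) = F (starRingEnd ℂ w)) :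
    (∑' l : gaussPeriodPair.lattice, F l).im = 0 := by
  let e : ℤ × ℤ ≃ ℤ × ℤ := ⟨fun p ↦ (p.1, -p.2), fun p ↦ (p.1, -p.2),
    fun p ↦ by simp, fun p ↦ by simp⟩
  rw [← Complex.conj_eq_iff_im, ← gaussPeriodPair.latticeEquivProd.symm.toEquiv.tsum_eq,
    Complex.conj_tsum]
  conv_rhs => rw [← e.tsum_eq]
  refine tsum_congr fun p ↦ ?_
  rw [hF]
  simp only [LinearEquiv.coe_toEquiv, gaussPeriodPair_coe_symm_apply]
  congr 1
  simp [gauss, e]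

theorem im_weierstrassP_gaussPeriodPair (x : ℝ) : (gaussPeriodPair.weierstrassP x).im = 0 :=
  im_tsum_gaussPeriodPair_lattice_eq_zero (fun l ↦ 1 / ((x : ℂ) - l) ^ 2 - 1 / l ^ 2)
    fun w ↦ by simp

theorem im_derivWeierstrassP_gaussPeriodPair (x : ℝ) :
    (gaussPeriodPair.derivWeierstrassP x).im = 0 := by
  rw [PeriodPair.derivWeierstrassP, Complex.neg_im, neg_eq_zero]
  exact im_tsum_gaussPeriodPair_lattice_eq_zero (fun l ↦ 2 / ((x : ℂ) - l) ^ 3)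
    fun w ↦ by simp [map_ofNat]

theorem tendsto_re_weierstrassP (L : PeriodPair) :
    Tendsto (fun x : ℝ ↦ (L.weierstrassP x).re) (𝓝[>] 0) atTop := by
  have h1 : Tendsto (fun x : ℝ ↦ (L.weierstrassPExcept 0 x).re) (𝓝[>] 0) (𝓝 0) := by
    have h0 : ContinuousAt (L.weierstrassPExcept 0) ((0 : ℝ) : ℂ) := by
      rw [Complex.ofReal_zero]
      exact (L.analyticAt_weierstrassPExcept 0).continuousAt
    have h2 : ContinuousAt (fun x : ℝ ↦ (L.weierstrassPExcept 0 x).re) 0 :=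
      Complex.continuous_re.continuousAt.comp
        (h0.comp (f := fun x : ℝ ↦ (x : ℂ)) Complex.continuous_ofReal.continuousAt)
    have h3 := h2.tendsto.mono_left (nhdsWithin_le_nhds (s := Set.Ioi 0))
    simpa using h3
  have h4 : Tendsto (fun x : ℝ ↦ (x ^ 2)⁻¹) (𝓝[>] 0) atTop := by
    refine Tendsto.inv_tendsto_nhdsGT_zero (tendsto_nhdsWithin_iff.2 ⟨?_, ?_⟩)
    · have : Tendsto (fun x : ℝ ↦ x ^ 2) (𝓝 0) (𝓝 (0 ^ 2)) := (continuous_pow 2).tendsto 0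
      rw [zero_pow two_ne_zero] at this
      exact this.mono_left nhdsWithin_le_nhds
    · filter_upwards [self_mem_nhdsWithin] with x hx
      exact pow_pos (Set.mem_Ioi.1 hx) 2
  refine (h1.add_atTop h4).congr fun x ↦ ?_
  have h5 := L.weierstrassPExcept_def 0 x
  simp only [ZeroMemClass.coe_zero, sub_zero] at h5
  have h6 : ((1 / (x : ℂ) ^ 2)).re = (x ^ 2)⁻¹ := by
    rw [← Complex.ofReal_pow, one_div, ← Complex.ofReal_inv, Complex.ofReal_re]
  rw [h5, Complex.add_re, Complex.sub_re, h6]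
  simp

theorem sqrt_eq_of_g₂_eq {e : ℝ} (he : 0 < e) (hg : gaussPeriodPair.g₂ = (4 * e ^ 2 : ℝ)) :
    2 * √e = Real.Gamma (1 / 4) ^ 2 / √(2 * π) := by
  have hg₃ : gaussPeriodPair.g₃ = 0 := by
    rw [PeriodPair.g₃, gaussPeriodPair_G, gaussLatticeSum_zero_eq_zero rfl, mul_zero]
  have hP : ∀ x : ℝ, gaussPeriodPair.weierstrassP x = ((gaussPeriodPair.weierstrassP x).re : ℝ) :=
    fun x ↦ Complex.ext rfl (by simp [im_weierstrassP_gaussPeriodPair])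
  have hP' : ∀ x : ℝ, gaussPeriodPair.derivWeierstrassP x
      = ((gaussPeriodPair.derivWeierstrassP x).re : ℝ) :=
    fun x ↦ Complex.ext rfl (by simp [im_derivWeierstrassP_gaussPeriodPair])
  rw [← integral_rpow_eq_Gamma_one_quarter]
  refine two_mul_sqrt_eq_integral (f := fun x ↦ (gaussPeriodPair.weierstrassP x).re)
    (f' := fun x ↦ (gaussPeriodPair.derivWeierstrassP x).re) he ?_ ?_ ?_
    (tendsto_re_weierstrassP _) ?_
  · intro x hx
    have hx' := ofReal_notMem_gaussPeriodPair_lattice hx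
    have := (gaussPeriodPair.analyticOnNhd_weierstrassP _ hx').differentiableAt.hasDerivAt
    rw [PeriodPair.deriv_weierstrassP] at this
    exact this.real_of_complex
  · intro x hx
    have hx' := ofReal_notMem_gaussPeriodPair_lattice hx
    have := (gaussPeriodPair.analyticOnNhd_derivWeierstrassP _ hx').differentiableAt.hasDerivAt
    rw [gaussPeriodPair.deriv_derivWeierstrassP hx', hg, hP] at this
    refine this.real_of_complex.congr_deriv ?_
    rw [show 6 * (((gaussPeriodPair.weierstrassP x).re : ℝ) : ℂ) ^ 2 - ((4 * e ^ 2 : ℝ) : ℂ) / 2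
      = ((6 * (gaussPeriodPair.weierstrassP x).re ^ 2 - 2 * e ^ 2 : ℝ) : ℂ) by push_cast; ring,
      Complex.ofReal_re]
  · intro x hx
    have h := gaussPeriodPair.derivWeierstrassP_sq x (ofReal_notMem_gaussPeriodPair_lattice hx)
    rw [hg, hg₃, hP, hP'] at h
    have h2 : (gaussPeriodPair.derivWeierstrassP x).re ^ 2
        = 4 * (gaussPeriodPair.weierstrassP x).re ^ 3
          - 4 * e ^ 2 * (gaussPeriodPair.weierstrassP x).re - 0 := by exact_mod_cast h
    rw [h2]
    ring
  · have h1 := gaussPeriodPair.derivWeierstrassP_add_coe (-(1 / 2))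
      ⟨_, gaussPeriodPair.ω₁_mem_lattice⟩
    have h2 : (-(1 / 2) + gaussPeriodPair.ω₁ : ℂ) = 1 / 2 := by
      rw [gaussPeriodPair]; norm_num
    simp only [h2, PeriodPair.derivWeierstrassP_neg] at h1
    have h3 : gaussPeriodPair.derivWeierstrassP (1 / 2) = 0 := by linear_combination h1 / 2
    push_cast
    rw [h3, Complex.zero_re]

theorem exists_diskEis_two_zero_eq_ratCast_mul :
    ∃ r : ℚ, diskEis 2 0 = r * (Real.Gamma (1 / 4) ^ 8 / π ^ 6 : ℝ) := by
  obtain ⟨x, hx, h⟩ := exists_diskEis_two_zero_eq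
  have hπ := Real.pi_pos
  have hG : gaussPeriodPair.G 4 = (16 / 3 * π ^ 4 * x : ℝ) := by
    rw [gaussPeriodPair_G, gaussLatticeSum_eq_diskEis (κ := 2) le_rfl (by simp), h]
    simp only [mul_pow, show (2 * 2 : ℕ) = 4 from rfl, Complex.I_pow_four]
    simp only [Nat.factorial]
    push_cast
    ring
  have hy : 0 < 80 * π ^ 4 * x := by positivity
  have hg : gaussPeriodPair.g₂ = (4 * √(80 * π ^ 4 * x) ^ 2 : ℝ) := by
    rw [Real.sq_sqrt hy.le, PeriodPair.g₂, hG]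
    push_cast
    ring
  have key := sqrt_eq_of_g₂_eq (Real.sqrt_pos.2 hy) hg
  have h4 : (2 * √√(80 * π ^ 4 * x)) ^ 4 = 16 * (80 * π ^ 4 * x) := by
    rw [mul_pow, show √√(80 * π ^ 4 * x) ^ 4 = (√√(80 * π ^ 4 * x) ^ 2) ^ 2 by ring,
      Real.sq_sqrt (Real.sqrt_nonneg _), Real.sq_sqrt hy.le]
    norm_num
  rw [key, div_pow, show √(2 * π) ^ 4 = (√(2 * π) ^ 2) ^ 2 by ring,
    Real.sq_sqrt (by positivity)] at h4
  refine ⟨1 / 5120, ?_⟩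
  have h5 : x = 1 / 5120 * (Real.Gamma (1 / 4) ^ 8 / π ^ 6) := by
    field_simp at h4 ⊢
    linear_combination -h4
  rw [h, h5]
  push_cast
  ring

end GaussEisensteinFour

section OddLatticeSums

/-- The Gaussian integer `(2 m + 1) + (2 n + 1) i`. -/
noncomputable def oddGauss (p : ℤ × ℤ) : ℂ := gauss (2 * p.1 + 1, 2 * p.2 + 1)

theorem summable_conj_gauss_pow_div {a b : ℕ} (hab : a + 3 ≤ b) :
    Summable fun p : ℤ × ℤ ↦ starRingEnd ℂ (gauss p) ^ a / gauss p ^ b := by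
  refine Summable.of_norm_bounded (summable_norm_gauss_pow (k := b - a) (by omega)) fun p ↦ ?_
  rw [norm_div, norm_pow, norm_pow, RCLike.norm_conj]
  rcases eq_or_ne (gauss p) 0 with h | h
  · simp [h, show b ≠ 0 by omega]
  · have h' : ‖gauss p‖ ≠ 0 := norm_ne_zero_iff.2 h
    obtain ⟨c, rfl⟩ := Nat.exists_eq_add_of_le (show a ≤ b by omega)
    rw [Nat.add_sub_cancel_left, pow_add]
    apply le_of_eq
    field_simp

theorem summable_conj_oddGauss_pow_div {a b : ℕ} (hab : a + 3 ≤ b) :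
    Summable fun p : ℤ × ℤ ↦ starRingEnd ℂ (oddGauss p) ^ a / oddGauss p ^ b := by
  refine (summable_conj_gauss_pow_div hab).comp_injective
    (i := fun p : ℤ × ℤ ↦ (2 * p.1 + 1, 2 * p.2 + 1)) fun p q h ↦ ?_
  simp only [Prod.mk.injEq] at h
  exact Prod.ext (by omega) (by omega)

/-- Splitting the Gaussian integers divisible by `1 + i` according to the parity of the
coordinates. -/
def gaussParityEquiv : (ℤ × ℤ) ⊕ (ℤ × ℤ) ≃ ℤ × ℤ where
  toFun := Sum.elim (fun p ↦ (p.1 + p.2, p.2 - p.1)) (fun p ↦ (p.1 + p.2 + 1, p.2 - p.1))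
  invFun p := if 2 ∣ p.1 - p.2 then .inl ((p.1 - p.2) / 2, (p.1 + p.2) / 2)
    else .inr ((p.1 - p.2) / 2, (p.1 + p.2) / 2)
  left_inv := by
    rintro (p | p)
    · rw [Sum.elim_inl]
      refine (if_pos (by simp only; omega)).trans ?_
      congr 1
      ext <;> simp only <;> omega
    · rw [Sum.elim_inr]
      refine (if_neg (by simp only; omega)).trans ?_
      congr 1
      ext <;> simp only <;> omega
  right_inv p := by
    beta_reduce
    split_ifs with h
    · rw [Sum.elim_inl]
      ext <;> simp only <;> omega
    · rw [Sum.elim_inr]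
      ext <;> simp only <;> omega

theorem tsum_oddGauss {a b : ℕ} (hab : a + 3 ≤ b) :
    ∑' p, starRingEnd ℂ (oddGauss p) ^ a / oddGauss p ^ b
      = (2 ^ a / (1 + Complex.I) ^ (a + b) - 2 ^ a / 2 ^ b) * gaussLatticeSum a b 0 := by
  have hs := summable_conj_gauss_pow_div hab
  set f := fun p : ℤ × ℤ ↦ starRingEnd ℂ (gauss p) ^ a / gauss p ^ b with hf
  have hI : (1 + Complex.I) * (1 - Complex.I) = 2 := by
    linear_combination -Complex.I_mul_I
  have hI0 : 1 + Complex.I ≠ 0 := left_ne_zero_of_mul (hI ▸ two_ne_zero)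
  have hrot : ∀ p : ℤ × ℤ, f (p.1 - p.2, p.1 + p.2) = 2 ^ a / (1 + Complex.I) ^ (a + b) * f p := by
    intro p
    have h1 : gauss (p.1 - p.2, p.1 + p.2) = (1 + Complex.I) * gauss p := by
      simp only [gauss]
      push_cast
      linear_combination -(p.2 : ℂ) * Complex.I_mul_I
    have h2 : (1 - Complex.I) = 2 / (1 + Complex.I) := by
      rw [eq_div_iff hI0, mul_comm, hI]
    simp only [hf, h1, map_mul, map_add, map_one, Complex.conj_I, ← sub_eq_add_neg, h2, mul_pow,
      div_pow, pow_add]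
    field_simp
  have hdbl : ∀ p : ℤ × ℤ, f (2 * p.1, 2 * p.2) = 2 ^ a / 2 ^ b * f p := by
    intro p
    have h1 : gauss (2 * p.1, 2 * p.2) = 2 * gauss p := by
      simp only [gauss]
      push_cast
      ring
    simp only [hf, h1, map_mul, map_ofNat, mul_pow]
    ring
  have h1 : HasSum (fun p : ℤ × ℤ ↦ f (p.1 - p.2, p.1 + p.2))
      (2 ^ a / 2 ^ b * ∑' p, f p + ∑' p, starRingEnd ℂ (oddGauss p) ^ a / oddGauss p ^ b) := by
    rw [← gaussParityEquiv.hasSum_iff]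
    refine HasSum.sum ?_ ?_
    · convert! hs.hasSum.mul_left (2 ^ a / 2 ^ b : ℂ) using 2 with p
      rw [← hdbl]
      simp only [Function.comp_apply, gaussParityEquiv, Equiv.coe_fn_mk, Sum.elim_inl]
      congr 1
      ext <;> simp only <;> omega
    · convert! (summable_conj_oddGauss_pow_div hab).hasSum using 2 with p
      simp only [Function.comp_apply, gaussParityEquiv, Equiv.coe_fn_mk, Sum.elim_inr, hf,
        oddGauss]
      rw [show p.1 + p.2 + 1 - (p.2 - p.1) = 2 * p.1 + 1 by omega,
        show p.1 + p.2 + 1 + (p.2 - p.1) = 2 * p.2 + 1 by omega]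
  have h2 := h1.unique ((hs.hasSum.mul_left _).congr_fun hrot)
  have h3 : gaussLatticeSum a b 0 = ∑' p, f p := by
    simp only [gaussLatticeSum, zero_mul, add_zero, hf]
  rw [h3]
  linear_combination h2

theorem exists_tsum_oddGauss_eq_ratCast_mul {a κ m s : ℕ} (hκ : 2 ≤ κ) (hm : κ + a = 2 * m)
    (hs : 2 * κ + a + s = 6 * m) :
    ∃ q : ℚ, ∑' p, starRingEnd ℂ (oddGauss p) ^ a / oddGauss p ^ (2 * κ + a)
      = (q * (Real.Gamma (1 / 4) ^ (8 * m) / π ^ s) : ℝ) := by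
  obtain ⟨r, h, -⟩ := hasWeight_gaussLatticeSum (fun κ h ↦ hasWeight_diskEis_zero h) a hκ
  obtain ⟨c, hc⟩ := exists_diskEis_two_zero_eq_ratCast_mul
  have hπ : (π : ℂ) ≠ 0 := by exact_mod_cast Real.pi_ne_zero
  have hI : (1 + Complex.I) ^ (a + (2 * κ + a)) = (-4) ^ m := by
    rw [show a + (2 * κ + a) = 4 * m by omega, pow_mul]
    congr 1
    linear_combination (Complex.I ^ 2 + 4 * Complex.I + 5) * Complex.I_mul_I
  rw [show (2 * κ + 2 * a) / 4 = m by omega, hc, div_eq_iff (pow_ne_zero _ hπ)] at h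
  rw [tsum_oddGauss (by omega), hI, h]
  refine ⟨(2 ^ a / (-4) ^ m - 2 ^ a / 2 ^ (2 * κ + a)) * (r * c ^ m), ?_⟩
  have h6 : (π : ℂ) ^ (6 * m) = π ^ (2 * κ + a) * π ^ s := by rw [← pow_add, hs]
  push_cast
  rw [mul_pow, div_pow, ← pow_mul, ← pow_mul, h6]
  field_simp

end OddLatticeSums

section LaplaceIntegral

open MeasureTheory Set

theorem norm_ofReal_pow_mul_cexp (n : ℕ) (s : ℂ) {z : ℝ} (hz : 0 < z) :
    ‖(z : ℂ) ^ n * Complex.exp (-(s * z))‖ = z ^ n * rexp (-(s.re * z)) := by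
  rw [norm_mul, norm_pow, Complex.norm_real, Real.norm_of_nonneg hz.le, Complex.norm_exp]
  simp

theorem integral_pow_mul_exp_neg_mul_Ioi (n : ℕ) {r : ℝ} (hr : 0 < r) :
    ∫ z in Ioi (0 : ℝ), z ^ n * rexp (-(r * z)) = n.factorial / r ^ (n + 1) := by
  have h := Real.integral_rpow_mul_exp_neg_mul_Ioi (a := n + 1) (by positivity) hr
  rw [Real.Gamma_nat_eq_factorial, show (n : ℝ) + 1 = (n + 1 : ℕ) by push_cast; rfl,
    Real.rpow_natCast] at h
  push_cast at h
  simp only [add_sub_cancel_right, Real.rpow_natCast] at h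
  rw [h, one_div, inv_pow, inv_mul_eq_div]

theorem integrableOn_pow_mul_exp_neg_mul_Ioi (n : ℕ) {r : ℝ} (hr : 0 < r) :
    IntegrableOn (fun z : ℝ ↦ z ^ n * rexp (-(r * z))) (Ioi 0) := by
  refine Integrable.of_integral_ne_zero ?_
  rw [integral_pow_mul_exp_neg_mul_Ioi n hr]
  positivity

theorem integrableOn_ofReal_pow_mul_cexp (n : ℕ) {s : ℂ} (hs : 0 < s.re) :
    IntegrableOn (fun z : ℝ ↦ (z : ℂ) ^ n * Complex.exp (-(s * z))) (Ioi 0) := by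
  refine (integrableOn_pow_mul_exp_neg_mul_Ioi n hs).mono'
    (Continuous.aestronglyMeasurable (by fun_prop)) ?_
  filter_upwards [ae_restrict_mem measurableSet_Ioi] with z hz
  exact (norm_ofReal_pow_mul_cexp n s hz).le

theorem integral_norm_ofReal_pow_mul_cexp (n : ℕ) {s : ℂ} (hs : 0 < s.re) :
    ∫ z in Ioi (0 : ℝ), ‖(z : ℂ) ^ n * Complex.exp (-(s * z))‖
      = n.factorial / s.re ^ (n + 1) := by
  rw [← integral_pow_mul_exp_neg_mul_Ioi n hs]
  exact setIntegral_congr_fun measurableSet_Ioi fun z hz ↦ norm_ofReal_pow_mul_cexp n s hz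

theorem integral_ofReal_pow_mul_cexp (n : ℕ) {s : ℂ} (hs : 0 < s.re) :
    ∫ z in Ioi (0 : ℝ), (z : ℂ) ^ n * Complex.exp (-(s * z)) = n.factorial / s ^ (n + 1) := by
  have hs0 : s ≠ 0 := fun h ↦ by simp [h] at hs
  induction n with
  | zero =>
    have := integral_exp_mul_complex_Ioi (a := -s) (by simpa using hs) 0
    simpa using this
  | succ n ih =>
    have hd : ∀ z : ℝ, HasDerivAt (fun z : ℝ ↦ (z : ℂ) ^ (n + 1) * Complex.exp (-(s * z)))
        ((n + 1 : ℕ) * ((z : ℂ) ^ n * Complex.exp (-(s * z)))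
          - s * ((z : ℂ) ^ (n + 1) * Complex.exp (-(s * z)))) z := by
      intro z
      have h1 : HasDerivAt (fun z : ℝ ↦ (z : ℂ)) 1 z := Complex.ofRealCLM.hasDerivAt
      have h2 := (h1.pow (n + 1)).mul (h1.const_mul s).neg.cexp
      convert! h2 using 1
      simp only [Nat.add_sub_cancel, Pi.pow_apply, Pi.neg_apply]
      ring
    have hi := (integrableOn_ofReal_pow_mul_cexp n hs).const_mul ((n + 1 : ℕ) : ℂ)
    have hi' := (integrableOn_ofReal_pow_mul_cexp (n + 1) hs).const_mul s
    have ht : Filter.Tendsto (fun z : ℝ ↦ (z : ℂ) ^ (n + 1) * Complex.exp (-(s * z)))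
        Filter.atTop (𝓝 0) := by
      rw [tendsto_zero_iff_norm_tendsto_zero]
      have h1 := tendsto_rpow_mul_exp_neg_mul_atTop_nhds_zero (n + 1 : ℕ) s.re hs
      refine h1.congr' ?_
      filter_upwards [Filter.eventually_gt_atTop 0] with z hz
      rw [norm_ofReal_pow_mul_cexp _ _ hz, Real.rpow_natCast, neg_mul]
    have h := integral_Ioi_of_hasDerivAt_of_tendsto (a := 0) (hd 0).continuousAt.continuousWithinAt
      (fun z _ ↦ hd z) (hi.sub hi') ht
    rw [integral_sub hi hi', integral_const_mul, integral_const_mul, ih] at h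
    simp only [Complex.ofReal_zero, zero_pow (Nat.succ_ne_zero n), zero_mul, sub_zero] at h
    rw [Nat.factorial_succ, pow_succ s (n + 1), eq_div_iff (by positivity)]
    push_cast at h ⊢
    field_simp at h
    linear_combination -h

end LaplaceIntegral

section SeriesExpansion

open MeasureTheory Set

theorem hasSum_choose_succ_two_mul_pow {r : ℂ} (hr : ‖r‖ < 1) :
    HasSum (fun n : ℕ ↦ ((n + 1).choose 2 : ℂ) * r ^ n) (r / (1 - r) ^ 3) := by
  rw [← hasSum_nat_add_iff' 1]
  have h := (hasSum_choose_mul_geometric_of_norm_lt_one 2 hr).mul_right r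
  simp only [Finset.range_one, Finset.sum_singleton, zero_add]
  convert! h using 1
  · funext n
    rw [pow_succ]
    ring
  · simp
    ring

/-- The exponent in the expansion of `(cosh z - cos z)⁻¹ ^ 3`. -/
noncomputable def expansionExponent (p : ℕ × ℕ) : ℂ :=
  (1 - Complex.I) / 2 * oddGauss (p.1, p.2)

theorem expansionExponent_eq (p : ℕ × ℕ) :
    expansionExponent p = (p.1 + p.2 + 1 : ℝ) + (p.2 - p.1 : ℝ) * Complex.I := by
  simp only [expansionExponent, oddGauss, gauss]
  push_cast
  linear_combination (-(2 * p.2 + 1 : ℂ) / 2) * Complex.I_mul_I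

theorem expansionExponent_re (p : ℕ × ℕ) : (expansionExponent p).re = p.1 + p.2 + 1 := by
  rw [expansionExponent_eq]
  simp

theorem HasSum.complex_mul {ι κ : Type*} {f : ι → ℂ} {g : κ → ℂ} {a b : ℂ} (hf : HasSum f a)
    (hg : HasSum g b) : HasSum (fun p : ι × κ ↦ f p.1 * g p.2) (a * b) :=
  hf.mul hg (summable_mul_of_summable_norm hf.summable.norm hg.summable.norm)

theorem exp_neg_mul_cos_sub_cosh (z : ℂ) :
    Complex.exp (-z) * (Complex.cos z - Complex.cosh z)
      = -((1 - Complex.exp (-z + z * Complex.I)) * (1 - Complex.exp (-z - z * Complex.I))) / 2 := by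
  have e1 : Complex.exp (-z) * Complex.exp z = 1 := by
    rw [← Complex.exp_add, neg_add_cancel, Complex.exp_zero]
  have e2 : Complex.exp (z * Complex.I) * Complex.exp (-(z * Complex.I)) = 1 := by
    rw [← Complex.exp_add, add_neg_cancel, Complex.exp_zero]
  rw [sub_eq_add_neg (-z), Complex.exp_add, Complex.exp_add, Complex.cos, Complex.cosh, neg_mul]
  linear_combination (-1 / 2) * e1 + Complex.exp (-z) ^ 2 / 2 * e2

theorem exp_neg_mul_expansionExponent_mul (p : ℕ × ℕ) (z : ℂ) :
    Complex.exp (-(expansionExponent p * z)) = Complex.exp (-z) *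
      (Complex.exp (-z + z * Complex.I) ^ p.1 * Complex.exp (-z - z * Complex.I) ^ p.2) := by
  rw [expansionExponent_eq, ← Complex.exp_nat_mul, ← Complex.exp_nat_mul, ← Complex.exp_add,
    ← Complex.exp_add]
  push_cast
  congr 1
  ring

theorem hasSum_inv_cos_sub_cosh_cube {z : ℝ} (hz : 0 < z) :
    HasSum (fun p : ℕ × ℕ ↦ -8 * (((p.1 + 1).choose 2 : ℂ) * (p.2 + 1).choose 2) *
      Complex.exp (-(expansionExponent p * z)))
      ((Complex.cos z - Complex.cosh z) ^ 3)⁻¹ := by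
  have hA : ‖Complex.exp (-z + z * Complex.I)‖ < 1 := by simp [Complex.norm_exp, hz]
  have hB : ‖Complex.exp (-z - z * Complex.I)‖ < 1 := by simp [Complex.norm_exp, hz]
  have h := ((hasSum_choose_succ_two_mul_pow hA).complex_mul
    (hasSum_choose_succ_two_mul_pow hB)).mul_left (-8 * Complex.exp (-z))
  have h1 := exp_neg_mul_cos_sub_cosh z
  have h2 : Complex.exp (-z + z * Complex.I) * Complex.exp (-z - z * Complex.I)
      = Complex.exp (-z) ^ 2 := by
    rw [← Complex.exp_add, ← Complex.exp_nat_mul]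
    push_cast
    congr 1
    ring
  simp only [exp_neg_mul_expansionExponent_mul]
  generalize Complex.exp (-z + z * Complex.I) = A at *
  generalize Complex.exp (-z - z * Complex.I) = B at *
  have h0 : Complex.exp (-z) ≠ 0 := Complex.exp_ne_zero _
  generalize Complex.exp (-z) = E at *
  have hA1 : 1 - A ≠ 0 := fun h ↦ by simp [← sub_eq_zero.1 h] at hA
  have hB1 : 1 - B ≠ 0 := fun h ↦ by simp [← sub_eq_zero.1 h] at hB
  have hv : ((Complex.cos z - Complex.cosh z) ^ 3)⁻¹
      = -8 * E * (A / (1 - A) ^ 3 * (B / (1 - B) ^ 3)) := by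
    rw [eq_div_of_mul_eq h0 ((mul_comm _ _).trans h1),
      show -8 * E * (A / (1 - A) ^ 3 * (B / (1 - B) ^ 3))
        = -8 * E * (A * B) / ((1 - A) ^ 3 * (1 - B) ^ 3) by field_simp, h2]
    field_simp
    norm_num
  rw [hv]
  exact h.congr_fun fun p ↦ by ring

end SeriesExpansion

section IntegralAsLatticeSum

open MeasureTheory Set

/-- The summand `(a² - 1) (b² - 1) / (a + b i) ^ (4 k)` at the odd numbers `a = 2 m + 1` and
`b = 2 n + 1`. -/
noncomputable def oddSummand (k : ℕ) (p : ℤ × ℤ) : ℂ :=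
  ((2 * p.1 + 1 : ℂ) ^ 2 - 1) * ((2 * p.2 + 1 : ℂ) ^ 2 - 1) / oddGauss p ^ (4 * k)

theorem expansionExponent_pow (k : ℕ) (p : ℕ × ℕ) :
    expansionExponent p ^ (4 * k) = oddGauss (p.1, p.2) ^ (4 * k) / (-4) ^ k := by
  have h : ((1 - Complex.I) / 2) ^ 4 = (-4)⁻¹ := by
    linear_combination ((Complex.I ^ 2 - 4 * Complex.I + 5) / 16) * Complex.I_mul_I
  rw [expansionExponent, mul_pow, pow_mul ((1 - Complex.I) / 2), h, inv_pow]
  ring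

theorem oddSummand_natCast_eq {k : ℕ} (n : ℕ) (p : ℕ × ℕ) :
    -8 * (((p.1 + 1).choose 2 : ℂ) * (p.2 + 1).choose 2) *
        (n.factorial / expansionExponent p ^ (4 * k))
      = (-(n.factorial * (-4) ^ k / 8) : ℝ) * oddSummand k (p.1, p.2) := by
  rw [expansionExponent_pow, Nat.cast_choose_two, Nat.cast_choose_two, oddSummand]
  push_cast
  have h4 : (-4 : ℂ) ^ k ≠ 0 := pow_ne_zero _ (by norm_num)
  field_simp
  ring

theorem choose_succ_two_le (a b : ℕ) : ((a + 1).choose 2 : ℝ) ≤ (a + b + 1) ^ 2 := by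
  rw [Nat.cast_choose_two]
  push_cast
  nlinarith [a.cast_nonneg (α := ℝ), b.cast_nonneg (α := ℝ)]

theorem summable_choose_mul_choose_div_pow {N : ℕ} (hN : 8 ≤ N) :
    Summable fun p : ℕ × ℕ ↦
      ((p.1 + 1).choose 2 : ℝ) * (p.2 + 1).choose 2 / (p.1 + p.2 + 1 : ℝ) ^ N := by
  have h1 : Summable fun n : ℕ ↦ 1 / ((n : ℝ) + 1) ^ 2 := by
    have := (summable_nat_add_iff 1).2 (Real.summable_one_div_nat_pow.2 one_lt_two)
    exact_mod_cast this
  refine Summable.of_nonneg_of_le (fun p ↦ by positivity) (fun p ↦ ?_)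
    (h1.mul_of_nonneg h1 (fun n ↦ by positivity) (fun n ↦ by positivity))
  have ha := p.1.cast_nonneg (α := ℝ)
  have hb := p.2.cast_nonneg (α := ℝ)
  have h2 := choose_succ_two_le p.1 p.2
  have h3 := choose_succ_two_le p.2 p.1
  rw [add_comm (p.2 : ℝ)] at h3
  set x : ℝ := p.1 + p.2 + 1 with hx
  have hx1 : 1 ≤ x := by linarith
  calc ((p.1 + 1).choose 2 : ℝ) * (p.2 + 1).choose 2 / x ^ N
      ≤ x ^ 2 * x ^ 2 / x ^ 8 := by gcongr
    _ = 1 / (x ^ 2) ^ 2 := by field_simp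
    _ ≤ 1 / (((p.1 : ℝ) + 1) * (p.2 + 1)) ^ 2 := by
      gcongr
      rw [hx]
      nlinarith [mul_nonneg ha hb]
    _ = 1 / ((p.1 : ℝ) + 1) ^ 2 * (1 / ((p.2 : ℝ) + 1) ^ 2) := by
      rw [mul_pow]
      field_simp

theorem integral_eq_tsum_oddSummand {k : ℕ} (hk : 2 ≤ k) :
    ((∫ z in Ioi (0 : ℝ), z ^ (4 * k - 1) / (Real.cos z - Real.cosh z) ^ 3 : ℝ) : ℂ)
      = (-((4 * k - 1).factorial * (-4) ^ k / 8) : ℝ) *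
        ∑' p : ℕ × ℕ, oddSummand k (p.1, p.2) := by
  have hre (p : ℕ × ℕ) : 0 < (expansionExponent p).re := by
    rw [expansionExponent_re]
    positivity
  have hN : 4 * k - 1 + 1 = 4 * k := by omega
  set c : ℕ × ℕ → ℂ := fun p ↦ -8 * (((p.1 + 1).choose 2 : ℂ) * (p.2 + 1).choose 2) with hc
  set F : ℕ × ℕ → ℝ → ℂ := fun p z ↦
    c p * ((z : ℂ) ^ (4 * k - 1) * Complex.exp (-(expansionExponent p * z))) with hF
  have hFn (p : ℕ × ℕ) : ∫ z in Ioi (0 : ℝ), ‖F p z‖ = 8 * (4 * k - 1).factorial *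
      (((p.1 + 1).choose 2 : ℝ) * (p.2 + 1).choose 2 / (p.1 + p.2 + 1 : ℝ) ^ (4 * k)) := by
    simp only [hF, norm_mul (c p)]
    rw [integral_const_mul, integral_norm_ofReal_pow_mul_cexp _ (hre p), expansionExponent_re, hN]
    simp only [hc, norm_mul, norm_neg, RCLike.norm_ofNat, RCLike.norm_natCast]
    ring
  have h := hasSum_integral_of_summable_integral_norm (μ := volume.restrict (Ioi 0)) (F := F)
    (fun p ↦ (integrableOn_ofReal_pow_mul_cexp _ (hre p)).const_mul _)
    (by simpa only [hFn] using (summable_choose_mul_choose_div_pow (by omega)).mul_left _)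
  have hv : ∫ z in Ioi (0 : ℝ), ∑' p, F p z
      = ((∫ z in Ioi (0 : ℝ), z ^ (4 * k - 1) / (Real.cos z - Real.cosh z) ^ 3 : ℝ) : ℂ) := by
    rw [← integral_complex_ofReal]
    refine setIntegral_congr_fun measurableSet_Ioi fun z hz ↦ ?_
    have h1 := ((hasSum_inv_cos_sub_cosh_cube hz).mul_left ((z : ℂ) ^ (4 * k - 1))).tsum_eq
    push_cast
    rw [div_eq_mul_inv, ← h1]
    exact tsum_congr fun p ↦ by simp only [hF, hc]; ring
  rw [← hv, ← h.tsum_eq, ← tsum_mul_left]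
  refine tsum_congr fun p ↦ ?_
  simp only [hF]
  rw [integral_const_mul, integral_ofReal_pow_mul_cexp _ (hre p), hN, hc]
  exact oddSummand_natCast_eq _ p

theorem oddSummand_eq {k : ℕ} (hk : 2 ≤ k) (p : ℤ × ℤ) :
    oddSummand k p = starRingEnd ℂ (oddGauss p) ^ 0 / oddGauss p ^ (2 * (2 * k) + 0)
      - starRingEnd ℂ (oddGauss p) ^ 1 / oddGauss p ^ (2 * (2 * k - 1) + 1)
      - 1 / 16 * (starRingEnd ℂ (oddGauss p) ^ 0 / oddGauss p ^ (2 * (2 * k - 2) + 0))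
      + 1 / 8 * (starRingEnd ℂ (oddGauss p) ^ 2 / oddGauss p ^ (2 * (2 * k - 2) + 2))
      - 1 / 16 * (starRingEnd ℂ (oddGauss p) ^ 4 / oddGauss p ^ (2 * (2 * k - 2) + 4)) := by
  have hw : oddGauss p = (2 * p.1 + 1) + (2 * p.2 + 1) * Complex.I := by
    simp only [oddGauss, gauss]
    push_cast
    ring
  have hw' : starRingEnd ℂ (oddGauss p) = (2 * p.1 + 1) - (2 * p.2 + 1) * Complex.I := by
    rw [hw]
    simp [sub_eq_add_neg, map_ofNat]
  have h0 : oddGauss p ≠ 0 := by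
    rw [oddGauss, Ne, gauss_eq_zero, Prod.ext_iff]
    simp only [Prod.fst_zero, Prod.snd_zero]
    omega
  obtain ⟨m, rfl⟩ := Nat.exists_eq_add_of_le hk
  rw [show 2 * (2 * (2 + m)) + 0 = 4 * m + 8 by ring,
    show 2 * (2 * (2 + m) - 1) + 1 = 4 * m + 7 by omega,
    show 2 * (2 * (2 + m) - 2) + 0 = 4 * m + 4 by omega,
    show 2 * (2 * (2 + m) - 2) + 2 = 4 * m + 6 by omega,
    show 2 * (2 * (2 + m) - 2) + 4 = 4 * m + 8 by omega, oddSummand,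
    show 4 * (2 + m) = 4 * m + 8 by ring]
  have ha : (2 * p.1 + 1 : ℂ) = (oddGauss p + starRingEnd ℂ (oddGauss p)) / 2 := by
    rw [hw', hw]
    ring
  have hb : (2 * p.2 + 1 : ℂ) ^ 2 = -((oddGauss p - starRingEnd ℂ (oddGauss p)) / 2) ^ 2 := by
    rw [hw', hw]
    linear_combination (2 * p.2 + 1 : ℂ) ^ 2 * Complex.I_mul_I
  rw [ha, hb]
  field_simp
  ring

theorem hasSum_oddSummand {k : ℕ} (hk : 2 ≤ k) :
    HasSum (oddSummand k)
      (∑' p, starRingEnd ℂ (oddGauss p) ^ 0 / oddGauss p ^ (2 * (2 * k) + 0)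
        - ∑' p, starRingEnd ℂ (oddGauss p) ^ 1 / oddGauss p ^ (2 * (2 * k - 1) + 1)
        - 1 / 16 * ∑' p, starRingEnd ℂ (oddGauss p) ^ 0 / oddGauss p ^ (2 * (2 * k - 2) + 0)
        + 1 / 8 * ∑' p, starRingEnd ℂ (oddGauss p) ^ 2 / oddGauss p ^ (2 * (2 * k - 2) + 2)
        - 1 / 16 * ∑' p, starRingEnd ℂ (oddGauss p) ^ 4 / oddGauss p ^ (2 * (2 * k - 2) + 4)) := by
  have h {a b : ℕ} (hab : a + 3 ≤ b) := (summable_conj_oddGauss_pow_div hab).hasSum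
  exact (((((h (by omega)).sub (h (by omega))).sub ((h (by omega)).mul_left _)).add
    ((h (by omega)).mul_left _)).sub ((h (by omega)).mul_left _)).congr_fun (oddSummand_eq hk)

theorem tsum_oddSummand_eq {k : ℕ} (hk : 2 ≤ k) :
    ∑' p, oddSummand k p = (4 * (∑' p : ℕ × ℕ, oddSummand k (p.1, p.2)).re : ℝ) := by
  have hs := (hasSum_oddSummand hk).summable
  have hinj : Function.Injective fun p : ℕ × ℕ ↦ ((p.1 : ℤ), (p.2 : ℤ)) := by
    rintro ⟨a, b⟩ ⟨c, d⟩ h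
    simpa using h
  have hneg (m : ℤ) : (2 * ((-(m + 1) : ℤ) : ℂ) + 1) = -(2 * m + 1) := by
    push_cast
    ring
  have hw (p : ℤ × ℤ) : oddGauss p = (2 * p.1 + 1) + (2 * p.2 + 1) * Complex.I := by
    simp only [oddGauss, gauss]
    push_cast
    ring
  have h1 (m n : ℤ) : oddSummand k (m, -(n + 1)) = starRingEnd ℂ (oddSummand k (m, n)) := by
    simp only [oddSummand, hw, hneg, neg_sq]
    simp [map_ofNat, -neg_add_rev]
  have h2 (m n : ℤ) : oddSummand k (-(m + 1), n) = starRingEnd ℂ (oddSummand k (m, n)) := by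
    simp only [oddSummand, hw, hneg, neg_sq]
    have h4k : Even (4 * k) := ⟨2 * k, by ring⟩
    rw [← h4k.neg_pow (-(2 * m + 1 : ℂ) + _), neg_add, neg_neg]
    simp [map_ofNat, -neg_add_rev]
  have hinner (m : ℤ) : ∑' n : ℤ, oddSummand k (m, n)
      = (2 * (∑' n : ℕ, oddSummand k (m, n)).re : ℝ) := by
    have hm := hs.prod_factor m
    have hm' : Summable fun n : ℕ ↦ oddSummand k (m, n) := hm.comp_injective Nat.cast_injective
    have h3 := HasSum.of_nat_of_neg_add_one (f := fun n : ℤ ↦ oddSummand k (m, n)) hm'.hasSum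
      (by simpa only [h1] using Complex.hasSum_conj'.2 hm'.hasSum)
    rw [h3.tsum_eq]
    exact Complex.add_conj _
  have hnn : Summable fun p : ℕ × ℕ ↦ oddSummand k (p.1, p.2) := hs.comp_injective hinj
  have houter : HasSum (fun m : ℕ ↦ ∑' n : ℤ, oddSummand k (m, n))
      (2 * (∑' p : ℕ × ℕ, oddSummand k (p.1, p.2)).re : ℝ) := by
    have h3 := hnn.hasSum.prod_fiberwise fun m ↦ (hnn.prod_factor m).hasSum
    have h4 := (Complex.hasSum_re h3).mul_left 2
    simp only [hinner]
    exact Complex.hasSum_ofReal.2 h4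
  have h5 := HasSum.of_nat_of_neg_add_one (f := fun m : ℤ ↦ ∑' n : ℤ, oddSummand k (m, n)) houter
    (by
      convert! houter using 2 with m
      rw [hinner, hinner]
      simp only [h2]
      rw [← Complex.conj_tsum, Complex.conj_re])
  rw [hs.tsum_prod, h5.tsum_eq]
  push_cast
  ring

end IntegralAsLatticeSum

theorem berndt_type_integral_order_three_minus (p : ℕ) (hp : 2 ≤ p) :
    ∃ q1 q2 q3 q4 q5 : ℚ,
      (∫ z in Set.Ioi (0:ℝ), z ^ (4*p-1) / (Real.cos z - Real.cosh z) ^ 3) =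
        (q1 : ℝ) * Real.Gamma (1/4) ^ (8*p-8) / π ^ (2*p-2)
      + (q2 : ℝ) * Real.Gamma (1/4) ^ (8*p) / π ^ (2*p+2)
      + (q3 : ℝ) * Real.Gamma (1/4) ^ (8*p) / π ^ (2*p+1)
      + (q4 : ℝ) * Real.Gamma (1/4) ^ (8*p) / π ^ (2*p)
      + (q5 : ℝ) * Real.Gamma (1/4) ^ (8*p+8) / π ^ (2*p+6) := by
  obtain ⟨a1, h1⟩ := exists_tsum_oddGauss_eq_ratCast_mul (a := 0) (κ := 2 * p - 2) (m := p - 1)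
    (s := 2 * p - 2) (by omega) (by omega) (by omega)
  obtain ⟨a2, h2⟩ := exists_tsum_oddGauss_eq_ratCast_mul (a := 2) (κ := 2 * p - 2) (m := p)
    (s := 2 * p + 2) (by omega) (by omega) (by omega)
  obtain ⟨a3, h3⟩ := exists_tsum_oddGauss_eq_ratCast_mul (a := 1) (κ := 2 * p - 1) (m := p)
    (s := 2 * p + 1) (by omega) (by omega) (by omega)
  obtain ⟨a4, h4⟩ := exists_tsum_oddGauss_eq_ratCast_mul (a := 0) (κ := 2 * p) (m := p)
    (s := 2 * p) (by omega) (by omega) (by omega)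
  obtain ⟨a5, h5⟩ := exists_tsum_oddGauss_eq_ratCast_mul (a := 4) (κ := 2 * p - 2) (m := p + 1)
    (s := 2 * p + 6) (by omega) (by omega) (by omega)
  have hsum := (hasSum_oddSummand hp).tsum_eq
  rw [tsum_oddSummand_eq hp, h1, h2, h3, h4, h5] at hsum
  have hIT := congrArg Complex.re (integral_eq_tsum_oddSummand hp)
  rw [Complex.re_ofReal_mul, Complex.ofReal_re] at hIT
  rw [show 8 * (p - 1) = 8 * p - 8 by omega, show 8 * (p + 1) = 8 * p + 8 by ring] at hsum
  set T := (∑' q : ℕ × ℕ, oddSummand p (q.1, q.2)).re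
  have hT : 4 * T = a4 * (Real.Gamma (1 / 4) ^ (8 * p) / π ^ (2 * p))
      - a3 * (Real.Gamma (1 / 4) ^ (8 * p) / π ^ (2 * p + 1))
      - 1 / 16 * (a1 * (Real.Gamma (1 / 4) ^ (8 * p - 8) / π ^ (2 * p - 2)))
      + 1 / 8 * (a2 * (Real.Gamma (1 / 4) ^ (8 * p) / π ^ (2 * p + 2)))
      - 1 / 16 * (a5 * (Real.Gamma (1 / 4) ^ (8 * p + 8) / π ^ (2 * p + 6))) := by
    rw [← Complex.ofReal_inj, hsum]
    push_cast
    ring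
  rw [hIT]
  refine ⟨(4 * p - 1).factorial * (-4) ^ p / 512 * a1,
    -((4 * p - 1).factorial * (-4) ^ p / 256 * a2),
    (4 * p - 1).factorial * (-4) ^ p / 32 * a3, -((4 * p - 1).factorial * (-4) ^ p / 32 * a4),
    (4 * p - 1).factorial * (-4) ^ p / 512 * a5, ?_⟩
  push_cast
  linear_combination (-((4 * p - 1).factorial * (-4) ^ p / 32) : ℝ) * hT
end

section
/- For every integer a ≥ 0, writing ñ = (2n−1)/2, the following identity of complex numbers holds: ((1 − i^(a+1))/(π^(a−1)·(1+i)^(a−1))) · ∫_0^∞ x^a/(cos x + cosh x)^3 dx = −(a(a−1)/4)·Σ_{n=1}^∞ (−1)^n ñ^(a−2)/cosh(ñπ)^3 − (5π²/2)·Σ_{n=1}^∞ (−1)^n ñ^a/cosh(ñπ)^3 + (3aπ/2)·Σ_{n=1}^∞ (−1)^n ñ^(a−1) sinh(ñπ)/cosh(ñπ)^4 + 3π²·Σ_{n=1}^∞ (−1)^n ñ^a/cosh(ñπ)^5. -/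
open Real

/-- The integral of `f` along the oriented segment from `a` to `b`. -/
noncomputable def segIntegral (f : ℂ → ℂ) (a b : ℂ) : ℂ :=
  ∫ t in (0 : ℝ)..1, f (a + t * (b - a)) * (b - a)

/-- The boundary of the triangle with vertices `0`, `R - R i`, `R + R i`. -/
def triangleBoundary (R : ℝ) : Set ℂ :=
  {z | |z.im| ≤ z.re ∧ z.re ≤ R ∧ (|z.im| = z.re ∨ z.re = R)}

/-- The counterclockwise integral of `f` along `triangleBoundary R`. -/
noncomputable def triangleIntegral (R : ℝ) (f : ℂ → ℂ) : ℂ :=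
  segIntegral f 0 (R - R * Complex.I) + segIntegral f (R - R * Complex.I) (R + R * Complex.I) +
    segIntegral f (R + R * Complex.I) 0

section Segment

variable {f g F : ℂ → ℂ} {a b : ℂ} {s : Set ℂ}

theorem continuousOn_segIntegrand (hs : Set.MapsTo (fun t : ℝ => a + t * (b - a)) (Set.Icc 0 1) s)
    (hf : ContinuousOn f s) :
    ContinuousOn (fun t : ℝ => f (a + t * (b - a)) * (b - a)) (Set.uIcc 0 1) := by
  rw [Set.uIcc_of_le zero_le_one]
  exact (hf.comp (by fun_prop) hs).mul continuousOn_const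

theorem segIntegral_eq_sub (hs : Set.MapsTo (fun t : ℝ => a + t * (b - a)) (Set.Icc 0 1) s)
    (hF : ∀ z ∈ s, HasDerivAt F (f z) z) (hf : ContinuousOn f s) :
    segIntegral f a b = F b - F a := by
  have h := intervalIntegral.integral_eq_sub_of_hasDerivAt
    (f := fun t : ℝ => F (a + t * (b - a))) (f' := fun t : ℝ => f (a + t * (b - a)) * (b - a))
    (a := 0) (b := 1) (fun t ht => ?_) (continuousOn_segIntegrand hs hf).intervalIntegrable
  · simpa [segIntegral] using h
  · rw [Set.uIcc_of_le zero_le_one] at ht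
    have h1 : HasDerivAt (fun t : ℝ => a + t * (b - a)) (b - a) t := by
      simpa using ((Complex.ofRealCLM.hasDerivAt (x := t)).mul_const (b - a)).const_add a
    have := (hF _ (hs ht)).scomp t h1
    simpa [Function.comp_def, mul_comm] using this

theorem segIntegral_add (hs : Set.MapsTo (fun t : ℝ => a + t * (b - a)) (Set.Icc 0 1) s)
    (hf : ContinuousOn f s) (hg : ContinuousOn g s) :
    segIntegral (fun z => f z + g z) a b = segIntegral f a b + segIntegral g a b := by
  simp only [segIntegral, add_mul]
  exact intervalIntegral.integral_add (continuousOn_segIntegrand hs hf).intervalIntegrable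
    (continuousOn_segIntegrand hs hg).intervalIntegrable

theorem segIntegral_const_mul (c : ℂ) :
    segIntegral (fun z => c * f z) a b = c * segIntegral f a b := by
  simp only [segIntegral, mul_assoc]
  exact intervalIntegral.integral_const_mul _ _

theorem segIntegral_congr (hs : Set.MapsTo (fun t : ℝ => a + t * (b - a)) (Set.Icc 0 1) s)
    (h : Set.EqOn f g s) : segIntegral f a b = segIntegral g a b := by
  refine intervalIntegral.integral_congr fun t ht => ?_
  rw [Set.uIcc_of_le zero_le_one] at ht
  simp only [h (hs ht)]

end Segment

section Triangle

variable {f g F : ℂ → ℂ} {R : ℝ}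

theorem mapsTo_lower_rays (hR : 0 ≤ R) :
    Set.MapsTo (fun t : ℝ => (0 : ℂ) + t * ((R - R * Complex.I) - 0)) (Set.Icc 0 1)
      {z : ℂ | |z.im| = z.re ∧ z.re ≤ R} := by
  rintro t ⟨h0, h1⟩
  have : |t * R| = t * R := abs_of_nonneg (by positivity)
  refine ⟨?_, ?_⟩ <;> simp [this]
  nlinarith

theorem mapsTo_right_side (hR : 0 ≤ R) :
    Set.MapsTo (fun t : ℝ => (R - R * Complex.I) + t * ((R + R * Complex.I) - (R - R * Complex.I)))
      (Set.Icc 0 1) {z : ℂ | |z.im| ≤ R ∧ z.re = R} := by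
  rintro t ⟨h0, h1⟩
  refine ⟨?_, ?_⟩ <;> simp
  rw [abs_le]
  constructor <;> nlinarith

theorem mapsTo_upper_rays (hR : 0 ≤ R) :
    Set.MapsTo (fun t : ℝ => (R + R * Complex.I) + t * (0 - (R + R * Complex.I))) (Set.Icc 0 1)
      {z : ℂ | |z.im| = z.re ∧ z.re ≤ R} := by
  rintro t ⟨h0, h1⟩
  have h2 : 0 ≤ (1 - t) * R := mul_nonneg (by linarith) hR
  have h3 : (R + R * Complex.I) + t * (0 - (R + R * Complex.I)) =
      ((1 - t) * R : ℝ) + ((1 - t) * R : ℝ) * Complex.I := by push_cast; ring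
  simp only [h3]
  refine ⟨?_, ?_⟩
  · simp only [Complex.add_im, Complex.add_re, Complex.ofReal_im, Complex.ofReal_re,
      Complex.re_ofReal_mul, Complex.im_ofReal_mul, Complex.I_re, Complex.I_im]
    simp only [mul_zero, mul_one, add_zero, zero_add, abs_of_nonneg h2]
  · simp only [Complex.add_re, Complex.ofReal_re, Complex.re_ofReal_mul, Complex.I_re]
    nlinarith

theorem rays_subset_triangleBoundary :
    {z : ℂ | |z.im| = z.re ∧ z.re ≤ R} ⊆ triangleBoundary R :=
  fun _ hz => ⟨hz.1.le, hz.2, Or.inl hz.1⟩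

theorem side_subset_triangleBoundary :
    {z : ℂ | |z.im| ≤ R ∧ z.re = R} ⊆ triangleBoundary R :=
  fun _ hz => ⟨hz.1.trans hz.2.ge, hz.2.le, Or.inr hz.2⟩

theorem mapsTo_lower (hR : 0 ≤ R) :
    Set.MapsTo (fun t : ℝ => (0 : ℂ) + t * ((R - R * Complex.I) - 0)) (Set.Icc 0 1)
      (triangleBoundary R) :=
  (mapsTo_lower_rays hR).mono_right rays_subset_triangleBoundary

theorem mapsTo_right (hR : 0 ≤ R) :
    Set.MapsTo (fun t : ℝ => (R - R * Complex.I) + t * ((R + R * Complex.I) - (R - R * Complex.I)))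
      (Set.Icc 0 1) (triangleBoundary R) :=
  (mapsTo_right_side hR).mono_right side_subset_triangleBoundary

theorem mapsTo_upper (hR : 0 ≤ R) :
    Set.MapsTo (fun t : ℝ => (R + R * Complex.I) + t * (0 - (R + R * Complex.I))) (Set.Icc 0 1)
      (triangleBoundary R) :=
  (mapsTo_upper_rays hR).mono_right rays_subset_triangleBoundary

theorem triangleIntegral_eq_zero_of_hasDerivAt (hR : 0 ≤ R)
    (hF : ∀ z ∈ triangleBoundary R, HasDerivAt F (f z) z)
    (hf : ContinuousOn f (triangleBoundary R)) : triangleIntegral R f = 0 := by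
  rw [triangleIntegral, segIntegral_eq_sub (mapsTo_lower hR) hF hf,
    segIntegral_eq_sub (mapsTo_right hR) hF hf, segIntegral_eq_sub (mapsTo_upper hR) hF hf]
  ring

theorem triangleIntegral_add (hR : 0 ≤ R) (hf : ContinuousOn f (triangleBoundary R))
    (hg : ContinuousOn g (triangleBoundary R)) :
    triangleIntegral R (fun z => f z + g z) = triangleIntegral R f + triangleIntegral R g := by
  rw [triangleIntegral, segIntegral_add (mapsTo_lower hR) hf hg,
    segIntegral_add (mapsTo_right hR) hf hg, segIntegral_add (mapsTo_upper hR) hf hg,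
    triangleIntegral, triangleIntegral]
  ring

theorem triangleIntegral_const_mul (c : ℂ) :
    triangleIntegral R (fun z => c * f z) = c * triangleIntegral R f := by
  simp only [triangleIntegral, segIntegral_const_mul, mul_add]

theorem triangleIntegral_congr (hR : 0 ≤ R) (h : Set.EqOn f g (triangleBoundary R)) :
    triangleIntegral R f = triangleIntegral R g := by
  rw [triangleIntegral, segIntegral_congr (mapsTo_lower hR) h,
    segIntegral_congr (mapsTo_right hR) h, segIntegral_congr (mapsTo_upper hR) h,
    triangleIntegral]

theorem triangleBoundary_subset_ball {r : ℝ} (hr : R < r) :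
    triangleBoundary R ⊆ Metric.ball (R : ℂ) r := by
  rintro z ⟨h1, h2, h3⟩
  have h0 : 0 ≤ z.re := (abs_nonneg _).trans h1
  rw [mem_ball_iff_norm]
  refine lt_of_le_of_lt (abs_le_of_sq_le_sq' ?_ (by linarith)).2 hr
  rw [Complex.sq_norm, Complex.normSq_apply]
  have : z.im ^ 2 ≤ z.re ^ 2 := sq_le_sq.2 (by rwa [abs_of_nonneg h0])
  simp
  nlinarith

theorem triangleIntegral_eq_zero_of_differentiableOn_ball {r : ℝ} (hR : 0 ≤ R) (hr : R < r)
    (hf : DifferentiableOn ℂ f (Metric.ball (R : ℂ) r)) : triangleIntegral R f = 0 := by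
  obtain ⟨F, hF⟩ := hf.isExactOn_ball
  exact triangleIntegral_eq_zero_of_hasDerivAt hR
    (fun z hz => hF z (triangleBoundary_subset_ball hr hz))
    (hf.continuousOn.mono (triangleBoundary_subset_ball hr))

theorem ne_ofReal_of_mem_triangleBoundary {p : ℝ} (hp : 0 < p) (hpR : p ≠ R) {z : ℂ}
    (hz : z ∈ triangleBoundary R) : z ≠ p := by
  rintro rfl
  obtain ⟨-, -, h | h⟩ := hz
  · simp at h; exact hp.ne h
  · exact hpR (by simpa using h)

theorem continuousOn_inv_sub {p : ℝ} (hp : 0 < p) (hpR : p ≠ R) :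
    ContinuousOn (fun z : ℂ => (z - p)⁻¹) (triangleBoundary R) :=
  ContinuousOn.inv₀ (by fun_prop) fun _ hz =>
    sub_ne_zero.2 (ne_ofReal_of_mem_triangleBoundary hp hpR hz)

theorem hasDerivAt_log_sub {p z : ℂ} (hz : p - z ∈ Complex.slitPlane) :
    HasDerivAt (fun w => Complex.log (p - w)) (z - p)⁻¹ z := by
  have h : (z - p)⁻¹ = -1 / (p - z) := by rw [← neg_sub p z, inv_neg, neg_div, one_div]
  rw [h]
  exact ((hasDerivAt_id z).const_sub p).clog hz

theorem triangleIntegral_inv_sub_of_gt {p : ℝ} (hR : 0 ≤ R) (hpR : R < p) :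
    triangleIntegral R (fun z => (z - p)⁻¹) = 0 := by
  refine triangleIntegral_eq_zero_of_hasDerivAt (F := fun w => Complex.log (p - w)) hR
    (fun z hz => hasDerivAt_log_sub (Or.inl ?_))
    (continuousOn_inv_sub (hR.trans_lt hpR) hpR.ne')
  have := hz.2.1
  simp; linarith

theorem triangleIntegral_inv_sub_of_lt {p : ℝ} (hp : 0 < p) (hpR : p < R) :
    triangleIntegral R (fun z => (z - p)⁻¹) = 2 * π * Complex.I := by
  have hR : 0 ≤ R := (hp.trans hpR).le
  have hrays : ∀ z ∈ {z : ℂ | |z.im| = z.re ∧ z.re ≤ R},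
      HasDerivAt (fun w => Complex.log (p - w)) (z - p)⁻¹ z := by
    intro z hz
    refine hasDerivAt_log_sub (?_ : _ ∨ _)
    by_cases h : z.im = 0
    · left; simp [← hz.1, h, hp]
    · right; simpa using h
  have hright : ∀ z ∈ {z : ℂ | |z.im| ≤ R ∧ z.re = R},
      HasDerivAt (fun w => Complex.log (w - p)) (z - p)⁻¹ z := by
    intro z hz
    rw [← one_div]
    refine ((hasDerivAt_id z).sub_const (p : ℂ)).clog (Or.inl ?_)
    have : z.re = R := hz.2
    simp [this, hpR]
  have hc1 : ContinuousOn (fun z : ℂ => (z - p)⁻¹) {z : ℂ | |z.im| = z.re ∧ z.re ≤ R} :=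
    ContinuousOn.inv₀ (by fun_prop) fun z hz h => by
      obtain rfl := sub_eq_zero.1 h
      exact hp.ne (by simpa using hz.1)
  have hc2 : ContinuousOn (fun z : ℂ => (z - p)⁻¹) {z : ℂ | |z.im| ≤ R ∧ z.re = R} :=
    ContinuousOn.inv₀ (by fun_prop) fun z hz h => by
      obtain rfl := sub_eq_zero.1 h
      exact hpR.ne (by simpa using hz.2)
  rw [triangleIntegral, segIntegral_eq_sub (mapsTo_lower_rays hR) hrays hc1,
    segIntegral_eq_sub (mapsTo_right_side hR) hright hc2,
    segIntegral_eq_sub (mapsTo_upper_rays hR) hrays hc1]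
  set u : ℂ := R - p + R * Complex.I with hu
  set v : ℂ := R - p - R * Complex.I with hv
  have hu0 : 0 < u.im := by simp [hu]; linarith
  have hv0 : v.im < 0 := by simp [hv]; linarith
  have e1 : (p : ℂ) - (R - R * Complex.I) = - v := by rw [hv]; ring
  have e2 : (p : ℂ) - (R + R * Complex.I) = - u := by rw [hu]; ring
  have e3 : (R : ℂ) + R * Complex.I - p = u := by rw [hu]; ring
  have e4 : (R : ℂ) - R * Complex.I - p = v := by rw [hv]; ring
  rw [e1, e2, e3, e4]
  simp only [Complex.log, norm_neg, Complex.arg_neg_eq_arg_sub_pi_of_im_pos hu0,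
    Complex.arg_neg_eq_arg_add_pi_of_im_neg hv0]
  push_cast
  ring

theorem exists_differentiableOn_eq_sub_principal_part {U : Set ℂ} {p c : ℂ} (hU : U ∈ nhds p)
    (hf : DifferentiableOn ℂ f (U \ {p}))
    (hlim : Filter.Tendsto (fun z => (z - p) * f z) (nhdsWithin p {p}ᶜ) (nhds c)) :
    ∃ g : ℂ → ℂ, DifferentiableOn ℂ g U ∧ ∀ z ≠ p, g z = f z + -c * (z - p)⁻¹ := by
  set φ : ℂ → ℂ := fun z => f z + -c * (z - p)⁻¹ with hφ
  refine ⟨_, Complex.differentiableOn_update_limUnder_of_isLittleO (f := φ) hU ?_ ?_, ?_⟩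
  · refine hf.add (DifferentiableOn.const_mul (DifferentiableOn.inv (by fun_prop) ?_) _)
    exact fun z hz => sub_ne_zero.2 hz.2
  · rw [Asymptotics.isLittleO_iff_tendsto']
    · have h1 : Filter.Tendsto (fun z => (z - p) * f z - c - (z - p) * φ p)
          (nhdsWithin p {p}ᶜ) (nhds (c - c - (p - p) * φ p)) :=
        (hlim.sub_const c).sub (Filter.Tendsto.mul_const _
          (((continuous_id.sub continuous_const).tendsto p).mono_left nhdsWithin_le_nhds))
      simp only [sub_self, zero_mul] at h1
      refine h1.congr' ?_
      filter_upwards [self_mem_nhdsWithin] with z hz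
      have : z - p ≠ 0 := sub_ne_zero.2 hz
      simp only [hφ]
      field_simp
      ring
    · filter_upwards [self_mem_nhdsWithin] with z hz h
      exact absurd (inv_eq_zero.1 h) (sub_ne_zero.2 hz)
  · intro z hz
    rw [Function.update_of_ne hz]

theorem triangleIntegral_eq_sum_of_simple_poles {r : ℝ} (hR : 0 ≤ R) (hr : R < r)
    (S : Finset ℝ) (c : ℝ → ℂ)
    (hS : ∀ p ∈ S, 0 < p ∧ p ≠ R ∧ (p : ℂ) ∈ Metric.ball (R : ℂ) r)
    (hf : DifferentiableOn ℂ f (Metric.ball (R : ℂ) r \ ((fun p : ℝ => (p : ℂ)) '' S)))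
    (hlim : ∀ p ∈ S, Filter.Tendsto (fun z : ℂ => (z - p) * f z)
      (nhdsWithin (p : ℂ) {(p : ℂ)}ᶜ) (nhds (c p))) :
    triangleIntegral R f = 2 * π * Complex.I * ∑ p ∈ S with p < R, c p := by
  induction S using Finset.induction_on generalizing f with
  | empty =>
    simpa using triangleIntegral_eq_zero_of_differentiableOn_ball hR hr (by simpa using hf)
  | insert p S hpS ih =>
    set T : Set ℂ := (fun q : ℝ => (q : ℂ)) '' S with hT
    have hTc : IsClosed T := (S.finite_toSet.image _).isClosed
    have hpT : (p : ℂ) ∉ T := by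
      rintro ⟨q, hq, hqp⟩
      exact hpS (Complex.ofReal_injective hqp ▸ hq)
    obtain ⟨hp0, hpR, hpb⟩ := hS p (Finset.mem_insert_self _ _)
    obtain ⟨g, hg, hgf⟩ := exists_differentiableOn_eq_sub_principal_part (f := f) (c := c p)
      (U := Metric.ball (R : ℂ) r \ T) (p := p)
      ((Metric.isOpen_ball.sdiff hTc).mem_nhds ⟨hpb, hpT⟩)
      (hf.mono fun z hz => ⟨hz.1.1, by
        rintro ⟨q, hq, rfl⟩
        rcases Finset.mem_insert.1 (Finset.mem_coe.1 hq) with rfl | h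
        · exact hz.2 rfl
        · exact hz.1.2 ⟨q, h, rfl⟩⟩)
      (hlim p (Finset.mem_insert_self _ _))
    have hB : triangleBoundary R ⊆ Metric.ball (R : ℂ) r \ T := fun z hz =>
      ⟨triangleBoundary_subset_ball hr hz, by
        rintro ⟨q, hq, rfl⟩
        obtain ⟨h0, h1, -⟩ := hS q (Finset.mem_insert_of_mem hq)
        exact ne_ofReal_of_mem_triangleBoundary h0 h1 hz rfl⟩
    have hgT := ih (f := g) (fun q hq => hS q (Finset.mem_insert_of_mem hq)) hg (fun q hq => by
      have hqp : (q : ℂ) ≠ p := fun h => hpS (Complex.ofReal_injective h ▸ hq)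
      have h1 := (hlim q (Finset.mem_insert_of_mem hq)).add
        (f := fun z : ℂ => (z - q) * f z) (g := fun z : ℂ => (z - q) * (-c p * (z - p)⁻¹))
        (b := ((q : ℂ) - q) * (-c p * ((q : ℂ) - p)⁻¹))
        (ContinuousAt.tendsto (f := fun z : ℂ => (z - q) * (-c p * (z - p)⁻¹)) (by
          have := sub_ne_zero.2 hqp
          fun_prop (disch := assumption)) |>.mono_left nhdsWithin_le_nhds)
      rw [sub_self, zero_mul, add_zero] at h1
      refine h1.congr' ?_
      filter_upwards [nhdsWithin_le_nhds (isOpen_ne.mem_nhds hqp)] with z hz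
      rw [hgf z hz]; ring)
    have hsplit : triangleIntegral R f =
        triangleIntegral R g + c p * triangleIntegral R (fun z => (z - p)⁻¹) := by
      rw [← triangleIntegral_const_mul, ← triangleIntegral_add (g := fun z => c p * (z - p)⁻¹) hR
        (hg.continuousOn.mono hB)
        (continuousOn_const.mul (continuousOn_inv_sub hp0 hpR))]
      refine triangleIntegral_congr hR fun z hz => ?_
      rw [hgf z (ne_ofReal_of_mem_triangleBoundary hp0 hpR hz)]
      ring
    rw [hsplit, hgT, Finset.filter_insert]
    rcases hpR.lt_or_gt with h | h
    · rw [triangleIntegral_inv_sub_of_lt hp0 h, if_pos h,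
        Finset.sum_insert (by simp [hpS])]
      ring
    · rw [triangleIntegral_inv_sub_of_gt hR h, if_neg h.not_gt]
      ring

end Triangle

theorem cosh_ne_zero_of_mem_ball {R r : ℝ} (hr : r ^ 2 = R ^ 2 + π ^ 2 / 4) {z : ℂ}
    (hz : z ∈ Metric.ball (R : ℂ) r) : Complex.cosh z ≠ 0 := by
  intro h
  rw [← Complex.cos_mul_I, Complex.cos_eq_zero_iff] at h
  obtain ⟨k, hk⟩ := h
  have him := congrArg Complex.im hk
  have hre := congrArg Complex.re hk
  have e : (2 * (k : ℂ) + 1) * π / 2 = (((2 * k + 1) * π / 2 : ℝ) : ℂ) := by push_cast; ring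
  rw [e] at him hre
  simp only [Complex.mul_I_im, Complex.mul_I_re, Complex.ofReal_im, Complex.ofReal_re] at him hre
  have hd : ‖z - R‖ ^ 2 < r ^ 2 := by
    rw [mem_ball_iff_norm] at hz
    gcongr
  rw [Complex.sq_norm, Complex.normSq_apply] at hd
  simp only [Complex.sub_re, Complex.sub_im, Complex.ofReal_re, Complex.ofReal_im, sub_zero,
    him] at hd
  have hk1 : (1 : ℝ) ≤ (2 * k + 1) ^ 2 := by
    have : (1 : ℤ) ≤ (2 * k + 1) ^ 2 := by
      have : 0 < (2 * k + 1) ^ 2 := by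
        have : 2 * k + 1 ≠ 0 := by omega
        positivity
      omega
    exact_mod_cast this
  have : z.im * z.im = (2 * k + 1) ^ 2 * (π ^ 2 / 4) := by
    rw [← neg_mul_neg, hre]; ring
  nlinarith [mul_le_mul_of_nonneg_right hk1 (by positivity : 0 ≤ π ^ 2 / 4)]

theorem eq_of_cos_eq_zero_of_mem_ball {N : ℕ} {r : ℝ} (hr : r < N * π + π / 2) {z : ℂ}
    (hz : z ∈ Metric.ball (((N * π : ℝ)) : ℂ) r) (h : Complex.cos z = 0) :
    ∃ n < 2 * N, z = (((2 * (n : ℝ) + 1) / 2 * π : ℝ) : ℂ) := by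
  obtain ⟨k, rfl⟩ := Complex.cos_eq_zero_iff.1 h
  have e : (2 * (k : ℂ) + 1) * π / 2 = (((2 * k + 1) / 2 * π : ℝ) : ℂ) := by push_cast; ring
  rw [e, mem_ball_iff_norm, ← Complex.ofReal_sub, Complex.norm_real, Real.norm_eq_abs,
    abs_lt] at hz
  have h1 : (-1 : ℝ) < k := by
    by_contra! hc
    nlinarith [hz.1, mul_le_mul_of_nonneg_right hc pi_pos.le]
  have h2 : (k : ℝ) < 2 * N := by
    by_contra! hc
    nlinarith [hz.2, mul_le_mul_of_nonneg_right hc pi_pos.le]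
  have h1' : -1 < k := by exact_mod_cast h1
  have h2' : k < 2 * N := by exact_mod_cast h2
  lift k to ℕ using by omega
  exact ⟨k, by omega, by rw [e]; simp⟩

theorem sin_half_odd_mul_pi (n : ℕ) : Real.sin ((2 * (n : ℝ) + 1) / 2 * π) = (-1) ^ n := by
  rw [show (2 * (n : ℝ) + 1) / 2 * π = n * π + π / 2 by ring, Real.sin_add_pi_div_two,
    Real.cos_nat_mul_pi]

theorem cos_half_odd_mul_pi (n : ℕ) : Real.cos ((2 * (n : ℝ) + 1) / 2 * π) = 0 := by
  rw [show (2 * (n : ℝ) + 1) / 2 * π = n * π + π / 2 by ring, Real.cos_add_pi_div_two,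
    Real.sin_nat_mul_pi, neg_zero]

theorem tendsto_sub_mul_div_cos {h : ℂ → ℂ} {p : ℝ} (hh : ContinuousAt h p)
    (hc : Real.cos p = 0) :
    Filter.Tendsto (fun z : ℂ => (z - p) * (h z / Complex.cos z))
      (nhdsWithin (p : ℂ) {(p : ℂ)}ᶜ) (nhds (-h p / Real.sin p)) := by
  have hc' : Complex.cos p = 0 := by rw [← Complex.ofReal_cos, hc, Complex.ofReal_zero]
  have hs : -Complex.sin p ≠ 0 := by
    intro h0
    have := Complex.sin_sq_add_cos_sq p
    simp [hc', neg_eq_zero.1 h0] at this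
  have h1 := ((hasDerivAt_iff_tendsto_slope.1 (Complex.hasDerivAt_cos (p : ℂ))).inv₀ hs).mul
    (hh.tendsto.mono_left nhdsWithin_le_nhds)
  have e : (-Complex.sin p)⁻¹ * h p = -h p / Real.sin p := by
    rw [inv_neg, Complex.ofReal_sin]; ring
  rw [e] at h1
  refine h1.congr fun z => ?_
  rw [slope_def_field, hc', sub_zero, inv_div]
  ring

/-- Half of the sum of `z ^ a / cosh z ^ 3` and its second derivative. -/
noncomputable def residueDensity (a : ℕ) (z : ℂ) : ℂ :=
  (a * ((a - 1 : ℕ) * z ^ (a - 1 - 1)) / Complex.cosh z ^ 3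
    - 6 * (a * z ^ (a - 1)) * Complex.sinh z / Complex.cosh z ^ 4
    + 10 * z ^ a / Complex.cosh z ^ 3 - 12 * z ^ a / Complex.cosh z ^ 5) / 2

theorem hasDerivAt_sec_wronskian {P Q : ℂ → ℂ} {q z : ℂ} (hP : HasDerivAt P (Q z) z)
    (hQ : HasDerivAt Q q z) (hch : Complex.cosh z ≠ 0) (hc : Complex.cos z ≠ 0) :
    HasDerivAt (fun w => (P w / Complex.cosh w ^ 3 * (Complex.sin w / Complex.cos w ^ 2)
        - (Q w / Complex.cosh w ^ 3 - 3 * P w * Complex.sinh w / Complex.cosh w ^ 4)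
          / Complex.cos w) / 2)
      (P z / (Complex.cosh z * Complex.cos z) ^ 3
        + -1 * ((q / Complex.cosh z ^ 3 - 6 * Q z * Complex.sinh z / Complex.cosh z ^ 4
          + 10 * P z / Complex.cosh z ^ 3 - 12 * P z / Complex.cosh z ^ 5) / 2
            / Complex.cos z)) z := by
  have hC := Complex.hasDerivAt_cos z
  have hS := Complex.hasDerivAt_sin z
  have hCh := Complex.hasDerivAt_cosh z
  have hSh := Complex.hasDerivAt_sinh z
  have key := (((hP.div (hCh.pow 3) (pow_ne_zero 3 hch)).mul
    (hS.div (hC.pow 2) (pow_ne_zero 2 hc))).sub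
    (((hQ.div (hCh.pow 3) (pow_ne_zero 3 hch)).sub
      (((hP.const_mul 3).mul hSh).div (hCh.pow 4) (pow_ne_zero 4 hch))).div hC hc)).div_const 2
  refine key.congr_deriv ?_
  have e1 := Complex.sin_sq z
  have e2 := Complex.sinh_sq z
  simp only [Pi.div_apply, Pi.mul_apply, Pi.pow_apply, Pi.sub_apply]
  norm_num
  field_simp
  generalize Complex.cos z = C at *
  generalize Complex.sin z = S at *
  generalize Complex.cosh z = Ch at *
  generalize Complex.sinh z = Sh at *
  ring_nf
  simp only [e1, e2]
  ring

theorem triangleIntegral_pow_div_cosh_mul_cos (a : ℕ) {N : ℕ} (hN : N ≠ 0) :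
    triangleIntegral (N * π) (fun z => z ^ a / (Complex.cosh z * Complex.cos z) ^ 3) =
      2 * π * Complex.I * ∑ n ∈ Finset.range N,
        (-1) ^ (n + 1) * residueDensity a (((2 * (n : ℝ) + 1) / 2 * π : ℝ) : ℂ) := by
  set R : ℝ := N * π with hRdef
  have hRpos : 0 < R := by positivity
  obtain ⟨r, hr0, hr⟩ : ∃ r : ℝ, 0 ≤ r ∧ r ^ 2 = R ^ 2 + π ^ 2 / 4 :=
    ⟨√(R ^ 2 + π ^ 2 / 4), Real.sqrt_nonneg _, Real.sq_sqrt (by positivity)⟩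
  have hRr : R < r := by nlinarith [pi_pos]
  have hrR : r < R + π / 2 := by nlinarith [pi_pos, mul_pos hRpos pi_pos]
  set pole : ℕ → ℝ := fun n => (2 * (n : ℝ) + 1) / 2 * π with hpole
  have hpole_inj : Function.Injective pole := fun m n h => by
    have := mul_right_cancel₀ pi_ne_zero h
    have : (m : ℝ) = n := by linarith
    exact_mod_cast this
  have hlt : ∀ n : ℕ, pole n < R ↔ n < N := fun n => by
    simp only [hpole, hRdef]
    rw [mul_lt_mul_iff_left₀ pi_pos, div_lt_iff₀ two_pos]
    constructor
    · intro h
      have : (2 * n + 1 : ℕ) < N * 2 := by exact_mod_cast h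
      omega
    · intro h
      have : (2 * n + 1 : ℕ) < N * 2 := by omega
      exact_mod_cast this
  have hne : ∀ n : ℕ, pole n ≠ R := fun n h => by
    have h1 := mul_right_cancel₀ pi_ne_zero h
    rw [div_eq_iff two_ne_zero] at h1
    have : (2 * n + 1 : ℕ) = N * 2 := by exact_mod_cast h1
    omega
  have hpos : ∀ n : ℕ, 0 < pole n := fun n => by positivity
  set S : Finset ℝ := (Finset.range (2 * N)).image pole with hS
  have hSmem : ∀ p ∈ S, 0 < p ∧ p ≠ R ∧ (p : ℂ) ∈ Metric.ball (R : ℂ) r := by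
    intro p hp
    obtain ⟨n, hn, rfl⟩ := Finset.mem_image.1 hp
    refine ⟨hpos n, hne n, ?_⟩
    rw [mem_ball_iff_norm, ← Complex.ofReal_sub, Complex.norm_real, Real.norm_eq_abs]
    refine lt_of_lt_of_le ?_ hRr.le
    have h2 : pole n < 2 * R := by
      have : ((n : ℝ) + 1) ≤ 2 * N := by exact_mod_cast Finset.mem_range.1 hn
      simp only [hpole, hRdef]
      nlinarith [pi_pos, mul_le_mul_of_nonneg_right this pi_pos.le]
    rw [abs_lt]
    constructor <;> linarith [hpos n]
  have hcosS : ∀ z ∈ Metric.ball (R : ℂ) r \ ((fun p : ℝ => (p : ℂ)) '' S),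
      Complex.cos z ≠ 0 := by
    rintro z ⟨hz, hzS⟩ h
    obtain ⟨n, hn, rfl⟩ := eq_of_cos_eq_zero_of_mem_ball hrR hz h
    exact hzS ⟨_, Finset.mem_coe.2 (Finset.mem_image_of_mem pole (Finset.mem_range.2 hn)), rfl⟩
  have hB : triangleBoundary R ⊆ Metric.ball (R : ℂ) r \ ((fun p : ℝ => (p : ℂ)) '' S) :=
    fun z hz => ⟨triangleBoundary_subset_ball hRr hz, by
      rintro ⟨p, hp, rfl⟩
      obtain ⟨h0, h1, -⟩ := hSmem p hp
      exact ne_ofReal_of_mem_triangleBoundary h0 h1 hz rfl⟩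
  have hH : DifferentiableOn ℂ (residueDensity a) (Metric.ball (R : ℂ) r) := fun z hz => by
    have := cosh_ne_zero_of_mem_ball hr hz
    unfold residueDensity
    refine DifferentiableAt.differentiableWithinAt ?_
    fun_prop (disch := simp [this])
  have hHcos : DifferentiableOn ℂ (fun z => residueDensity a z / Complex.cos z)
      (Metric.ball (R : ℂ) r \ ((fun p : ℝ => (p : ℂ)) '' S)) :=
    (hH.mono Set.sdiff_subset).div Complex.differentiable_cos.differentiableOn hcosS
  have hF : ContinuousOn (fun z => z ^ a / (Complex.cosh z * Complex.cos z) ^ 3)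
      (triangleBoundary R) := fun z hz => by
    have h1 := cosh_ne_zero_of_mem_ball hr (hB hz).1
    have h2 := hcosS z (hB hz)
    refine ContinuousAt.continuousWithinAt ?_
    fun_prop (disch := simp [h1, h2])
  have hHB := hHcos.continuousOn.mono hB
  have hexact := triangleIntegral_eq_zero_of_hasDerivAt hRpos.le
    (fun z hz => hasDerivAt_sec_wronskian (hasDerivAt_pow a z)
      ((hasDerivAt_pow (a - 1) z).const_mul (a : ℂ)) (cosh_ne_zero_of_mem_ball hr (hB hz).1)
      (hcosS z (hB hz))) (hF.add (continuousOn_const.mul hHB))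
  have hadd := triangleIntegral_add (g := fun z => -1 * (residueDensity a z / Complex.cos z))
    hRpos.le hF (continuousOn_const.mul hHB)
  rw [triangleIntegral_const_mul] at hadd
  have heq : triangleIntegral R (fun z => z ^ a / (Complex.cosh z * Complex.cos z) ^ 3) =
      triangleIntegral R (fun z => residueDensity a z / Complex.cos z) := by
    have := hadd.symm.trans hexact
    linear_combination this
  rw [heq, triangleIntegral_eq_sum_of_simple_poles hRpos.le hRr S
    (fun p => -residueDensity a p / Real.sin p) hSmem hHcos]
  · congr 1
    have hfilter : ({p ∈ S | p < R} : Finset ℝ) = (Finset.range N).image pole := by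
      ext p
      simp only [hS, Finset.mem_filter, Finset.mem_image, Finset.mem_range]
      constructor
      · rintro ⟨⟨n, -, rfl⟩, h⟩
        exact ⟨n, (hlt n).1 h, rfl⟩
      · rintro ⟨n, hn, rfl⟩
        exact ⟨⟨n, by omega, rfl⟩, (hlt n).2 hn⟩
    rw [hfilter, Finset.sum_image hpole_inj.injOn]
    refine Finset.sum_congr rfl fun n _ => ?_
    simp only [hpole, sin_half_odd_mul_pi]
    have h1 : ((-1 : ℂ) ^ n) * (-1) ^ n = 1 := by rw [← mul_pow]; norm_num
    rw [Complex.ofReal_pow, Complex.ofReal_neg, Complex.ofReal_one,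
      div_eq_iff (pow_ne_zero _ (by norm_num)), pow_succ]
    linear_combination residueDensity a _ * h1
  · intro p hp
    obtain ⟨n, hn, rfl⟩ := Finset.mem_image.1 hp
    exact tendsto_sub_mul_div_cos
      (hH.differentiableAt (Metric.isOpen_ball.mem_nhds (hSmem _ hp).2.2)).continuousAt
      (cos_half_odd_mul_pi n)

theorem cos_add_cosh_pos (x : ℝ) : 0 < Real.cos x + Real.cosh x := by
  rcases eq_or_ne x 0 with rfl | hx
  · norm_num
  · linarith [Real.one_lt_cosh.2 hx, Real.neg_one_le_cos x]

theorem continuous_pow_div_cos_add_cosh (a : ℕ) :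
    Continuous fun x : ℝ => x ^ a / (Real.cos x + Real.cosh x) ^ 3 :=
  (continuous_pow a).div (by fun_prop) fun x => (pow_pos (cos_add_cosh_pos x) 3).ne'

theorem exp_div_four_le_sinh {x : ℝ} (hx : 1 ≤ x) : Real.exp x / 4 ≤ Real.sinh x := by
  have h1 : 2 ≤ Real.exp x := by linarith [Real.add_one_le_exp x]
  have h2 : Real.exp (-x) ≤ 1 := Real.exp_le_one_iff.2 (by linarith)
  rw [Real.sinh_eq]
  linarith

theorem one_le_sinh {x : ℝ} (hx : 1 ≤ x) : 1 ≤ Real.sinh x :=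
  hx.trans (Real.self_le_sinh_iff.2 (by linarith))

theorem integrableOn_pow_div_cos_add_cosh (a : ℕ) :
    MeasureTheory.IntegrableOn (fun x : ℝ => x ^ a / (Real.cos x + Real.cosh x) ^ 3)
      (Set.Ioi 0) := by
  refine integrable_of_isBigO_exp_neg (b := 1) one_pos
    (continuous_pow_div_cos_add_cosh a).continuousOn ?_
  have h1 : (fun x : ℝ => x ^ a) =O[Filter.atTop] fun x => Real.exp (1 * x) :=
    (isLittleO_pow_exp_pos_mul_atTop a one_pos).isBigO
  have h2 : (fun x : ℝ => ((Real.cos x + Real.cosh x) ^ 3)⁻¹) =O[Filter.atTop]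
      fun x => Real.exp (-2 * x) := by
    refine Asymptotics.IsBigO.of_bound 64 ?_
    filter_upwards [Filter.eventually_ge_atTop 2] with x hx
    have h3 : Real.exp x / 4 ≤ Real.cos x + Real.cosh x := by
      have hq : (4 : ℝ) ≤ Real.exp x := by
        have h5 := Real.add_one_le_exp 1
        have h6 : Real.exp (1 + 1) = Real.exp 1 * Real.exp 1 := Real.exp_add 1 1
        have h7 : Real.exp (1 + 1) ≤ Real.exp x := Real.exp_le_exp.2 (by linarith)
        nlinarith
      have := Real.neg_one_le_cos x
      rw [Real.cosh_eq]
      linarith [Real.exp_pos (-x)]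
    rw [Real.norm_of_nonneg (inv_nonneg.2 (pow_pos (cos_add_cosh_pos x) 3).le),
      Real.norm_of_nonneg (Real.exp_pos _).le]
    calc ((Real.cos x + Real.cosh x) ^ 3)⁻¹ ≤ ((Real.exp x / 4) ^ 3)⁻¹ := by gcongr
      _ = 64 * Real.exp (-(3 * x)) := by
        rw [div_pow, inv_div, Real.exp_neg, ← Real.exp_nat_mul]; norm_num; rfl
      _ ≤ 64 * Real.exp (-2 * x) := by gcongr; linarith
  refine (h1.mul h2).congr (fun x => by rw [div_eq_mul_inv]) fun x => ?_
  rw [← Real.exp_add]; ring_nf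

theorem two_mul_cosh_mul_cos_diagonal {c : ℂ} (hc : c = (1 + Complex.I) / 2 ∨
    c = (1 - Complex.I) / 2) (x : ℂ) :
    2 * (Complex.cosh (x * c) * Complex.cos (x * c)) = Complex.cos x + Complex.cosh x := by
  rw [← Complex.cos_mul_I x, Complex.cos_add_cos, ← Complex.cos_mul_I (x * c)]
  have hI := Complex.I_mul_I
  rcases hc with rfl | rfl
  · rw [show x * ((1 + Complex.I) / 2) * Complex.I = -((x - x * Complex.I) / 2) by
      linear_combination x / 2 * hI, Complex.cos_neg]
    rw [show x * ((1 + Complex.I) / 2) = (x + x * Complex.I) / 2 by ring]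
    ring
  · rw [show x * ((1 - Complex.I) / 2) * Complex.I = (x + x * Complex.I) / 2 by
      linear_combination -x / 2 * hI]
    rw [show x * ((1 - Complex.I) / 2) = (x - x * Complex.I) / 2 by ring]
    ring

theorem segIntegral_diagonal (a : ℕ) {c : ℂ} (hc : c = (1 + Complex.I) / 2 ∨
    c = (1 - Complex.I) / 2) (X : ℝ) :
    segIntegral (fun z => z ^ a / (Complex.cosh z * Complex.cos z) ^ 3) 0 (X * c) =
      8 * c ^ (a + 1) *
        ((∫ x in (0 : ℝ)..X, x ^ a / (Real.cos x + Real.cosh x) ^ 3 : ℝ) : ℂ) := by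
  have h := intervalIntegral.mul_integral_comp_mul_right (a := 0) (b := 1)
    (f := fun x : ℝ => x ^ a / (Real.cos x + Real.cosh x) ^ 3) X
  rw [zero_mul, one_mul] at h
  rw [← h, ← intervalIntegral.integral_const_mul, ← intervalIntegral.integral_ofReal, segIntegral,
    ← intervalIntegral.integral_const_mul]
  refine intervalIntegral.integral_congr fun t _ => ?_
  have e := two_mul_cosh_mul_cos_diagonal hc ((t * X : ℝ) : ℂ)
  have hne : Complex.cos ((t * X : ℝ) : ℂ) + Complex.cosh ((t * X : ℝ) : ℂ) ≠ 0 := by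
    exact_mod_cast (cos_add_cosh_pos (t * X)).ne'
  have e' : Complex.cosh (((t * X : ℝ) : ℂ) * c) * Complex.cos (((t * X : ℝ) : ℂ) * c) =
      (Complex.cos ((t * X : ℝ) : ℂ) + Complex.cosh ((t * X : ℝ) : ℂ)) / 2 := by
    rw [← e]; ring
  have e2 : (0 : ℂ) + t * (X * c - 0) = ((t * X : ℝ) : ℂ) * c := by push_cast; ring
  simp only [e2, e']
  push_cast at hne ⊢
  field_simp
  ring

theorem segIntegral_swap (f : ℂ → ℂ) (a b : ℂ) : segIntegral f b a = -segIntegral f a b := by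
  have h := intervalIntegral.integral_comp_sub_left (a := 0) (b := 1)
    (fun t : ℝ => f (a + t * (b - a)) * (b - a)) 1
  rw [sub_self, sub_zero] at h
  rw [segIntegral, segIntegral, ← h, ← intervalIntegral.integral_neg]
  refine intervalIntegral.integral_congr fun t _ => ?_
  have e : a + ((1 - t : ℝ) : ℂ) * (b - a) = b + t * (a - b) := by push_cast; ring
  simp only [e]
  ring

theorem norm_segIntegral_le {f : ℂ → ℂ} {a b : ℂ} {s : Set ℂ} {C : ℝ}
    (hs : Set.MapsTo (fun t : ℝ => a + t * (b - a)) (Set.Icc 0 1) s) (hC : ∀ z ∈ s, ‖f z‖ ≤ C) :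
    ‖segIntegral f a b‖ ≤ C * ‖b - a‖ := by
  have := intervalIntegral.norm_integral_le_of_norm_le_const (a := 0) (b := 1)
    (f := fun t : ℝ => f (a + t * (b - a)) * (b - a)) (C := C * ‖b - a‖) (fun t ht => by
      rw [Set.uIoc_of_le zero_le_one] at ht
      rw [norm_mul]
      gcongr
      exact hC _ (hs ⟨ht.1.le, ht.2⟩))
  simpa [segIntegral] using this

theorem sinh_re_le_norm_cosh (z : ℂ) : Real.sinh z.re ≤ ‖Complex.cosh z‖ := by
  have h := norm_sub_norm_le (Complex.exp z) (-Complex.exp (-z))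
  rw [sub_neg_eq_add, norm_neg, Complex.norm_exp, Complex.norm_exp, Complex.neg_re] at h
  rw [Complex.cosh, norm_div, Complex.norm_two, Real.sinh_eq]
  gcongr

theorem one_le_norm_cos_of_re_eq {N : ℕ} {z : ℂ} (hz : z.re = N * π) : 1 ≤ ‖Complex.cos z‖ := by
  have e : z = (N * π : ℂ) + z.im * Complex.I := by
    conv_lhs => rw [← Complex.re_add_im z, hz]
    push_cast; ring
  have hcos : Complex.cos (N * π) = (-1) ^ N := by
    exact_mod_cast congrArg Complex.ofReal (Real.cos_nat_mul_pi N)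
  have e1 : Complex.cos z = ((-1) ^ N * Real.cosh z.im : ℝ) := by
    rw [e, Complex.cos_add, Complex.sin_nat_mul_pi, hcos, Complex.cos_mul_I]
    simp
  rw [e1, Complex.norm_real, norm_mul, norm_pow, norm_neg, norm_one, one_pow, one_mul,
    Real.norm_of_nonneg (Real.cosh_pos _).le]
  exact Real.one_le_cosh _

theorem norm_segIntegral_right_le (a : ℕ) {N : ℕ} (hN : N ≠ 0) :
    ‖segIntegral (fun z => z ^ a / (Complex.cosh z * Complex.cos z) ^ 3)
        (((N * π : ℝ) : ℂ) - ((N * π : ℝ) : ℂ) * Complex.I)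
        (((N * π : ℝ) : ℂ) + ((N * π : ℝ) : ℂ) * Complex.I)‖ ≤
      4 * 2 ^ (a + 1) * ((N * π) ^ (a + 1) * Real.exp (-(N * π))) := by
  set R : ℝ := N * π with hR
  have hR1 : 1 ≤ R := by
    have : (1 : ℝ) ≤ N := by exact_mod_cast Nat.one_le_iff_ne_zero.2 hN
    nlinarith [pi_gt_three]
  have hR0 : 0 ≤ R := by linarith
  have hbound : ∀ z ∈ {z : ℂ | |z.im| ≤ R ∧ z.re = R},
      ‖z ^ a / (Complex.cosh z * Complex.cos z) ^ 3‖ ≤ (2 * R) ^ a / (Real.exp R / 4) := by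
    rintro z ⟨him, hre⟩
    have h1 : ‖z‖ ≤ 2 * R := by
      refine (Complex.norm_le_abs_re_add_abs_im z).trans ?_
      rw [hre, abs_of_nonneg hR0]
      linarith
    have h2 : Real.sinh R ≤ ‖Complex.cosh z‖ := hre ▸ sinh_re_le_norm_cosh z
    have h3 : 1 ≤ ‖Complex.cos z‖ := one_le_norm_cos_of_re_eq (hre.trans hR)
    have h4 : Real.sinh R ≤ ‖Complex.cosh z‖ * ‖Complex.cos z‖ :=
      h2.trans (le_mul_of_one_le_right (norm_nonneg _) h3)
    have h5 : Real.exp R / 4 ≤ (‖Complex.cosh z‖ * ‖Complex.cos z‖) ^ 3 :=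
      (exp_div_four_le_sinh hR1).trans <| h4.trans <|
        le_self_pow₀ ((one_le_sinh hR1).trans h4) (by norm_num)
    rw [norm_div, norm_pow, norm_pow, norm_mul]
    gcongr
  refine (norm_segIntegral_le (mapsTo_right_side hR0) hbound).trans_eq ?_
  have e : ‖((R : ℂ) + R * Complex.I) - (R - R * Complex.I)‖ = 2 * R := by
    rw [show ((R : ℂ) + R * Complex.I) - (R - R * Complex.I) = ((2 * R : ℝ) : ℂ) * Complex.I by
      push_cast; ring, norm_mul, Complex.norm_I, mul_one, Complex.norm_real,
      Real.norm_of_nonneg (by linarith)]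
  rw [e, Real.exp_neg]
  field_simp
  ring

theorem tendsto_triangleIntegral (a : ℕ) :
    Filter.Tendsto (fun N : ℕ => triangleIntegral (N * π)
        (fun z => z ^ a / (Complex.cosh z * Complex.cos z) ^ 3)) Filter.atTop
      (nhds (8 * (((1 - Complex.I) / 2) ^ (a + 1) - ((1 + Complex.I) / 2) ^ (a + 1)) *
        ((∫ x in Set.Ioi (0 : ℝ), x ^ a / (Real.cos x + Real.cosh x) ^ 3 : ℝ) : ℂ))) := by
  have hNpi : Filter.Tendsto (fun N : ℕ => (N : ℝ) * π) Filter.atTop Filter.atTop :=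
    tendsto_natCast_atTop_atTop.atTop_mul_const pi_pos
  have hJ := (Complex.continuous_ofReal.tendsto _).comp
    (MeasureTheory.intervalIntegral_tendsto_integral_Ioi 0 (integrableOn_pow_div_cos_add_cosh a)
      (hNpi.const_mul_atTop two_pos))
  have hside : Filter.Tendsto (fun N : ℕ =>
      segIntegral (fun z => z ^ a / (Complex.cosh z * Complex.cos z) ^ 3)
        (((N * π : ℝ) : ℂ) - ((N * π : ℝ) : ℂ) * Complex.I)
        (((N * π : ℝ) : ℂ) + ((N * π : ℝ) : ℂ) * Complex.I)) Filter.atTop (nhds 0) := by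
    have h0 := ((Real.tendsto_pow_mul_exp_neg_atTop_nhds_zero (a + 1)).comp hNpi).const_mul
      (4 * 2 ^ (a + 1))
    rw [mul_zero] at h0
    refine squeeze_zero_norm' ?_ h0
    filter_upwards [Filter.eventually_ne_atTop 0] with N hN
    exact norm_segIntegral_right_le a hN
  have key := (hside.add (hJ.const_mul
    (8 * (((1 - Complex.I) / 2) ^ (a + 1) - ((1 + Complex.I) / 2) ^ (a + 1)))))
  rw [zero_add] at key
  refine key.congr fun N => ?_
  have e1 : ((N * π : ℝ) : ℂ) - ((N * π : ℝ) : ℂ) * Complex.I =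
      ((2 * (N * π) : ℝ) : ℂ) * ((1 - Complex.I) / 2) := by push_cast; ring
  have e2 : ((N * π : ℝ) : ℂ) + ((N * π : ℝ) : ℂ) * Complex.I =
      ((2 * (N * π) : ℝ) : ℂ) * ((1 + Complex.I) / 2) := by push_cast; ring
  rw [triangleIntegral, segIntegral_swap _ 0, e1, e2, segIntegral_diagonal a (Or.inr rfl),
    segIntegral_diagonal a (Or.inl rfl)]
  simp only [Function.comp_apply]
  ring

theorem summable_of_abs_le_pow_div_cosh (a : ℕ) {t : ℕ → ℝ}
    (ht : ∀ n : ℕ, |t n| ≤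
      4 * ((n : ℝ) + 1) ^ a / Real.cosh ((2 * (n : ℝ) + 1) / 2 * π)) : Summable t := by
  have h := ((summable_nat_add_iff 1).2
    (Real.summable_pow_mul_exp_neg_nat_mul a one_pos)).mul_left 8
  refine Summable.of_norm_bounded h fun n => (ht n).trans ?_
  have hn : (0 : ℝ) ≤ n := n.cast_nonneg
  have h1 : (n : ℝ) + 1 ≤ (2 * (n : ℝ) + 1) / 2 * π := by nlinarith [pi_gt_three]
  have h2 : Real.exp ((n : ℝ) + 1) / 2 ≤ Real.cosh ((2 * (n : ℝ) + 1) / 2 * π) := by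
    rw [Real.cosh_eq]
    have := Real.exp_le_exp.2 h1
    linarith [Real.exp_pos (-((2 * (n : ℝ) + 1) / 2 * π))]
  calc 4 * ((n : ℝ) + 1) ^ a / Real.cosh ((2 * (n : ℝ) + 1) / 2 * π)
      ≤ 4 * ((n : ℝ) + 1) ^ a / (Real.exp ((n : ℝ) + 1) / 2) := by gcongr
    _ = 8 * ((((n + 1 : ℕ) : ℝ)) ^ a * Real.exp (-1 * ((n + 1 : ℕ) : ℝ))) := by
      rw [neg_one_mul, Real.exp_neg]
      push_cast
      field_simp
      norm_num

theorem half_odd_rpow_sub_le (a : ℕ) (n k : ℕ) (hk : k ≤ 2) :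
    ((2 * (n : ℝ) + 1) / 2) ^ ((a : ℝ) - k) ≤ 4 * ((n : ℝ) + 1) ^ a := by
  have hn : (0 : ℝ) ≤ n := n.cast_nonneg
  have hu : 0 < (2 * (n : ℝ) + 1) / 2 := by positivity
  rw [Real.rpow_sub hu, Real.rpow_natCast, Real.rpow_natCast, div_le_iff₀ (by positivity)]
  have h1 : ((2 * (n : ℝ) + 1) / 2) ^ a ≤ ((n : ℝ) + 1) ^ a := by gcongr; linarith
  have h2 : 1 ≤ 4 * ((2 * (n : ℝ) + 1) / 2) ^ k := by
    interval_cases k <;> nlinarith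
  nlinarith [pow_pos (by linarith : 0 < (n : ℝ) + 1) a]

theorem abs_alternating_le (n : ℕ) {x B y c : ℝ} (hx : 0 ≤ x) (hxB : x ≤ B) (hy : |y| ≤ c⁻¹) :
    |(-1 : ℝ) ^ (n + 1) * x * y| ≤ B / c := by
  rw [abs_mul, abs_mul, abs_pow, abs_neg, abs_one, one_pow, one_mul, abs_of_nonneg hx,
    div_eq_mul_inv]
  gcongr
  exact hx.trans hxB

theorem inv_cosh_pow_le {k : ℕ} (hk : k ≠ 0) (x : ℝ) :
    |(Real.cosh x ^ k)⁻¹| ≤ (Real.cosh x)⁻¹ := by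
  have := Real.cosh_pos x
  rw [abs_of_nonneg (by positivity)]
  gcongr
  exact le_self_pow₀ (Real.one_le_cosh x) hk

theorem abs_sinh_div_cosh_pow_four_le (x : ℝ) :
    |Real.sinh x * (Real.cosh x ^ 4)⁻¹| ≤ (Real.cosh x)⁻¹ := by
  have hc := Real.cosh_pos x
  have hs : |Real.sinh x| ≤ Real.cosh x :=
    abs_le_of_sq_le_sq (by rw [Real.sinh_sq]; linarith) hc.le
  have h3 : |(Real.cosh x ^ 3)⁻¹| ≤ (Real.cosh x)⁻¹ := inv_cosh_pow_le (by norm_num) x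
  rw [abs_mul, abs_of_pos (by positivity : 0 < (Real.cosh x ^ 4)⁻¹)]
  rw [abs_of_pos (by positivity)] at h3
  calc |Real.sinh x| * (Real.cosh x ^ 4)⁻¹ ≤ Real.cosh x * (Real.cosh x ^ 4)⁻¹ := by gcongr
    _ = (Real.cosh x ^ 3)⁻¹ := by field_simp
    _ ≤ _ := h3

theorem residueDensity_mul_pi (a : ℕ) {u : ℝ} (hu : 0 < u) :
    residueDensity a ((u * π : ℝ) : ℂ) = (π : ℂ) ^ a / 2 *
      ((a : ℂ) * ((a : ℂ) - 1) / (π : ℂ) ^ 2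
          * ((u ^ ((a : ℝ) - 2) / Real.cosh (u * π) ^ 3 : ℝ) : ℂ)
        - 6 * (a : ℂ) / π
          * ((u ^ ((a : ℝ) - 1) * Real.sinh (u * π) / Real.cosh (u * π) ^ 4 : ℝ) : ℂ)
        + 10 * ((u ^ (a : ℝ) / Real.cosh (u * π) ^ 3 : ℝ) : ℂ)
        - 12 * ((u ^ (a : ℝ) / Real.cosh (u * π) ^ 5 : ℝ) : ℂ)) := by
  have hπ : (π : ℂ) ≠ 0 := by exact_mod_cast pi_ne_zero
  have hu' : (u : ℂ) ≠ 0 := by exact_mod_cast hu.ne'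
  have hc : Complex.cosh (u * π) ≠ 0 := by exact_mod_cast (Real.cosh_pos (u * π)).ne'
  have hz : ((u * π : ℝ) : ℂ) ≠ 0 := by exact_mod_cast (mul_pos hu pi_pos).ne'
  have h1 : (a : ℂ) * ((u * π : ℝ) : ℂ) ^ (a - 1) =
      a * (((u * π : ℝ) : ℂ) ^ a / ((u * π : ℝ) : ℂ)) := by
    rcases a with _ | a
    · simp
    · rw [Nat.add_sub_cancel, pow_succ, mul_div_cancel_right₀ _ hz]
  have h2 : (a : ℂ) * ((a - 1 : ℕ) * ((u * π : ℝ) : ℂ) ^ (a - 1 - 1)) =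
      a * (a - 1) * (((u * π : ℝ) : ℂ) ^ a / ((u * π : ℝ) : ℂ) ^ 2) := by
    rcases a with _ | _ | a
    · simp
    · simp
    · rw [show a + 1 + 1 = a + 2 from rfl, pow_add, mul_div_cancel_right₀ _ (pow_ne_zero 2 hz),
        show a + 2 - 1 - 1 = a by omega, show a + 2 - 1 = a + 1 by omega]
      push_cast
      ring
  rw [residueDensity, h1, h2, Real.rpow_sub hu, Real.rpow_sub hu, Real.rpow_natCast,
    Real.rpow_one, Real.rpow_two]
  push_cast
  rw [mul_pow]
  field_simp

theorem contour_relation_cos_plus_cosh (a : ℕ) :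
    ((1 - Complex.I ^ (a+1)) / ((π : ℂ) ^ ((a : ℤ) - 1) * (1 + Complex.I) ^ ((a : ℤ) - 1))) *
      ((∫ x in Set.Ioi (0:ℝ), x ^ a / (Real.cos x + Real.cosh x) ^ 3 : ℝ) : ℂ) =
    -((a : ℂ) * ((a : ℂ) - 1) / 4) *
        ((∑' n : ℕ, (-1 : ℝ) ^ (n+1) * ((2*(n:ℝ)+1)/2) ^ ((a : ℝ) - 2)
            / Real.cosh (((2*(n:ℝ)+1)/2) * π) ^ 3 : ℝ) : ℂ)
    - (5 * (π : ℂ) ^ 2 / 2) *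
        ((∑' n : ℕ, (-1 : ℝ) ^ (n+1) * ((2*(n:ℝ)+1)/2) ^ ((a : ℝ))
            / Real.cosh (((2*(n:ℝ)+1)/2) * π) ^ 3 : ℝ) : ℂ)
    + (3 * (a : ℂ) * (π : ℂ) / 2) *
        ((∑' n : ℕ, (-1 : ℝ) ^ (n+1) * ((2*(n:ℝ)+1)/2) ^ ((a : ℝ) - 1)
            * Real.sinh (((2*(n:ℝ)+1)/2) * π) / Real.cosh (((2*(n:ℝ)+1)/2) * π) ^ 4 : ℝ) : ℂ)
    + 3 * (π : ℂ) ^ 2 *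
        ((∑' n : ℕ, (-1 : ℝ) ^ (n+1) * ((2*(n:ℝ)+1)/2) ^ ((a : ℝ))
            / Real.cosh (((2*(n:ℝ)+1)/2) * π) ^ 5 : ℝ) : ℂ) := by
  have hu : ∀ n : ℕ, 0 < (2 * (n : ℝ) + 1) / 2 := fun n => by positivity
  have hs1 : Summable fun n : ℕ => (-1 : ℝ) ^ (n+1) * ((2*(n:ℝ)+1)/2) ^ ((a : ℝ) - 2)
      / Real.cosh (((2*(n:ℝ)+1)/2) * π) ^ 3 :=
    summable_of_abs_le_pow_div_cosh a fun n => by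
      rw [div_eq_mul_inv]
      exact abs_alternating_le n (Real.rpow_nonneg (hu n).le _)
        (by exact_mod_cast half_odd_rpow_sub_le a n 2 le_rfl) (inv_cosh_pow_le (by norm_num) _)
  have hpow : ∀ n : ℕ, ((2*(n:ℝ)+1)/2) ^ (a : ℝ) ≤ 4 * ((n : ℝ) + 1) ^ a := fun n => by
    simpa using half_odd_rpow_sub_le a n 0 (by norm_num)
  have hs2 : Summable fun n : ℕ => (-1 : ℝ) ^ (n+1) * ((2*(n:ℝ)+1)/2) ^ ((a : ℝ))
      / Real.cosh (((2*(n:ℝ)+1)/2) * π) ^ 3 :=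
    summable_of_abs_le_pow_div_cosh a fun n => by
      rw [div_eq_mul_inv]
      exact abs_alternating_le n (Real.rpow_nonneg (hu n).le _) (hpow n)
        (inv_cosh_pow_le (by norm_num) _)
  have hs3 : Summable fun n : ℕ => (-1 : ℝ) ^ (n+1) * ((2*(n:ℝ)+1)/2) ^ ((a : ℝ) - 1)
      * Real.sinh (((2*(n:ℝ)+1)/2) * π) / Real.cosh (((2*(n:ℝ)+1)/2) * π) ^ 4 :=
    summable_of_abs_le_pow_div_cosh a fun n => by
      rw [div_eq_mul_inv, mul_assoc]
      exact abs_alternating_le n (Real.rpow_nonneg (hu n).le _)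
        (by simpa using half_odd_rpow_sub_le a n 1 (by norm_num))
        (abs_sinh_div_cosh_pow_four_le _)
  have hs4 : Summable fun n : ℕ => (-1 : ℝ) ^ (n+1) * ((2*(n:ℝ)+1)/2) ^ ((a : ℝ))
      / Real.cosh (((2*(n:ℝ)+1)/2) * π) ^ 5 :=
    summable_of_abs_le_pow_div_cosh a fun n => by
      rw [div_eq_mul_inv]
      exact abs_alternating_le n (Real.rpow_nonneg (hu n).le _) (hpow n)
        (inv_cosh_pow_le (by norm_num) _)
  have hsum := ((((Complex.hasSum_ofReal.2 hs1.hasSum).mul_left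
      ((a : ℂ) * ((a : ℂ) - 1) / (π : ℂ) ^ 2)).sub
    ((Complex.hasSum_ofReal.2 hs3.hasSum).mul_left (6 * (a : ℂ) / π))).add
    ((Complex.hasSum_ofReal.2 hs2.hasSum).mul_left 10)).sub
    ((Complex.hasSum_ofReal.2 hs4.hasSum).mul_left 12)
  have hlim := (hsum.mul_left (2 * π * Complex.I * ((π : ℂ) ^ a / 2))).tendsto_sum_nat
  have heq := tendsto_nhds_unique (tendsto_triangleIntegral a) (hlim.congr' (by
    filter_upwards [Filter.eventually_ne_atTop 0] with N hN
    rw [triangleIntegral_pow_div_cosh_mul_cos a hN, Finset.mul_sum]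
    refine Finset.sum_congr rfl fun n _ => ?_
    rw [residueDensity_mul_pi a (hu n)]
    push_cast
    ring))
  generalize (∑' n : ℕ, (-1 : ℝ) ^ (n+1) * ((2*(n:ℝ)+1)/2) ^ ((a : ℝ) - 2)
      / Real.cosh (((2*(n:ℝ)+1)/2) * π) ^ 3) = S₁ at *
  generalize (∑' n : ℕ, (-1 : ℝ) ^ (n+1) * ((2*(n:ℝ)+1)/2) ^ ((a : ℝ))
      / Real.cosh (((2*(n:ℝ)+1)/2) * π) ^ 3) = S₂ at *
  generalize (∑' n : ℕ, (-1 : ℝ) ^ (n+1) * ((2*(n:ℝ)+1)/2) ^ ((a : ℝ) - 1)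
      * Real.sinh (((2*(n:ℝ)+1)/2) * π) / Real.cosh (((2*(n:ℝ)+1)/2) * π) ^ 4) = S₃ at *
  generalize (∑' n : ℕ, (-1 : ℝ) ^ (n+1) * ((2*(n:ℝ)+1)/2) ^ ((a : ℝ))
      / Real.cosh (((2*(n:ℝ)+1)/2) * π) ^ 5) = S₄ at *
  generalize (∫ x in Set.Ioi (0:ℝ), x ^ a / (Real.cos x + Real.cosh x) ^ 3) = J at *
  have hπ : (π : ℂ) ≠ 0 := by exact_mod_cast pi_ne_zero
  have hI : (1 : ℂ) + Complex.I ≠ 0 := fun h => by simpa using congrArg Complex.re h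
  have hII := Complex.I_mul_I
  have hcoef : (1 - Complex.I ^ (a+1)) /
      ((π : ℂ) ^ ((a : ℤ) - 1) * (1 + Complex.I) ^ ((a : ℤ) - 1)) =
      2 * Complex.I * (((1 - Complex.I) / 2) ^ (a + 1) - ((1 + Complex.I) / 2) ^ (a + 1)) * π
        / (π : ℂ) ^ a := by
    have e1 : ((1 - Complex.I) / 2) ^ (a + 1) = 1 / (1 + Complex.I) ^ (a + 1) := by
      rw [eq_div_iff (pow_ne_zero _ hI), ← mul_pow,
        show (1 - Complex.I) / 2 * (1 + Complex.I) = 1 by linear_combination -1 / 2 * hII,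
        one_pow]
    have e2 : ((1 + Complex.I) / 2) ^ (a + 1) = Complex.I ^ (a + 1) / (1 + Complex.I) ^ (a + 1) := by
      rw [eq_div_iff (pow_ne_zero _ hI), ← mul_pow,
        show (1 + Complex.I) / 2 * (1 + Complex.I) = Complex.I by linear_combination 1 / 2 * hII]
    have e3 : (1 + Complex.I) ^ (a + 1) = (1 + Complex.I) ^ a * (1 + Complex.I) := pow_succ _ _
    rw [zpow_sub_one₀ hπ, zpow_sub_one₀ hI, zpow_natCast, zpow_natCast, e1, e2, e3]
    field_simp
    linear_combination (1 - Complex.I ^ (a + 1)) * hII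
  rw [hcoef]
  have hπa := pow_ne_zero a hπ
  have hrw : 2 * Complex.I * (((1 - Complex.I) / 2) ^ (a + 1) - ((1 + Complex.I) / 2) ^ (a + 1))
      * π / (π : ℂ) ^ a * (J : ℂ) = Complex.I / 4 * π / (π : ℂ) ^ a *
        (8 * (((1 - Complex.I) / 2) ^ (a + 1) - ((1 + Complex.I) / 2) ^ (a + 1)) * (J : ℂ)) := by
    ring
  rw [hrw, heq]
  field_simp
  rw [Complex.I_sq]
  ring
end
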